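/- Let K₀, v₀ > 0 and let g⁰ be a smooth complete metric on ℝ^n with n = 2 satisfying |R| ≤ K₀ everywhere and vol(B(x,1)) ≥ v₀ for every x ∈ ℝ² (balls and volume taken with respect to g⁰). Let g₁ and g₂ be two smooth time-dependent metrics on ℝ² over [0,T], each solving the Ricci flow, each complete for every t ∈ [0,T], and both equal to g⁰ at t = 0. Then g₁(x,t) = g₂(x,t) for all x ∈ ℝ² and all 0 ≤ t ≤ min{T, 1/K₀}. -/

import Mathlib

open Set MeasureTheory
open scoped BigOperators Matrix

noncomputable section

variable {n : ℕ}

/-- Partial derivative of `f` at `x` in the `i`-th coordinate direction. -/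
def pd (f : (Fin n → ℝ) → ℝ) (i : Fin n) (x : Fin n → ℝ) : ℝ :=
  fderiv ℝ f x (Pi.single i 1)

/-- Christoffel symbols `Γ^k_{ij}` of a (time-independent) metric `G`. -/
def christoffel (G : (Fin n → ℝ) → Matrix (Fin n) (Fin n) ℝ)
    (x : Fin n → ℝ) (k i j : Fin n) : ℝ :=
  (1/2) * ∑ l, (G x)⁻¹ k l *
    (pd (fun y => G y j l) i x + pd (fun y => G y i l) j x - pd (fun y => G y i j) l x)

/-- Ricci tensor `R_{jk}`. -/
def ricci (G : (Fin n → ℝ) → Matrix (Fin n) (Fin n) ℝ)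
    (x : Fin n → ℝ) (j k : Fin n) : ℝ :=
  ∑ i, (pd (fun y => christoffel G y i j k) i x
      - pd (fun y => christoffel G y i i k) j x
      + ∑ p, (christoffel G x i i p * christoffel G x p j k
            - christoffel G x i j p * christoffel G x p i k))

/-- Scalar curvature. -/
def scalarCurv (G : (Fin n → ℝ) → Matrix (Fin n) (Fin n) ℝ) (x : Fin n → ℝ) : ℝ :=
  ∑ j, ∑ k, (G x)⁻¹ j k * ricci G x j k

/-- Riemann tensor `R_{ijkl}`. -/
def riemann (G : (Fin n → ℝ) → Matrix (Fin n) (Fin n) ℝ)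
    (x : Fin n → ℝ) (i j k l : Fin n) : ℝ :=
  ∑ m, G x l m *
    (pd (fun y => christoffel G y m j k) i x - pd (fun y => christoffel G y m i k) j x
      + ∑ p, (christoffel G x m i p * christoffel G x p j k
            - christoffel G x m j p * christoffel G x p i k))

/-- Norm of the Riemann tensor. -/
def riemNorm (G : (Fin n → ℝ) → Matrix (Fin n) (Fin n) ℝ) (x : Fin n → ℝ) : ℝ :=
  Real.sqrt (∑ i, ∑ j, ∑ k, ∑ l, ∑ a, ∑ b, ∑ c, ∑ d,
    (G x)⁻¹ i a * (G x)⁻¹ j b * (G x)⁻¹ k c * (G x)⁻¹ l d *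
      riemann G x i j k l * riemann G x a b c d)

/-- Sectional curvature of the plane spanned by `u`, `v`. -/
def sectionalCurv (G : (Fin n → ℝ) → Matrix (Fin n) (Fin n) ℝ)
    (x : Fin n → ℝ) (u v : Fin n → ℝ) : ℝ :=
  (∑ i, ∑ j, ∑ k, ∑ l, riemann G x i j k l * u i * v j * v k * u l) /
    ((∑ i, ∑ j, G x i j * u i * u j) * (∑ i, ∑ j, G x i j * v i * v j)
      - (∑ i, ∑ j, G x i j * u i * v j) ^ 2)

/-- Length of a path with respect to the metric `G`. -/
def pathLength (G : (Fin n → ℝ) → Matrix (Fin n) (Fin n) ℝ)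
    (γ : ℝ → (Fin n → ℝ)) : ℝ :=
  ∫ s in (0:ℝ)..1, Real.sqrt (∑ i, ∑ j, G (γ s) i j * deriv γ s i * deriv γ s j)

/-- Riemannian distance: infimum of lengths of C¹ paths. -/
def riemDist (G : (Fin n → ℝ) → Matrix (Fin n) (Fin n) ℝ)
    (x y : Fin n → ℝ) : ℝ :=
  sInf {L : ℝ | ∃ γ : ℝ → (Fin n → ℝ),
    ContDiffOn ℝ 1 γ (Icc 0 1) ∧ γ 0 = x ∧ γ 1 = y ∧ L = pathLength G γ}

/-- Metric ball. -/
def rBall (G : (Fin n → ℝ) → Matrix (Fin n) (Fin n) ℝ)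
    (x₀ : Fin n → ℝ) (r : ℝ) : Set (Fin n → ℝ) :=
  {x | riemDist G x₀ x < r}

/-- Completeness of `(ℝⁿ, riemDist G)`. -/
def riemComplete (G : (Fin n → ℝ) → Matrix (Fin n) (Fin n) ℝ) : Prop :=
  ∀ u : ℕ → (Fin n → ℝ),
    (∀ ε > (0:ℝ), ∃ N, ∀ p ≥ N, ∀ q ≥ N, riemDist G (u p) (u q) < ε) →
    ∃ x, ∀ ε > (0:ℝ), ∃ N, ∀ p ≥ N, riemDist G (u p) x < ε

/-- Riemannian volume of a set. -/
def riemVol (G : (Fin n → ℝ) → Matrix (Fin n) (Fin n) ℝ)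
    (S : Set (Fin n → ℝ)) : ℝ :=
  ∫ x in S, Real.sqrt ((G x).det)

/-- A smooth (time-independent) Riemannian metric. -/
def SmoothMetric (G : (Fin n → ℝ) → Matrix (Fin n) (Fin n) ℝ) : Prop :=
  (∀ i j, ContDiff ℝ (⊤ : ℕ∞) (fun x => G x i j)) ∧ ∀ x, (G x).IsSymm ∧ (G x).PosDef

/-- A smooth time-dependent metric over the time interval `I`. -/
def SmoothMetricFamily (g : (Fin n → ℝ) → ℝ → Matrix (Fin n) (Fin n) ℝ)
    (I : Set ℝ) : Prop :=
  (∀ i j, ContDiffOn ℝ (⊤ : ℕ∞) (fun p : (Fin n → ℝ) × ℝ => g p.1 p.2 i j) (univ ×ˢ I)) ∧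
  ∀ x : Fin n → ℝ, ∀ t ∈ I, (g x t).IsSymm ∧ (g x t).PosDef

/-- The Ricci flow equation `∂ₜ g = -2 Ric` over the time interval `I`. -/
def IsRicciFlow (g : (Fin n → ℝ) → ℝ → Matrix (Fin n) (Fin n) ℝ)
    (I : Set ℝ) : Prop :=
  ∀ x : Fin n → ℝ, ∀ t ∈ I, ∀ j k,
    derivWithin (fun s => g x s j k) I t = -2 * ricci (fun y => g y t) x j k

/-- `lam ≥ mu ≥ nu` are the eigenvalues of the 3×3 matrix `M`
(characterized via the characteristic polynomial). -/
def IsEigTriple (M : Matrix (Fin 3) (Fin 3) ℝ) (lam mu nu : ℝ) : Prop :=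
  nu ≤ mu ∧ mu ≤ lam ∧
  ∀ z : ℝ, (z • (1 : Matrix (Fin 3) (Fin 3) ℝ) - M).det = (z - lam) * (z - mu) * (z - nu)

/-- Hamilton's curvature operator `g^{il}(R g_{lj} - 2 R_{lj})` in dimension 3. -/
def curvOp (G : (Fin 3 → ℝ) → Matrix (Fin 3) (Fin 3) ℝ) (x : Fin 3 → ℝ) :
    Matrix (Fin 3) (Fin 3) ℝ :=
  Matrix.of fun i j => ∑ l, (G x)⁻¹ i l * (scalarCurv G x * G x l j - 2 * ricci G x l j)

section PartialDerivatives

variable {f g : (Fin n → ℝ) → ℝ} {x : Fin n → ℝ}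

lemma pd_add (hf : DifferentiableAt ℝ f x) (hg : DifferentiableAt ℝ g x) (i : Fin n) :
    pd (fun y => f y + g y) i x = pd f i x + pd g i x := by
  simp only [pd]; rw [fderiv_fun_add hf hg]; rfl

lemma pd_sub (hf : DifferentiableAt ℝ f x) (hg : DifferentiableAt ℝ g x) (i : Fin n) :
    pd (fun y => f y - g y) i x = pd f i x - pd g i x := by
  simp only [pd]; rw [fderiv_fun_sub hf hg]; rfl

lemma pd_neg (i : Fin n) : pd (fun y => -f y) i x = -pd f i x := by
  simp only [pd]; rw [fderiv_fun_neg]; rfl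

lemma pd_mul (hf : DifferentiableAt ℝ f x) (hg : DifferentiableAt ℝ g x) (i : Fin n) :
    pd (fun y => f y * g y) i x = f x * pd g i x + g x * pd f i x := by
  simp only [pd]; rw [fderiv_fun_mul hf hg]; simp

lemma pd_const_mul (c : ℝ) (hf : DifferentiableAt ℝ f x) (i : Fin n) :
    pd (fun y => c * f y) i x = c * pd f i x := by
  simp only [pd]; rw [fderiv_const_mul hf]; simp

lemma pd_const (c : ℝ) (i : Fin n) : pd (fun _ => c) i x = 0 := by
  simp [pd]

lemma pd_sum {ι : Type*} (s : Finset ι) {F : ι → (Fin n → ℝ) → ℝ}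
    (hF : ∀ k ∈ s, DifferentiableAt ℝ (F k) x) (i : Fin n) :
    pd (fun y => ∑ k ∈ s, F k y) i x = ∑ k ∈ s, pd (F k) i x := by
  simp only [pd]; rw [fderiv_fun_sum hF]; simp

lemma pd_comp {φ : ℝ → ℝ} {φ' : ℝ} (hφ : HasDerivAt φ φ' (f x)) (hf : DifferentiableAt ℝ f x)
    (i : Fin n) : pd (fun y => φ (f y)) i x = φ' * pd f i x := by
  simp only [pd]
  have := (hφ.comp_hasFDerivAt x hf.hasFDerivAt).fderiv
  have h2 : (fun y => φ (f y)) = φ ∘ f := rfl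
  rw [h2, this]; simp

lemma contDiff_pd (hf : ContDiff ℝ (⊤ : ℕ∞) f) (i : Fin n) :
    ContDiff ℝ (⊤ : ℕ∞) (pd f i) := by
  have : ContDiff ℝ (⊤ : ℕ∞) (fderiv ℝ f) := hf.fderiv_right (by simp)
  exact this.clm_apply contDiff_const

lemma pd_comm (hf : ContDiff ℝ (⊤ : ℕ∞) f) (i j : Fin n) (x : Fin n → ℝ) :
    pd (pd f i) j x = pd (pd f j) i x := by
  have hs : IsSymmSndFDerivAt ℝ f x := by
    apply (hf.contDiffAt).isSymmSndFDerivAt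
    simp only [minSmoothness_of_isRCLikeNormedField]
    exact WithTop.coe_le_coe.2 (le_top : (2 : ℕ∞) ≤ ⊤)
  have h2 : DifferentiableAt ℝ (fderiv ℝ f) x := by
    have : ContDiff ℝ (⊤ : ℕ∞) (fderiv ℝ f) := hf.fderiv_right (by simp)
    exact this.differentiable (by simp) x
  have key : ∀ a b : Fin n, pd (pd f a) b x =
      fderiv ℝ (fderiv ℝ f) x (Pi.single b 1) (Pi.single a 1) := by
    intro a b
    change fderiv ℝ (fun y => fderiv ℝ f y (Pi.single a 1)) x (Pi.single b 1) = _
    rw [fderiv_clm_apply h2 (differentiableAt_const _)]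
    simp
  rw [key, key, hs.eq]

end PartialDerivatives

lemma ContDiff.differentiableAt_top {E F : Type*} [NormedAddCommGroup E] [NormedSpace ℝ E]
    [NormedAddCommGroup F] [NormedSpace ℝ F] {f : E → F} (hf : ContDiff ℝ (⊤ : ℕ∞) f) (x : E) :
    DifferentiableAt ℝ f x := hf.differentiable (by simp) x

namespace SmoothMetric

variable {G : (Fin 2 → ℝ) → Matrix (Fin 2) (Fin 2) ℝ}

lemma symm (h : SmoothMetric G) (x : Fin 2 → ℝ) : G x 1 0 = G x 0 1 := (h.2 x).1.apply 0 1

lemma diag_pos (h : SmoothMetric G) (x : Fin 2 → ℝ) : 0 < G x 0 0 := (h.2 x).2.diag_pos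

lemma det_eq (h : SmoothMetric G) (x : Fin 2 → ℝ) :
    (G x).det = G x 0 0 * G x 1 1 - G x 0 1 ^ 2 := by
  rw [Matrix.det_fin_two, h.symm]; ring

lemma det_pos (h : SmoothMetric G) (x : Fin 2 → ℝ) :
    0 < G x 0 0 * G x 1 1 - G x 0 1 ^ 2 := by
  rw [← h.det_eq]; exact (h.2 x).2.det_pos

lemma inv_apply (h : SmoothMetric G) (x : Fin 2 → ℝ) :
    (G x)⁻¹ 0 0 = G x 1 1 / (G x 0 0 * G x 1 1 - G x 0 1 ^ 2) ∧
    (G x)⁻¹ 0 1 = - G x 0 1 / (G x 0 0 * G x 1 1 - G x 0 1 ^ 2) ∧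
    (G x)⁻¹ 1 0 = - G x 0 1 / (G x 0 0 * G x 1 1 - G x 0 1 ^ 2) ∧
    (G x)⁻¹ 1 1 = G x 0 0 / (G x 0 0 * G x 1 1 - G x 0 1 ^ 2) := by
  rw [Matrix.inv_def, h.det_eq, Matrix.adjugate_fin_two, Ring.inverse_eq_inv']
  simp [h.symm]
  refine ⟨?_, ?_, ?_⟩ <;> ring

lemma contDiff_inv (h : SmoothMetric G) (a b : Fin 2) :
    ContDiff ℝ (⊤ : ℕ∞) (fun x => (G x)⁻¹ a b) := by
  have hD : ContDiff ℝ (⊤ : ℕ∞) (fun x => G x 0 0 * G x 1 1 - G x 0 1 ^ 2) :=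
    ((h.1 0 0).mul (h.1 1 1)).sub ((h.1 0 1).pow 2)
  have hD0 : ∀ x, G x 0 0 * G x 1 1 - G x 0 1 ^ 2 ≠ 0 := fun x => (h.det_pos x).ne'
  have h00 : (fun x => (G x)⁻¹ 0 0) = _ := funext fun x => (h.inv_apply x).1
  have h01 : (fun x => (G x)⁻¹ 0 1) = _ := funext fun x => (h.inv_apply x).2.1
  have h10 : (fun x => (G x)⁻¹ 1 0) = _ := funext fun x => (h.inv_apply x).2.2.1
  have h11 : (fun x => (G x)⁻¹ 1 1) = _ := funext fun x => (h.inv_apply x).2.2.2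
  fin_cases a <;> fin_cases b
  · exact h00 ▸ (h.1 1 1).div hD hD0
  · exact h01 ▸ (h.1 0 1).neg.div hD hD0
  · exact h10 ▸ (h.1 0 1).neg.div hD hD0
  · exact h11 ▸ (h.1 0 0).div hD hD0

lemma inv_mul_self (h : SmoothMetric G) (x : Fin 2 → ℝ) : (G x)⁻¹ * G x = 1 :=
  Matrix.nonsing_inv_mul _ ((h.2 x).2.isUnit.map Matrix.detMonoidHom)

lemma mul_inv_self (h : SmoothMetric G) (x : Fin 2 → ℝ) : G x * (G x)⁻¹ = 1 :=
  Matrix.mul_nonsing_inv _ ((h.2 x).2.isUnit.map Matrix.detMonoidHom)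

lemma pd_inv (h : SmoothMetric G) (a b i : Fin 2) (x : Fin 2 → ℝ) :
    pd (fun y => (G y)⁻¹ a b) i x =
      -∑ c, ∑ d, (G x)⁻¹ a c * pd (fun y => G y c d) i x * (G x)⁻¹ d b := by
  have key : ∀ e, ∑ c, (pd (fun y => (G y)⁻¹ a c) i x * G x c e
      + (G x)⁻¹ a c * pd (fun y => G y c e) i x) = 0 := by
    intro e
    have h1 : (fun y => ∑ c, (G y)⁻¹ a c * G y c e) = fun _ => (1 : Matrix (Fin 2) (Fin 2) ℝ) a e := by
      funext y; rw [← h.inv_mul_self y, Matrix.mul_apply]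
    have h2 : pd (fun y => ∑ c, (G y)⁻¹ a c * G y c e) i x = 0 := by rw [h1, pd_const]
    rw [pd_sum _ (fun k _ => ((h.contDiff_inv a k).mul (h.1 k e)).differentiableAt_top x)] at h2
    rw [← h2]
    refine Finset.sum_congr rfl fun c _ => ?_
    rw [pd_mul ((h.contDiff_inv a c).differentiableAt_top x) ((h.1 c e).differentiableAt_top x)]
    ring
  have k0 := key 0
  have k1 := key 1
  have m : ∀ c, ∑ e, G x c e * (G x)⁻¹ e b = (1 : Matrix (Fin 2) (Fin 2) ℝ) c b := by
    intro c; rw [← h.mul_inv_self x, Matrix.mul_apply]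
  have m0 := m 0
  have m1 := m 1
  have e1 : pd (fun y => (G y)⁻¹ a b) i x
      = ∑ c, pd (fun y => (G y)⁻¹ a c) i x * (1 : Matrix (Fin 2) (Fin 2) ℝ) c b := by
    fin_cases b <;> simp [Matrix.one_apply]
  rw [e1]
  simp only [Fin.sum_univ_two] at *
  rw [← m0, ← m1]
  linear_combination (G x)⁻¹ 0 b * k0 + (G x)⁻¹ 1 b * k1

lemma pd_christoffel (h : SmoothMetric G) (k i j e : Fin 2) (x : Fin 2 → ℝ) :
    pd (fun y => christoffel G y k i j) e x =
      (1/2) * ∑ l, ((G x)⁻¹ k l * (pd (pd (fun y => G y j l) i) e x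
          + pd (pd (fun y => G y i l) j) e x - pd (pd (fun y => G y i j) l) e x)
        + (-∑ c, ∑ d, (G x)⁻¹ k c * pd (fun y => G y c d) e x * (G x)⁻¹ d l) *
          (pd (fun y => G y j l) i x + pd (fun y => G y i l) j x
            - pd (fun y => G y i j) l x)) := by
  unfold christoffel
  have D : ∀ a b c, DifferentiableAt ℝ (pd (fun y => G y a b) c) x := fun a b c =>
    (contDiff_pd (h.1 a b) c).differentiableAt_top x
  have I : ∀ a b, DifferentiableAt ℝ (fun y => (G y)⁻¹ a b) x := fun a b =>
    (h.contDiff_inv a b).differentiableAt_top x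
  have S : ∀ l, DifferentiableAt ℝ (fun y => pd (fun y => G y j l) i y + pd (fun y => G y i l) j y
      - pd (fun y => G y i j) l y) x := fun l => ((D _ _ _).add (D _ _ _)).sub (D _ _ _)
  rw [pd_const_mul _ (DifferentiableAt.fun_sum fun l _ => (I k l).fun_mul (S l)),
    pd_sum _ (fun l _ => (I k l).fun_mul (S l))]
  congr 1
  refine Finset.sum_congr rfl fun l _ => ?_
  rw [pd_mul (I k l) (S l), pd_sub ((D _ _ _).fun_add (D _ _ _)) (D _ _ _), pd_add (D _ _ _) (D _ _ _),
    h.pd_inv]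
  ring

lemma contDiff_christoffel (h : SmoothMetric G) (k i j : Fin 2) :
    ContDiff ℝ (⊤ : ℕ∞) (fun x => christoffel G x k i j) := by
  unfold christoffel
  refine contDiff_const.mul (ContDiff.sum fun l _ => (h.contDiff_inv k l).mul ?_)
  exact ((contDiff_pd (h.1 _ _) _).add (contDiff_pd (h.1 _ _) _)).sub (contDiff_pd (h.1 _ _) _)

end SmoothMetric

/-- The Gauss curvature of a two dimensional metric as a rational function of its `2`-jet. -/
def gaussJet (a b c a0 a1 b0 b1 c0 c1 a11 b01 c00 : ℝ) : ℝ :=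
  ((a * c - b ^ 2) * ((2 * b01 - a11 - c00) / 2)
    + c * (a1 / 2 * (a1 / 2) - a0 / 2 * (b1 - c0 / 2))
    - b * (2 * (a1 / 2) * (c0 / 2) - a0 / 2 * (c1 / 2) - (b0 - a1 / 2) * (b1 - c0 / 2))
    + a * (c0 / 2 * (c0 / 2) - (b0 - a1 / 2) * (c1 / 2))) / (a * c - b ^ 2) ^ 2

/-- The Gauss curvature of a two dimensional metric. -/
def gaussCurv (G : (Fin 2 → ℝ) → Matrix (Fin 2) (Fin 2) ℝ) (x : Fin 2 → ℝ) : ℝ :=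
  gaussJet (G x 0 0) (G x 0 1) (G x 1 1)
    (pd (fun y => G y 0 0) 0 x) (pd (fun y => G y 0 0) 1 x)
    (pd (fun y => G y 0 1) 0 x) (pd (fun y => G y 0 1) 1 x)
    (pd (fun y => G y 1 1) 0 x) (pd (fun y => G y 1 1) 1 x)
    (pd (pd (fun y => G y 0 0) 1) 1 x) (pd (pd (fun y => G y 0 1) 0) 1 x)
    (pd (pd (fun y => G y 1 1) 0) 0 x)

namespace SmoothMetric

variable {G : (Fin 2 → ℝ) → Matrix (Fin 2) (Fin 2) ℝ}

set_option maxHeartbeats 4000000 in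
lemma ricci_eq_gaussCurv (h : SmoothMetric G) (x : Fin 2 → ℝ) (j k : Fin 2) :
    ricci G x j k = gaussCurv G x * G x j k := by
  have hD := (h.det_pos x).ne'
  obtain ⟨i00, i01, i10, i11⟩ := h.inv_apply x
  have c0 := pd_comm (h.1 0 0) 0 1 x
  have c1 := pd_comm (h.1 0 1) 0 1 x
  have c2 := pd_comm (h.1 1 1) 0 1 x
  unfold ricci gaussCurv
  simp only [h.pd_christoffel]
  simp only [christoffel, Fin.sum_univ_two]
  fin_cases j <;> fin_cases k <;>
    simp only [Fin.zero_eta, Fin.mk_one, Fin.isValue, h.symm, i00, i01, i10, i11] <;>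
    rw [← c1] <;> (try rw [← c0]) <;> (try rw [← c2]) <;>
    generalize pd (pd (fun y => G y 0 0) 0) 1 x = a01 at * <;>
    generalize pd (pd (fun y => G y 0 0) 1) 1 x = a11 at * <;>
    generalize pd (pd (fun y => G y 0 0) 0) 0 x = a00 at * <;>
    generalize pd (pd (fun y => G y 0 1) 0) 1 x = b01 at * <;>
    generalize pd (pd (fun y => G y 0 1) 1) 1 x = b11 at * <;>
    generalize pd (pd (fun y => G y 0 1) 0) 0 x = b00 at * <;>
    generalize pd (pd (fun y => G y 1 1) 0) 1 x = c01 at * <;>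
    generalize pd (pd (fun y => G y 1 1) 1) 1 x = c11 at * <;>
    generalize pd (pd (fun y => G y 1 1) 0) 0 x = c00 at * <;>
    generalize pd (fun y => G y 0 0) 0 x = a0 at * <;>
    generalize pd (fun y => G y 0 0) 1 x = a1 at * <;>
    generalize pd (fun y => G y 0 1) 0 x = b0 at * <;>
    generalize pd (fun y => G y 0 1) 1 x = b1 at * <;>
    generalize pd (fun y => G y 1 1) 0 x = c0 at * <;>
    generalize pd (fun y => G y 1 1) 1 x = c1 at * <;>
    generalize G x 0 0 = a at * <;>
    generalize G x 0 1 = b at * <;>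
    generalize G x 1 1 = c at * <;>
    unfold gaussJet
  all_goals generalize hDD : a * c - b ^ 2 = D at *
  all_goals field_simp
  all_goals subst hDD
  all_goals ring

lemma scalarCurv_eq (h : SmoothMetric G) (x : Fin 2 → ℝ) :
    scalarCurv G x = 2 * gaussCurv G x := by
  have hD := (h.det_pos x).ne'
  obtain ⟨i00, i01, i10, i11⟩ := h.inv_apply x
  simp only [scalarCurv, h.ricci_eq_gaussCurv, Fin.sum_univ_two, i00, i01, i10, i11, h.symm]
  generalize gaussCurv G x = k
  generalize hDD : G x 0 0 * G x 1 1 - G x 0 1 ^ 2 = D at *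
  field_simp
  subst hDD
  ring

end SmoothMetric

/-- The first order part of the Laplacian of `G`, i.e. the Laplacian of the coordinates. -/
def drift (G : (Fin 2 → ℝ) → Matrix (Fin 2) (Fin 2) ℝ) (x : Fin 2 → ℝ) (a : Fin 2) : ℝ :=
  -∑ c, ∑ d, (G x)⁻¹ c d * christoffel G x a c d

/-- The Laplace-Beltrami operator. -/
def lap (G : (Fin 2 → ℝ) → Matrix (Fin 2) (Fin 2) ℝ) (u : (Fin 2 → ℝ) → ℝ) (x : Fin 2 → ℝ) : ℝ :=
  ∑ a, ∑ b, (G x)⁻¹ a b * pd (pd u a) b x + ∑ a, drift G x a * pd u a x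

namespace SmoothMetric

variable {G : (Fin 2 → ℝ) → Matrix (Fin 2) (Fin 2) ℝ}

lemma contDiff_drift (h : SmoothMetric G) (a : Fin 2) :
    ContDiff ℝ (⊤ : ℕ∞) (fun x => drift G x a) :=
  (ContDiff.sum fun c _ => ContDiff.sum fun d _ =>
    (h.contDiff_inv c d).mul (h.contDiff_christoffel a c d)).neg

lemma pd_drift (h : SmoothMetric G) (a e : Fin 2) (x : Fin 2 → ℝ) :
    pd (fun y => drift G y a) e x = -∑ c, ∑ d, ((G x)⁻¹ c d * pd (fun y => christoffel G y a c d) e x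
      + christoffel G x a c d * pd (fun y => (G y)⁻¹ c d) e x) := by
  have D : ∀ c d, DifferentiableAt ℝ (fun y => (G y)⁻¹ c d * christoffel G y a c d) x := fun c d =>
    ((h.contDiff_inv c d).mul (h.contDiff_christoffel a c d)).differentiableAt_top x
  unfold drift
  rw [pd_neg, pd_sum _ fun c _ => DifferentiableAt.fun_sum fun d _ => D c d]
  congr 1
  refine Finset.sum_congr rfl fun c _ => ?_
  rw [pd_sum _ fun d _ => D c d]
  refine Finset.sum_congr rfl fun d _ => ?_
  rw [pd_mul ((h.contDiff_inv c d).differentiableAt_top x)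
    ((h.contDiff_christoffel a c d).differentiableAt_top x)]

set_option maxHeartbeats 8000000 in
/-- Trace of the second variation of the energy density in a parallel orthonormal frame. -/
lemma trace_second_variation (h : SmoothMetric G) (x ξ : Fin 2 → ℝ) :
    (∑ a, ∑ b, ∑ c, ∑ d, (G x)⁻¹ c d * pd (pd (fun y => G y a b) c) d x * ξ a * ξ b)
    + (∑ a, ∑ b, ∑ c, drift G x c * pd (fun y => G y a b) c x * ξ a * ξ b)
    - 4 * (∑ a, ∑ b, ∑ c, ∑ e, ∑ f, pd (fun y => G y a b) c x * ξ a *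
        christoffel G x b e f * ξ e * (G x)⁻¹ c f)
    + 2 * (∑ a, ∑ b, ∑ c, ∑ d, ∑ e, ∑ f, G x a b * christoffel G x a e c *
        christoffel G x b f d * ξ e * ξ f * (G x)⁻¹ c d)
    + 2 * (∑ a, ∑ b, ∑ e, G x a b * ξ a * pd (fun y => drift G y b) e x * ξ e)
    = -2 * gaussCurv G x * ∑ a, ∑ b, G x a b * ξ a * ξ b := by
  have hD := (h.det_pos x).ne'
  obtain ⟨i00, i01, i10, i11⟩ := h.inv_apply x
  have c0 := pd_comm (h.1 0 0) 0 1 x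
  have c1 := pd_comm (h.1 0 1) 0 1 x
  have c2 := pd_comm (h.1 1 1) 0 1 x
  unfold gaussCurv
  simp only [h.pd_drift, h.pd_christoffel, h.pd_inv]
  simp only [drift, christoffel, Fin.sum_univ_two]
  simp only [h.symm, i00, i01, i10, i11]
  rw [← c0, ← c1, ← c2]
  generalize pd (pd (fun y => G y 0 0) 0) 1 x = a01 at *
  generalize pd (pd (fun y => G y 0 0) 1) 1 x = a11 at *
  generalize pd (pd (fun y => G y 0 0) 0) 0 x = a00 at *
  generalize pd (pd (fun y => G y 0 1) 0) 1 x = b01 at *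
  generalize pd (pd (fun y => G y 0 1) 1) 1 x = b11 at *
  generalize pd (pd (fun y => G y 0 1) 0) 0 x = b00 at *
  generalize pd (pd (fun y => G y 1 1) 0) 1 x = c01 at *
  generalize pd (pd (fun y => G y 1 1) 1) 1 x = c11 at *
  generalize pd (pd (fun y => G y 1 1) 0) 0 x = c00 at *
  generalize pd (fun y => G y 0 0) 0 x = a0 at *
  generalize pd (fun y => G y 0 0) 1 x = a1 at *
  generalize pd (fun y => G y 0 1) 0 x = b0 at *
  generalize pd (fun y => G y 0 1) 1 x = b1 at *
  generalize pd (fun y => G y 1 1) 0 x = c0 at *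
  generalize pd (fun y => G y 1 1) 1 x = c1 at *
  generalize G x 0 0 = a at *
  generalize G x 0 1 = b at *
  generalize G x 1 1 = c at *
  generalize ξ 0 = s
  generalize ξ 1 = t
  unfold gaussJet
  generalize hDD : a * c - b ^ 2 = D at *
  field_simp
  subst hDD
  ring


section Conformal

variable {G' : (Fin 2 → ℝ) → Matrix (Fin 2) (Fin 2) ℝ} {f : (Fin 2 → ℝ) → ℝ}

lemma pd_conformal (h : SmoothMetric G) (hf : ContDiff ℝ (⊤ : ℕ∞) f)
    (hG' : ∀ x a b, G' x a b = Real.exp (f x) * G x a b) (a b i : Fin 2) (x : Fin 2 → ℝ) :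
    pd (fun y => G' y a b) i x =
      Real.exp (f x) * (pd f i x * G x a b + pd (fun y => G y a b) i x) := by
  simp only [hG']
  rw [pd_mul (hf.exp.differentiableAt_top x) ((h.1 a b).differentiableAt_top x),
    pd_comp (Real.hasDerivAt_exp (f x)) (hf.differentiableAt_top x)]
  ring

lemma pd_pd_conformal (h : SmoothMetric G) (hf : ContDiff ℝ (⊤ : ℕ∞) f)
    (hG' : ∀ x a b, G' x a b = Real.exp (f x) * G x a b) (a b i j : Fin 2) (x : Fin 2 → ℝ) :
    pd (pd (fun y => G' y a b) i) j x =
      Real.exp (f x) * (pd f j x * (pd f i x * G x a b + pd (fun y => G y a b) i x)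
        + (pd (pd f i) j x * G x a b + pd f i x * pd (fun y => G y a b) j x
          + pd (pd (fun y => G y a b) i) j x)) := by
  have e : pd (fun y => G' y a b) i = fun x =>
      Real.exp (f x) * (pd f i x * G x a b + pd (fun y => G y a b) i x) :=
    funext (h.pd_conformal hf hG' a b i)
  have d1 := (contDiff_pd hf i).differentiableAt_top x
  have d2 := (h.1 a b).differentiableAt_top x
  have d3 := (contDiff_pd (h.1 a b) i).differentiableAt_top x
  rw [e, pd_mul (hf.exp.differentiableAt_top x) ((d1.fun_mul d2).fun_add d3),
    pd_comp (Real.hasDerivAt_exp (f x)) (hf.differentiableAt_top x),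
    pd_add (d1.fun_mul d2) d3, pd_mul d1 d2]
  ring

lemma inv_conformal (h : SmoothMetric G) (h' : SmoothMetric G')
    (hG' : ∀ x a b, G' x a b = Real.exp (f x) * G x a b) (a b : Fin 2) (x : Fin 2 → ℝ) :
    (G' x)⁻¹ a b = Real.exp (-f x) * (G x)⁻¹ a b := by
  obtain ⟨i00, i01, i10, i11⟩ := h.inv_apply x
  obtain ⟨j00, j01, j10, j11⟩ := h'.inv_apply x
  have hD := (h.det_pos x).ne'
  have hw := (Real.exp_pos (f x)).ne'
  simp only [hG'] at j00 j01 j10 j11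
  have hD' : Real.exp (f x) * G x 0 0 * (Real.exp (f x) * G x 1 1) - (Real.exp (f x) * G x 0 1) ^ 2
    = Real.exp (f x) ^ 2 * (G x 0 0 * G x 1 1 - G x 0 1 ^ 2) := by ring
  rw [hD'] at j00 j01 j10 j11
  rw [Real.exp_neg]
  generalize G x 0 0 * G x 1 1 - G x 0 1 ^ 2 = D at *
  fin_cases a <;> fin_cases b <;>
    simp only [Fin.zero_eta, Fin.mk_one, Fin.isValue, i00, i01, i10, i11, j00, j01, j10, j11] <;>
    field_simp

set_option maxHeartbeats 4000000 in
lemma lap_conformal (h : SmoothMetric G) (h' : SmoothMetric G') (hf : ContDiff ℝ (⊤ : ℕ∞) f)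
    (hG' : ∀ x a b, G' x a b = Real.exp (f x) * G x a b) (u : (Fin 2 → ℝ) → ℝ) (x : Fin 2 → ℝ) :
    lap G' u x = Real.exp (-f x) * lap G u x := by
  have hD := (h.det_pos x).ne'
  have hw := (Real.exp_pos (f x)).ne'
  obtain ⟨i00, i01, i10, i11⟩ := h.inv_apply x
  unfold lap drift christoffel
  simp only [h.inv_conformal h' hG', h.pd_conformal hf hG', Fin.sum_univ_two, h.symm,
    i00, i01, i10, i11, Real.exp_neg]
  generalize pd (fun y => G y 0 0) 0 x = a0 at *
  generalize pd (fun y => G y 0 0) 1 x = a1 at *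
  generalize pd (fun y => G y 0 1) 0 x = b0 at *
  generalize pd (fun y => G y 0 1) 1 x = b1 at *
  generalize pd (fun y => G y 1 1) 0 x = c0 at *
  generalize pd (fun y => G y 1 1) 1 x = c1 at *
  generalize G x 0 0 = a at *
  generalize G x 0 1 = b at *
  generalize G x 1 1 = c at *
  generalize Real.exp (f x) = w at *
  generalize hDD : a * c - b ^ 2 = D at *
  field_simp
  subst hDD
  ring

set_option maxHeartbeats 4000000 in
lemma gaussCurv_conformal (h : SmoothMetric G) (hf : ContDiff ℝ (⊤ : ℕ∞) f)
    (hG' : ∀ x a b, G' x a b = Real.exp (f x) * G x a b) (x : Fin 2 → ℝ) :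
    gaussCurv G' x = Real.exp (-f x) * (gaussCurv G x - lap G f x / 2) := by
  have hD := (h.det_pos x).ne'
  have hw := (Real.exp_pos (f x)).ne'
  obtain ⟨i00, i01, i10, i11⟩ := h.inv_apply x
  have c0 := pd_comm hf 0 1 x
  unfold gaussCurv gaussJet lap drift christoffel
  simp only [h.pd_pd_conformal hf hG', h.pd_conformal hf hG', Fin.sum_univ_two, h.symm,
    i00, i01, i10, i11, Real.exp_neg, ← c0]
  simp only [hG']
  generalize pd (pd (fun y => G y 0 0) 1) 1 x = a11 at *
  generalize pd (pd (fun y => G y 0 1) 0) 1 x = b01 at *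
  generalize pd (pd (fun y => G y 1 1) 0) 0 x = c00 at *
  generalize pd (fun y => G y 0 0) 0 x = a0 at *
  generalize pd (fun y => G y 0 0) 1 x = a1 at *
  generalize pd (fun y => G y 0 1) 0 x = b0 at *
  generalize pd (fun y => G y 0 1) 1 x = b1 at *
  generalize pd (fun y => G y 1 1) 0 x = c0 at *
  generalize pd (fun y => G y 1 1) 1 x = c1 at *
  generalize G x 0 0 = a at *
  generalize G x 0 1 = b at *
  generalize G x 1 1 = c at *
  generalize Real.exp (f x) = w at *
  have hD' : w * a * (w * c) - (w * b) ^ 2 = w ^ 2 * (a * c - b ^ 2) := by ring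
  rw [hD']
  generalize hDD : a * c - b ^ 2 = D at *
  field_simp
  subst hDD
  ring

end Conformal

end SmoothMetric

section Taylor

variable {E : Type*} [NormedAddCommGroup E] [NormedSpace ℝ E]

set_option maxSynthPendingDepth 5 in
set_option synthInstance.maxHeartbeats 200000 in
/-- Second order Taylor expansion with a remainder that is uniform over a compact set. -/
lemma exists_taylor_two [ProperSpace E] {f : E → ℝ} {Ω K : Set E} (hΩ : IsOpen Ω) (hK : IsCompact K)
    (hKΩ : K ⊆ Ω) (hf : ContDiffOn ℝ (⊤ : ℕ∞) f Ω) :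
    ∃ δ > 0, ∃ M, ∀ z ∈ K, ∀ d : E, ‖d‖ ≤ δ → z + d ∈ Ω ∧
      |f (z + d) - f z - fderiv ℝ f z d - fderiv ℝ (fderiv ℝ f) z d d / 2| ≤ M * ‖d‖ ^ 3 := by
  obtain ⟨δ, hδ, hKδ⟩ := hK.exists_cthickening_subset_open hΩ hKΩ
  have hf1 : ContDiffOn ℝ (⊤ : ℕ∞) (fderiv ℝ f) Ω := hf.fderiv_of_isOpen hΩ (by simp)
  have hf2 : ContDiffOn ℝ (⊤ : ℕ∞) (fderiv ℝ (fderiv ℝ f)) Ω := hf1.fderiv_of_isOpen hΩ (by simp)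
  have hf3 : ContDiffOn ℝ (⊤ : ℕ∞) (fderiv ℝ (fderiv ℝ (fderiv ℝ f))) Ω :=
    hf2.fderiv_of_isOpen hΩ (by simp)
  have D : ∀ z ∈ Ω, DifferentiableAt ℝ f z := fun z hz =>
    (hf.contDiffAt (hΩ.mem_nhds hz)).differentiableAt (by simp)
  have D1 : ∀ z ∈ Ω, DifferentiableAt ℝ (fderiv ℝ f) z := fun z hz =>
    (hf1.contDiffAt (hΩ.mem_nhds hz)).differentiableAt (by simp)
  have D2 : ∀ z ∈ Ω, DifferentiableAt ℝ (fderiv ℝ (fderiv ℝ f)) z := fun z hz =>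
    (hf2.contDiffAt (hΩ.mem_nhds hz)).differentiableAt (by simp)
  obtain ⟨M, hM⟩ := (hK.cthickening (r := δ)).exists_bound_of_continuousOn
    (hf3.continuousOn.mono hKδ)
  have hball : ∀ z ∈ K, ∀ w ∈ Metric.closedBall z δ, w ∈ Ω := fun z hz w hw =>
    hKδ (Metric.closedBall_subset_cthickening hz δ hw)
  have hM0 : ∀ z ∈ K, 0 ≤ M := fun z hz => (norm_nonneg _).trans
    (hM z (Metric.closedBall_subset_cthickening hz δ (Metric.mem_closedBall_self hδ.le)))
  refine ⟨δ, hδ, M, fun z hz d hd => ?_⟩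
  have hsub : Metric.closedBall z ‖d‖ ⊆ Metric.closedBall z δ := Metric.closedBall_subset_closedBall hd
  have hdmem : z + d ∈ Metric.closedBall z ‖d‖ := by simp
  have hzmem : z ∈ Metric.closedBall z ‖d‖ := by simp
  have cvx := convex_closedBall z ‖d‖
  have l2 : ∀ w ∈ Metric.closedBall z ‖d‖,
      ‖fderiv ℝ (fderiv ℝ f) w - fderiv ℝ (fderiv ℝ f) z‖ ≤ M * ‖d‖ := by
    intro w hw
    refine (cvx.norm_image_sub_le_of_norm_fderiv_le (𝕜 := ℝ) (C := M)
      (fun y hy => D2 y (hball z hz y (hsub hy))) (fun y hy => hM y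
        (Metric.closedBall_subset_cthickening hz δ (hsub hy))) hzmem hw).trans ?_
    gcongr
    · exact hM0 z hz
    · simpa [dist_eq_norm] using hw
  have l1 : ∀ w ∈ Metric.closedBall z ‖d‖,
      ‖fderiv ℝ f w - fderiv ℝ f z - fderiv ℝ (fderiv ℝ f) z (w - z)‖ ≤ M * ‖d‖ * ‖d‖ := by
    intro w hw
    refine (cvx.norm_image_sub_le_of_norm_hasFDerivWithin_le' (𝕜 := ℝ) (C := M * ‖d‖)
      (fun y hy => (D1 y (hball z hz y (hsub hy))).hasFDerivAt.hasFDerivWithinAt) l2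
      hzmem hw).trans ?_
    have := hM0 z hz
    gcongr
    simpa [dist_eq_norm] using hw
  refine ⟨hball z hz _ (hsub hdmem), ?_⟩
  let ψ : ℝ → ℝ := fun s => f (z + s • d) - s * fderiv ℝ f z d
    - s ^ 2 / 2 * fderiv ℝ (fderiv ℝ f) z d d
  have hw : ∀ s ∈ Icc (0:ℝ) 1, z + s • d ∈ Metric.closedBall z ‖d‖ := by
    intro s hs
    simp only [Metric.mem_closedBall, dist_self_add_left, norm_smul, Real.norm_eq_abs,
      abs_of_nonneg hs.1]
    exact mul_le_of_le_one_left (norm_nonneg _) hs.2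
  have hψ : ∀ s ∈ Icc (0:ℝ) 1, HasDerivWithinAt ψ (fderiv ℝ f (z + s • d) d - fderiv ℝ f z d
      - s * fderiv ℝ (fderiv ℝ f) z d d) (Icc 0 1) s := by
    intro s hs
    have h1 : HasDerivAt (fun s : ℝ => f (z + s • d)) (fderiv ℝ f (z + s • d) d) s := by
      have h2 : HasDerivAt (fun s : ℝ => z + s • d) d s := by
        simpa using ((hasDerivAt_id s).smul_const d).const_add z
      exact (D _ (hball z hz _ (hsub (hw s hs)))).hasFDerivAt.comp_hasDerivAt s h2
    have h3 := (h1.sub ((hasDerivAt_id s).mul_const (fderiv ℝ f z d))).sub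
      ((((hasDerivAt_id s).pow 2).div_const 2).mul_const (fderiv ℝ (fderiv ℝ f) z d d))
    refine (h3.congr_deriv ?_).hasDerivWithinAt
    simp
  have := (convex_Icc (0:ℝ) 1).norm_image_sub_le_of_norm_hasDerivWithin_le
    (C := M * ‖d‖ * ‖d‖ * ‖d‖) hψ (fun s hs => by
      have e := l1 _ (hw s hs)
      have e2 : fderiv ℝ f (z + s • d) d - fderiv ℝ f z d - s * fderiv ℝ (fderiv ℝ f) z d d
        = (fderiv ℝ f (z + s • d) - fderiv ℝ f z
          - fderiv ℝ (fderiv ℝ f) z (z + s • d - z)) d := by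
        simp
      rw [e2]
      refine (ContinuousLinearMap.le_opNorm _ _).trans ?_
      gcongr) (left_mem_Icc.2 zero_le_one) (right_mem_Icc.2 zero_le_one)
  simp only [ψ, Real.norm_eq_abs] at this
  refine (le_of_eq_of_le ?_ this).trans (le_of_eq ?_)
  · congr 1; simp; ring
  · simp; ring

end Taylor

section Expansion

variable {ι : Type*}

/-- `F h i = a i + b i * h + c i * h ^ 2 + O(h ^ 3)`, uniformly in `i`, with bounded coefficients. -/
def HasExpansion (F : ℝ → ι → ℝ) (a b c : ι → ℝ) : Prop :=
  ∃ h₀ > 0, ∃ M, ∀ i, |a i| ≤ M ∧ |b i| ≤ M ∧ |c i| ≤ M ∧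
    ∀ h, |h| ≤ h₀ → |F h i - (a i + b i * h + c i * h ^ 2)| ≤ M * |h| ^ 3

namespace HasExpansion

variable {F F' : ℝ → ι → ℝ} {a b c a' b' c' : ι → ℝ}

lemma exact {B : ℝ} (ha : ∀ i, |a i| ≤ B) (hb : ∀ i, |b i| ≤ B) (hc : ∀ i, |c i| ≤ B)
    (hF : ∀ h i, F h i = a i + b i * h + c i * h ^ 2) : HasExpansion F a b c := by
  refine ⟨1, one_pos, B, fun i => ⟨ha i, hb i, hc i, fun h _ => ?_⟩⟩
  rw [hF, sub_self, abs_zero]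
  exact mul_nonneg ((abs_nonneg _).trans (ha i)) (by positivity)

lemma add (h : HasExpansion F a b c) (h' : HasExpansion F' a' b' c') :
    HasExpansion (fun h i => F h i + F' h i) (fun i => a i + a' i) (fun i => b i + b' i)
      (fun i => c i + c' i) := by
  obtain ⟨h₀, hh, M, H⟩ := h
  obtain ⟨h₀', hh', M', H'⟩ := h'
  refine ⟨min h₀ h₀', lt_min hh hh', M + M', fun i => ?_⟩
  obtain ⟨ha, hb, hc, hF⟩ := H i
  obtain ⟨ha', hb', hc', hF'⟩ := H' i
  refine ⟨(abs_add_le _ _).trans (add_le_add ha ha'), (abs_add_le _ _).trans (add_le_add hb hb'),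
    (abs_add_le _ _).trans (add_le_add hc hc'), fun h hle => ?_⟩
  have e1 := hF h (hle.trans (min_le_left _ _))
  have e2 := hF' h (hle.trans (min_le_right _ _))
  calc _ = |(F h i - (a i + b i * h + c i * h ^ 2)) + (F' h i - (a' i + b' i * h + c' i * h ^ 2))| := by
        congr 1; ring
    _ ≤ _ := (abs_add_le _ _).trans (by linarith)

lemma mul (h : HasExpansion F a b c) (h' : HasExpansion F' a' b' c') :
    HasExpansion (fun h i => F h i * F' h i) (fun i => a i * a' i)
      (fun i => a i * b' i + b i * a' i) (fun i => a i * c' i + b i * b' i + c i * a' i) := by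
  obtain ⟨h₀, hh, M, H⟩ := h
  obtain ⟨h₀', hh', M', H'⟩ := h'
  refine ⟨min 1 (min h₀ h₀'), lt_min one_pos (lt_min hh hh'), 10 * (M * M'), fun i => ?_⟩
  obtain ⟨ha, hb, hc, hF⟩ := H i
  obtain ⟨ha', hb', hc', hF'⟩ := H' i
  have hM : 0 ≤ M := (abs_nonneg _).trans ha
  have hM' : 0 ≤ M' := (abs_nonneg _).trans ha'
  have hMM := mul_nonneg hM hM'
  have m : ∀ {x y : ℝ}, |x| ≤ M → |y| ≤ M' → |x * y| ≤ M * M' := fun hx hy => by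
    rw [abs_mul]; exact mul_le_mul hx hy (abs_nonneg _) hM
  refine ⟨(m ha ha').trans (by linarith), ?_, ?_, fun h hle => ?_⟩
  · exact (abs_add_le _ _).trans (by linarith [m ha hb', m hb ha'])
  · exact (abs_add_three _ _ _).trans (by linarith [m ha hc', m hb hb', m hc ha'])
  have h1 : |h| ≤ 1 := hle.trans (min_le_left _ _)
  have e1 := hF h (hle.trans ((min_le_right _ _).trans (min_le_left _ _)))
  have e2 := hF' h (hle.trans ((min_le_right _ _).trans (min_le_right _ _)))
  set r := F h i - (a i + b i * h + c i * h ^ 2) with hr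
  set r' := F' h i - (a' i + b' i * h + c' i * h ^ 2) with hr'
  have h0 := abs_nonneg h
  have h3 : |h| ^ 3 ≤ 1 := pow_le_one₀ h0 h1
  have h2 : |h| ^ 2 ≤ 1 := pow_le_one₀ h0 h1
  have h33 : 0 ≤ |h| ^ 3 := by positivity
  have p' : |a' i + b' i * h + c' i * h ^ 2| ≤ 3 * M' := by
    refine (abs_add_three _ _ _).trans ?_
    rw [abs_mul, abs_mul, abs_pow]
    nlinarith [abs_nonneg (b' i), abs_nonneg (c' i)]
  have p : |a i + b i * h + c i * h ^ 2| ≤ 3 * M := by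
    refine (abs_add_three _ _ _).trans ?_
    rw [abs_mul, abs_mul, abs_pow]
    nlinarith [abs_nonneg (b i), abs_nonneg (c i)]
  have key : F h i * F' h i - (a i * a' i + (a i * b' i + b i * a' i) * h
      + (a i * c' i + b i * b' i + c i * a' i) * h ^ 2)
      = (b i * c' i) * h ^ 3 + (c i * b' i) * h ^ 3 + (c i * c' i) * h ^ 4
        + (a i + b i * h + c i * h ^ 2) * r' + r * (a' i + b' i * h + c' i * h ^ 2) + r * r' := by
    rw [hr, hr']; ring
  rw [key]
  have t1 : |(b i * c' i) * h ^ 3| ≤ M * M' * |h| ^ 3 := by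
    rw [abs_mul, abs_pow]; gcongr; exact m hb hc'
  have t2 : |(c i * b' i) * h ^ 3| ≤ M * M' * |h| ^ 3 := by
    rw [abs_mul, abs_pow]; gcongr; exact m hc hb'
  have t3 : |(c i * c' i) * h ^ 4| ≤ M * M' * |h| ^ 3 := by
    rw [abs_mul, abs_pow]
    exact mul_le_mul (m hc hc') (pow_le_pow_of_le_one h0 h1 (by norm_num)) (by positivity) hMM
  have t4 : |(a i + b i * h + c i * h ^ 2) * r'| ≤ 3 * (M * M') * |h| ^ 3 := by
    rw [abs_mul]
    calc _ ≤ (3 * M) * (M' * |h| ^ 3) := mul_le_mul p e2 (abs_nonneg _) (by positivity)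
      _ = _ := by ring
  have t5 : |r * (a' i + b' i * h + c' i * h ^ 2)| ≤ 3 * (M * M') * |h| ^ 3 := by
    rw [abs_mul]
    calc _ ≤ (M * |h| ^ 3) * (3 * M') := mul_le_mul e1 p' (abs_nonneg _) (by positivity)
      _ = _ := by ring
  have t6 : |r * r'| ≤ M * M' * |h| ^ 3 := by
    rw [abs_mul]
    calc _ ≤ (M * |h| ^ 3) * (M' * |h| ^ 3) := mul_le_mul e1 e2 (abs_nonneg _) (by positivity)
      _ = (M * M' * |h| ^ 3) * |h| ^ 3 := by ring
      _ ≤ _ := mul_le_of_le_one_right (by positivity) h3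
  refine (abs_add_le _ _).trans ?_
  have s1 := abs_add_le ((b i * c' i) * h ^ 3 + (c i * b' i) * h ^ 3 + (c i * c' i) * h ^ 4
        + (a i + b i * h + c i * h ^ 2) * r') (r * (a' i + b' i * h + c' i * h ^ 2))
  have s2 := abs_add_le ((b i * c' i) * h ^ 3 + (c i * b' i) * h ^ 3 + (c i * c' i) * h ^ 4)
    ((a i + b i * h + c i * h ^ 2) * r')
  have s3 := abs_add_three ((b i * c' i) * h ^ 3) ((c i * b' i) * h ^ 3) ((c i * c' i) * h ^ 4)
  linarith

lemma congr (h : HasExpansion F a b c) (ha : ∀ i, a i = a' i) (hb : ∀ i, b i = b' i)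
    (hc : ∀ i, c i = c' i) : HasExpansion F a' b' c' := by
  rwa [← funext ha, ← funext hb, ← funext hc]

lemma zero : HasExpansion (fun _ (_ : ι) => 0) (fun _ => 0) (fun _ => 0) (fun _ => 0) :=
  exact (B := 0) (by simp) (by simp) (by simp) (by simp)

lemma sum {κ : Type*} (s : Finset κ) {F : κ → ℝ → ι → ℝ} {a b c : κ → ι → ℝ}
    (h : ∀ k, HasExpansion (F k) (a k) (b k) (c k)) :
    HasExpansion (fun h i => ∑ k ∈ s, F k h i) (fun i => ∑ k ∈ s, a k i)
      (fun i => ∑ k ∈ s, b k i) (fun i => ∑ k ∈ s, c k i) := by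
  classical
  induction s using Finset.induction_on with
  | empty => simpa using zero
  | insert k s hk ih => simpa [Finset.sum_insert hk] using (h k).add ih

end HasExpansion

end Expansion

section SpaceTime

lemma sum_smul_single (v : Fin n → ℝ) : v = ∑ i, v i • (Pi.single i 1 : Fin n → ℝ) := by
  funext j; simp [Finset.sum_apply, Pi.single_apply]

lemma fderiv_apply_eq_sum_pd (f : (Fin n → ℝ) → ℝ) (x v : Fin n → ℝ) :
    fderiv ℝ f x v = ∑ i, v i * pd f i x := by
  conv_lhs => rw [sum_smul_single v]
  simp [pd]

variable {f : (Fin n → ℝ) × ℝ → ℝ} {Ω : Set ((Fin n → ℝ) × ℝ)}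

lemma hasFDerivAt_slice (x : Fin n → ℝ) (t : ℝ) : HasFDerivAt (fun y : Fin n → ℝ => (y, t))
    (ContinuousLinearMap.inl ℝ (Fin n → ℝ) ℝ) x := by
  simpa [ContinuousLinearMap.inl] using (hasFDerivAt_id x).prodMk (hasFDerivAt_const t x)

lemma fderiv_slice {x : Fin n → ℝ} {t : ℝ} (hf : DifferentiableAt ℝ f (x, t)) (v : Fin n → ℝ) :
    fderiv ℝ f (x, t) (v, 0) = fderiv ℝ (fun y => f (y, t)) x v := by
  have h2 := (hf.hasFDerivAt (x := (x, t))).comp x (hasFDerivAt_slice x t)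
  have e : (f ∘ fun y => (y, t)) = fun y => f (y, t) := rfl
  rw [e] at h2
  rw [h2.fderiv]; simp

lemma fderiv_time {x : Fin n → ℝ} {t : ℝ} (hf : DifferentiableAt ℝ f (x, t)) :
    HasDerivAt (fun r => f (x, r)) (fderiv ℝ f (x, t) (0, 1)) t := by
  have h1 : HasDerivAt (fun r : ℝ => (x, r)) (0, 1) t :=
    (hasDerivAt_const t x).prodMk (hasDerivAt_id t)
  exact (hf.hasFDerivAt (x := (x, t))).comp_hasDerivAt t h1

lemma fderiv_eq_space_add_time {x : Fin n → ℝ} {t : ℝ} (hf : DifferentiableAt ℝ f (x, t))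
    (v : Fin n → ℝ) (s : ℝ) : fderiv ℝ f (x, t) (v, s) =
      ∑ i, v i * pd (fun y => f (y, t)) i x + s * deriv (fun r => f (x, r)) t := by
  have e : (v, s) = (v, (0:ℝ)) + s • ((0 : Fin n → ℝ), (1:ℝ)) := by simp
  rw [e, map_add, map_smul, fderiv_slice hf, (fderiv_time hf).deriv, fderiv_apply_eq_sum_pd]
  simp

lemma fderiv_fderiv_space (hΩ : IsOpen Ω) (hf : ContDiffOn ℝ (⊤ : ℕ∞) f Ω) {x : Fin n → ℝ} {t : ℝ}
    (hz : (x, t) ∈ Ω) (v : Fin n → ℝ) : fderiv ℝ (fderiv ℝ f) (x, t) (v, 0) (v, 0) =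
      ∑ i, ∑ j, v i * v j * pd (pd (fun y => f (y, t)) i) j x := by
  have hf1 : ContDiffOn ℝ (⊤ : ℕ∞) (fderiv ℝ f) Ω := hf.fderiv_of_isOpen hΩ (by simp)
  have D1 : DifferentiableAt ℝ (fderiv ℝ f) (x, t) :=
    (hf1.contDiffAt (hΩ.mem_nhds hz)).differentiableAt (by simp)
  have hcont : Continuous fun y : Fin n → ℝ => (y, t) := by fun_prop
  have key : ∀ i j, pd (pd (fun y => f (y, t)) i) j x =
      fderiv ℝ (fderiv ℝ f) (x, t) (Pi.single j 1, 0) (Pi.single i 1, 0) := by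
    intro i j
    have ev : pd (fun y => f (y, t)) i =ᶠ[nhds x]
        fun y => fderiv ℝ f (y, t) (Pi.single i 1, 0) := by
      filter_upwards [hcont.continuousAt.preimage_mem_nhds (hΩ.mem_nhds hz)] with y hy
      exact (fderiv_slice ((hf.contDiffAt (hΩ.mem_nhds hy)).differentiableAt (by simp)) _).symm
    have h1 := (D1.hasFDerivAt (x := (x, t))).comp x (hasFDerivAt_slice x t)
    have h2 : HasFDerivAt (fun y : Fin n → ℝ => fderiv ℝ f (y, t) (Pi.single i 1, 0)) _ x :=
      h1.clm_apply (hasFDerivAt_const _ _)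
    rw [pd, ev.fderiv_eq, h2.fderiv]
    simp
  simp only [key]
  have e : (v, (0:ℝ)) = ∑ i, v i • ((Pi.single i 1 : Fin n → ℝ), (0:ℝ)) := by
    rw [Prod.ext_iff]
    constructor
    · simpa [Prod.fst_sum] using sum_smul_single v
    · simp [Prod.snd_sum]
  conv_lhs => rw [e]
  simp only [map_sum, map_smul, FunLike.coe_sum, FunLike.coe_smul, Finset.sum_apply, Pi.smul_apply, smul_eq_mul,
    Finset.mul_sum]
  refine Finset.sum_congr rfl fun i _ => Finset.sum_congr rfl fun j _ => ?_
  rw [← mul_assoc]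

set_option maxSynthPendingDepth 5 in
set_option synthInstance.maxHeartbeats 200000 in
lemma HasExpansion.of_contDiffOn {ι : Type*} (hΩ : IsOpen Ω) (hf : ContDiffOn ℝ (⊤ : ℕ∞) f Ω)
    {K : Set ((Fin n → ℝ) × ℝ)} (hK : IsCompact K) (hKΩ : K ⊆ Ω) {x V W : ι → Fin n → ℝ}
    {t : ι → ℝ} (hxt : ∀ i, (x i, t i) ∈ K) {B : ℝ} (hV : ∀ i, ‖V i‖ ≤ B) (hW : ∀ i, ‖W i‖ ≤ B) :
    HasExpansion (fun h i => f (x i + h • V i + h ^ 2 • W i, t i - h ^ 2 / 4))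
      (fun i => f (x i, t i)) (fun i => ∑ a, V i a * pd (fun y => f (y, t i)) a (x i))
      (fun i => ∑ a, W i a * pd (fun y => f (y, t i)) a (x i) - deriv (fun r => f (x i, r)) (t i) / 4
        + (∑ a, ∑ b, V i a * V i b * pd (pd (fun y => f (y, t i)) a) b (x i)) / 2) := by
  have hf1 : ContDiffOn ℝ (⊤ : ℕ∞) (fderiv ℝ f) Ω := hf.fderiv_of_isOpen hΩ (by simp)
  have hf2 : ContDiffOn ℝ (⊤ : ℕ∞) (fderiv ℝ (fderiv ℝ f)) Ω := hf1.fderiv_of_isOpen hΩ (by simp)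
  obtain ⟨δ, hδ, M, hM⟩ := exists_taylor_two hΩ hK hKΩ hf
  obtain ⟨M0, hM0⟩ := hK.exists_bound_of_continuousOn (hf.continuousOn.mono hKΩ)
  obtain ⟨M1, hM1⟩ := hK.exists_bound_of_continuousOn (hf1.continuousOn.mono hKΩ)
  obtain ⟨M2, hM2⟩ := hK.exists_bound_of_continuousOn
    (f := fderiv ℝ (fderiv ℝ f)) (hf2.continuousOn.mono hKΩ)
  rcases isEmpty_or_nonempty ι with hι | ⟨⟨i₀⟩⟩
  · exact ⟨1, one_pos, 0, fun i => isEmptyElim i⟩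
  have hB : 0 ≤ B := (norm_nonneg _).trans (hV i₀)
  have n1 : 0 ≤ M1 := (norm_nonneg _).trans (hM1 _ (hxt i₀))
  have n2 : 0 ≤ M2 := (norm_nonneg _).trans (hM2 _ (hxt i₀))
  set A := B + 1 with hA
  have hA1 : 1 ≤ A := by linarith
  -- coefficients as Fréchet derivatives
  have D : ∀ i, DifferentiableAt ℝ f (x i, t i) := fun i =>
    (hf.contDiffAt (hΩ.mem_nhds (hKΩ (hxt i)))).differentiableAt (by simp)
  have c1 : ∀ i, ∑ a, V i a * pd (fun y => f (y, t i)) a (x i) = fderiv ℝ f (x i, t i) (V i, 0) :=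
    fun i => by rw [fderiv_eq_space_add_time (D i)]; simp
  have c2 : ∀ i, ∑ a, W i a * pd (fun y => f (y, t i)) a (x i) - deriv (fun r => f (x i, r)) (t i) / 4
      = fderiv ℝ f (x i, t i) (W i, -(1/4)) :=
    fun i => by rw [fderiv_eq_space_add_time (D i)]; ring
  have c3 : ∀ i, ∑ a, ∑ b, V i a * V i b * pd (pd (fun y => f (y, t i)) a) b (x i)
      = fderiv ℝ (fderiv ℝ f) (x i, t i) (V i, 0) (V i, 0) :=
    fun i => (fderiv_fderiv_space hΩ hf (hKΩ (hxt i)) _).symm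
  simp only [c1, c2]
  have nV : ∀ i, ‖(V i, (0:ℝ))‖ ≤ A := fun i => by
    rw [Prod.norm_mk]; simp only [norm_zero]; exact max_le ((hV i).trans (by linarith)) (by linarith)
  have nW : ∀ i, ‖(W i, (-(1/4):ℝ))‖ ≤ A := fun i => by
    rw [Prod.norm_mk]
    refine max_le ((hW i).trans (by linarith)) ?_
    rw [Real.norm_eq_abs, abs_neg, abs_of_pos (by norm_num)]; linarith
  have b1 : ∀ i, ∀ w, ‖fderiv ℝ f (x i, t i) w‖ ≤ M1 * ‖w‖ := fun i w =>
    (ContinuousLinearMap.le_opNorm _ _).trans (by gcongr; exact hM1 _ (hxt i))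
  have b2 : ∀ i, ∀ w w', ‖fderiv ℝ (fderiv ℝ f) (x i, t i) w w'‖ ≤ M2 * ‖w‖ * ‖w'‖ := fun i w w' =>
    (ContinuousLinearMap.le_opNorm₂ _ _ _).trans (by gcongr; exact hM2 _ (hxt i))
  refine ⟨min 1 (δ / (2 * A)), by positivity, M0 + M1 * A + M2 * A * A + |M| * (2 * A) ^ 3
    + 2 * (M2 * A * A), fun i => ?_⟩
  have p0 : 0 ≤ M0 := (norm_nonneg _).trans (hM0 _ (hxt i₀))
  have p1 : 0 ≤ M1 * A := by positivity
  have p2 : 0 ≤ M2 * A * A := by positivity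
  have p3 : 0 ≤ |M| * (2 * A) ^ 3 := by positivity
  have q1 : |fderiv ℝ f (x i, t i) (V i, 0)| ≤ M1 * A := (b1 i _).trans (by gcongr; exact nV i)
  have q2 : |fderiv ℝ f (x i, t i) (W i, -(1/4))| ≤ M1 * A := (b1 i _).trans (by gcongr; exact nW i)
  have q3 : ∀ w w' : (Fin n → ℝ) × ℝ, ‖w‖ ≤ A → ‖w'‖ ≤ A →
      |fderiv ℝ (fderiv ℝ f) (x i, t i) w w'| ≤ M2 * A * A := fun w w' hw hw' =>
    (b2 i _ _).trans (by gcongr)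
  refine ⟨(hM0 _ (hxt i)).trans (by linarith), q1.trans (by linarith), ?_, fun h hh => ?_⟩
  · refine (abs_add_le _ _).trans ?_
    rw [abs_div, abs_two, c3]
    have := q3 _ _ (nV i) (nV i)
    linarith
  have h1 : |h| ≤ 1 := hh.trans (min_le_left _ _)
  have h0 := abs_nonneg h
  set d : (Fin n → ℝ) × ℝ := h • (V i, (0:ℝ)) + h ^ 2 • (W i, (-(1/4):ℝ)) with hd
  have ed : (x i + h • V i + h ^ 2 • W i, t i - h ^ 2 / 4) = (x i, t i) + d := by
    rw [hd]; ext1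
    · simp [add_assoc]
    · simp; ring
  have nd : ‖d‖ ≤ 2 * A * |h| := by
    refine (norm_add_le _ _).trans ?_
    rw [norm_smul, norm_smul, Real.norm_eq_abs, Real.norm_eq_abs, abs_pow]
    have e1 := nV i
    have e2 := nW i
    have : |h| ^ 2 * ‖(W i, (-(1/4):ℝ))‖ ≤ |h| * A := by
      gcongr
      nlinarith
    nlinarith
  have nd' : ‖d‖ ≤ δ := by
    refine nd.trans ?_
    have := hh.trans (min_le_right _ _)
    rw [le_div_iff₀ (by positivity)] at this
    linarith
  have T := (hM _ (hxt i) d nd').2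
  rw [← ed] at T
  have exp1 : fderiv ℝ f (x i, t i) d = h * fderiv ℝ f (x i, t i) (V i, 0)
      + h ^ 2 * fderiv ℝ f (x i, t i) (W i, -(1/4)) := by
    rw [hd, map_add, map_smul, map_smul]; rfl
  have exp2 : fderiv ℝ (fderiv ℝ f) (x i, t i) d d =
      h ^ 2 * fderiv ℝ (fderiv ℝ f) (x i, t i) (V i, 0) (V i, 0)
      + h ^ 3 * (fderiv ℝ (fderiv ℝ f) (x i, t i) (V i, 0) (W i, -(1/4))
        + fderiv ℝ (fderiv ℝ f) (x i, t i) (W i, -(1/4)) (V i, 0))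
      + h ^ 4 * fderiv ℝ (fderiv ℝ f) (x i, t i) (W i, -(1/4)) (W i, -(1/4)) := by
    rw [hd]
    simp only [map_add, map_smul, FunLike.coe_add, FunLike.coe_smul, Pi.add_apply, Pi.smul_apply,
      smul_eq_mul]
    ring
  rw [exp1, exp2] at T
  obtain ⟨X1, hX1⟩ : ∃ X1, fderiv ℝ (fderiv ℝ f) (x i, t i) (V i, 0) (V i, 0) = X1 := ⟨_, rfl⟩
  rw [hX1] at T
  have hX1' := (c3 i).trans hX1
  beta_reduce
  rw [hX1']
  have r2 := q3 _ _ (nV i) (nW i)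
  have r3 := q3 _ _ (nW i) (nV i)
  have r4 := q3 _ _ (nW i) (nW i)
  generalize fderiv ℝ (fderiv ℝ f) (x i, t i) (V i, 0) (W i, -(1/4)) = X2 at T r2
  generalize fderiv ℝ (fderiv ℝ f) (x i, t i) (W i, -(1/4)) (V i, 0) = X3 at T r3
  generalize fderiv ℝ (fderiv ℝ f) (x i, t i) (W i, -(1/4)) (W i, -(1/4)) = X4 at T r4
  have T' : M * ‖d‖ ^ 3 ≤ |M| * (2 * A) ^ 3 * |h| ^ 3 := by
    calc M * ‖d‖ ^ 3 ≤ |M| * (2 * A * |h|) ^ 3 := by gcongr; exact le_abs_self M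
      _ = _ := by ring
  have u1 : |h ^ 3 / 2 * (X2 + X3)| ≤ |h| ^ 3 * (M2 * A * A) := by
    rw [abs_mul, abs_div, abs_pow, abs_two]
    have := abs_add_le X2 X3
    have h3 : 0 ≤ |h| ^ 3 := by positivity
    nlinarith
  have u2 : |h ^ 4 / 2 * X4| ≤ |h| ^ 3 * (M2 * A * A) := by
    rw [abs_mul, abs_div, abs_pow, abs_two]
    have : |h| ^ 4 ≤ |h| ^ 3 := pow_le_pow_of_le_one h0 h1 (by norm_num)
    exact mul_le_mul (by linarith [pow_nonneg h0 4]) r4 (abs_nonneg _) (by positivity)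
  have h3 : 0 ≤ |h| ^ 3 := by positivity
  have e := (abs_add_three (f (x i + h • V i + h ^ 2 • W i, t i - h ^ 2 / 4) - f (x i, t i)
    - (h * fderiv ℝ f (x i, t i) (V i, 0) + h ^ 2 * fderiv ℝ f (x i, t i) (W i, -(1/4)))
    - (h ^ 2 * X1 + h ^ 3 * (X2 + X3) + h ^ 4 * X4) / 2) (h ^ 3 / 2 * (X2 + X3)) (h ^ 4 / 2 * X4))
  refine le_of_eq_of_le ?_ (e.trans ((add_le_add (add_le_add (T.trans T') u1) u2).trans ?_))
  · congr 1; ring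
  · nlinarith

end SpaceTime

section EnergyAlgebra

variable {G : (Fin 2 → ℝ) → Matrix (Fin 2) (Fin 2) ℝ}

namespace SmoothMetric

lemma metric_compat (h : SmoothMetric G) (x ξ V : Fin 2 → ℝ) :
    ∑ a, ∑ b, ∑ c, pd (fun y => G y a b) c x * ξ a * ξ b * V c =
      2 * ∑ a, ∑ b, ∑ e, ∑ f, G x a b * ξ a * christoffel G x b e f * ξ e * V f := by
  have hD := (h.det_pos x).ne'
  obtain ⟨i00, i01, i10, i11⟩ := h.inv_apply x
  simp only [christoffel, Fin.sum_univ_two]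
  simp only [h.symm, i00, i01, i10, i11]
  generalize hDD : G x 0 0 * G x 1 1 - G x 0 1 ^ 2 = D at *
  field_simp
  subst hDD
  ring

lemma trace_first_variation (h : SmoothMetric G) (x ξ : Fin 2 → ℝ) :
    ∑ a, ∑ b, G x a b * ξ a * drift G x b
      + ∑ a, ∑ b, ∑ c, pd (fun y => G y a b) c x * ξ a * (G x)⁻¹ c b
      - ∑ a, ∑ b, ∑ e, ∑ f, G x a b * (G x)⁻¹ a f * christoffel G x b e f * ξ e = 0 := by
  have hD := (h.det_pos x).ne'
  obtain ⟨i00, i01, i10, i11⟩ := h.inv_apply x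
  simp only [drift, christoffel, Fin.sum_univ_two]
  simp only [h.symm, i00, i01, i10, i11]
  generalize hDD : G x 0 0 * G x 1 1 - G x 0 1 ^ 2 = D at *
  field_simp
  subst hDD
  ring

lemma trace_metric (h : SmoothMetric G) (x : Fin 2 → ℝ) :
    ∑ a, ∑ b, G x a b * (G x)⁻¹ a b = 2 := by
  have hD := (h.det_pos x).ne'
  obtain ⟨i00, i01, i10, i11⟩ := h.inv_apply x
  simp only [Fin.sum_univ_two]
  simp only [h.symm, i00, i01, i10, i11]
  field_simp
  ring

/-- First order coefficient of the velocity of the varied curve. -/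
def velOne (G : (Fin 2 → ℝ) → Matrix (Fin 2) (Fin 2) ℝ) (x ξ V : Fin 2 → ℝ) (ζ η : ℝ)
    (b : Fin 2) : ℝ :=
  ζ * V b - η * ∑ e, ∑ f, christoffel G x b e f * ξ e * V f

/-- Second order coefficient of the velocity of the varied curve. -/
def velTwo (G : (Fin 2 → ℝ) → Matrix (Fin 2) (Fin 2) ℝ) (x ξ : Fin 2 → ℝ) (ζ η : ℝ)
    (b : Fin 2) : ℝ :=
  (1/4) * (2 * η * ζ * drift G x b + η ^ 2 * ∑ e, pd (fun y => drift G y b) e x * ξ e)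

/-- First order coefficient of the energy density of the varied curve. -/
lemma density_first (h : SmoothMetric G) (x ξ V : Fin 2 → ℝ) (ζ η : ℝ) :
    ∑ a, ∑ b, (G x a b * (ξ a * velOne G x ξ V ζ η b + velOne G x ξ V ζ η a * ξ b)
      + (∑ c, (η • V) c * pd (fun y => G y a b) c x) * (ξ a * ξ b)) =
      2 * ζ * ∑ a, ∑ b, G x a b * ξ a * V b := by
  have e := h.metric_compat x ξ V
  simp only [velOne, Fin.sum_univ_two, Pi.smul_apply, smul_eq_mul] at e ⊢
  simp only [h.symm] at e ⊢
  linear_combination η * e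

set_option maxHeartbeats 2000000 in
/-- Second order coefficient of the energy density, summed over an orthonormal frame. -/
lemma density_second (h : SmoothMetric G) (x ξ : Fin 2 → ℝ) (V : Fin 2 → Fin 2 → ℝ) (ζ η : ℝ)
    (hV : ∀ c d, V 0 c * V 0 d + V 1 c * V 1 d = (G x)⁻¹ c d) (k : ℝ) :
    ∑ i, ∑ a, ∑ b, (G x a b * (ξ a * velTwo G x ξ ζ η b
        + velOne G x ξ (V i) ζ η a * velOne G x ξ (V i) ζ η b + velTwo G x ξ ζ η a * ξ b)
      + (∑ c, (η • V i) c * pd (fun y => G y a b) c x) *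
        (ξ a * velOne G x ξ (V i) ζ η b + velOne G x ξ (V i) ζ η a * ξ b)
      + (∑ c, ((η ^ 2 / 4) • drift G x) c * pd (fun y => G y a b) c x
          - (-2 * k * G x a b) / 4
          + (∑ c, ∑ d, (η • V i) c * (η • V i) d * pd (pd (fun y => G y a b) c) d x) / 2) *
        (ξ a * ξ b)) =
      2 * ζ ^ 2 + (k - gaussCurv G x * η ^ 2) * ∑ a, ∑ b, G x a b * ξ a * ξ b := by
  have e1 := h.trace_second_variation x ξ
  have e2 := h.trace_first_variation x ξ
  have e3 := h.trace_metric x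
  simp only [← hV] at e1 e2 e3
  simp only [velOne, velTwo, Fin.sum_univ_two, Pi.smul_apply, smul_eq_mul] at e1 e2 e3 ⊢
  simp only [h.symm] at e1 e2 e3 ⊢
  linear_combination η ^ 2 / 2 * e1 + 2 * η * ζ * e2 + ζ ^ 2 * e3

end SmoothMetric

end EnergyAlgebra

section ParallelFrame

lemma hasDerivAt_comp_curve {f : (Fin n → ℝ) → ℝ} {γ : ℝ → Fin n → ℝ} {ξ : Fin n → ℝ} {s : ℝ}
    (hf : DifferentiableAt ℝ f (γ s)) (hγ : HasDerivAt γ ξ s) :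
    HasDerivAt (fun r => f (γ r)) (∑ i, ξ i * pd f i (γ s)) s := by
  rw [← fderiv_apply_eq_sum_pd]
  exact hf.hasFDerivAt.comp_hasDerivAt s hγ

/-- A linear algebra identity behind the rotation of a moving frame: `a`, `b`, `c` are metric
coefficients and `p`, `q`, `r`, `u` the connection coefficients along a curve. -/
lemma moving_frame_identity {a b c α β p q r u : ℝ} (hα : α ^ 2 * a = 1)
    (hβ : β ^ 2 * (a * c - b ^ 2) = 1) {a' b' c' : ℝ} (ha : a' = 2 * (a * p + b * q))
    (hb : b' = b * p + c * q + a * r + b * u) (hc : c' = 2 * (b * r + c * u)) :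
    (-(1/2) * α ^ 3 * a' = (a * c - b ^ 2) * β * α ^ 2 * q * (-(b * (α * β))) - p * α) ∧
    (0 = (a * c - b ^ 2) * β * α ^ 2 * q * (a * (α * β)) - q * α) ∧
    (-(b' * (α * β) + b * (-(1/2) * α ^ 3 * a' * β
        + α * (-(1/2) * β ^ 3 * (a' * c + a * c' - 2 * b * b')))) =
      -((a * c - b ^ 2) * β * α ^ 2 * q) * α - (p * (-(b * (α * β))) + r * (a * (α * β)))) ∧
    (a' * (α * β) + a * (-(1/2) * α ^ 3 * a' * β
        + α * (-(1/2) * β ^ 3 * (a' * c + a * c' - 2 * b * b'))) =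
      -(q * (-(b * (α * β))) + u * (a * (α * β)))) := by
  subst ha hb hc
  refine ⟨?_, ?_, ?_, ?_⟩
  · linear_combination -α * p * hα + α ^ 3 * q * b * hβ
  · linear_combination -q * α * (β ^ 2 * (a * c - b ^ 2)) * hα - q * α * hβ
  · linear_combination (b * β * α * p + c * β * α * q) * hα + b * α * β * (p + u) * hβ
  · linear_combination -(a * β * α * p + β * α * b * q) * hα - a * α * β * (p + u) * hβ

lemma hasDerivAt_inv_sqrt {a : ℝ → ℝ} {a' s : ℝ} (h : HasDerivAt a a' s) (h0 : 0 < a s) :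
    HasDerivAt (fun r => (√(a r))⁻¹) (-(1/2) * (√(a s))⁻¹ ^ 3 * a') s := by
  have h1 := (h.sqrt h0.ne').inv (Real.sqrt_pos.2 h0).ne'
  refine HasDerivAt.congr_deriv h1 ?_
  have := (Real.sqrt_pos.2 h0).ne'
  field_simp

variable {G : (Fin 2 → ℝ) → Matrix (Fin 2) (Fin 2) ℝ}

/-- The connection form along a curve: `∇_ξ V = V' + conn G x ξ V`. -/
def conn (G : (Fin 2 → ℝ) → Matrix (Fin 2) (Fin 2) ℝ) (x ξ V : Fin 2 → ℝ) (b : Fin 2) : ℝ :=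
  ∑ e, ∑ f, christoffel G x b e f * ξ e * V f

namespace SmoothMetric

lemma continuous_conn (h : SmoothMetric G) {ι : Type*} [TopologicalSpace ι] {x ξ V : ι → Fin 2 → ℝ}
    (hx : Continuous x) (hξ : Continuous ξ) (hV : Continuous V) :
    Continuous fun i => conn G (x i) (ξ i) (V i) := by
  refine continuous_pi fun b => continuous_finsetSum _ fun e _ => continuous_finsetSum _ fun f _ => ?_
  exact (((h.contDiff_christoffel b e f).continuous.comp hx).mul ((continuous_apply e).comp hξ)).mul
    ((continuous_apply f).comp hV)

lemma metric_along (h : SmoothMetric G) (x ξ : Fin 2 → ℝ) :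
    (∑ i, ξ i * pd (fun y => G y 0 0) i x = 2 * (G x 0 0 * conn G x ξ (Pi.single 0 1) 0
        + G x 0 1 * conn G x ξ (Pi.single 0 1) 1)) ∧
    (∑ i, ξ i * pd (fun y => G y 0 1) i x = G x 0 1 * conn G x ξ (Pi.single 0 1) 0
        + G x 1 1 * conn G x ξ (Pi.single 0 1) 1 + G x 0 0 * conn G x ξ (Pi.single 1 1) 0
        + G x 0 1 * conn G x ξ (Pi.single 1 1) 1) ∧
    (∑ i, ξ i * pd (fun y => G y 1 1) i x = 2 * (G x 0 1 * conn G x ξ (Pi.single 1 1) 0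
        + G x 1 1 * conn G x ξ (Pi.single 1 1) 1)) := by
  have hD := (h.det_pos x).ne'
  obtain ⟨i00, i01, i10, i11⟩ := h.inv_apply x
  simp only [conn, christoffel, Fin.sum_univ_two, Pi.single_apply]
  simp only [h.symm, i00, i01, i10, i11]
  generalize hDD : G x 0 0 * G x 1 1 - G x 0 1 ^ 2 = D at *
  refine ⟨?_, ?_, ?_⟩ <;>
  · simp
    field_simp
    subst hDD
    ring

/-- Existence of a parallel orthonormal frame along a `C¹` curve. -/
lemma exists_parallel_frame (h : SmoothMetric G) {γ : ℝ → Fin 2 → ℝ} (hγ : ContDiff ℝ 1 γ) :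
    ∃ V : Fin 2 → ℝ → Fin 2 → ℝ,
      (∀ i s, HasDerivAt (V i) (-conn G (γ s) (deriv γ s) (V i s)) s) ∧
      ∀ s c d, V 0 s c * V 0 s d + V 1 s c * V 1 s d = (G (γ s))⁻¹ c d := by
  set ξ := deriv γ with hξ
  have cξ : Continuous ξ := hγ.continuous_deriv le_rfl
  have dγ : ∀ s, HasDerivAt γ (ξ s) s := fun s => (hγ.differentiable (by simp) s).hasDerivAt
  set a := fun s => G (γ s) 0 0 with ha
  set b := fun s => G (γ s) 0 1 with hb
  set c := fun s => G (γ s) 1 1 with hc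
  have a0 : ∀ s, 0 < a s := fun s => h.diag_pos _
  have D0 : ∀ s, 0 < a s * c s - b s ^ 2 := fun s => h.det_pos _
  set α := fun s => (√(a s))⁻¹ with hα
  set β := fun s => (√(a s * c s - b s ^ 2))⁻¹ with hβ
  have eα : ∀ s, α s ^ 2 * a s = 1 := fun s => by
    simp only [hα, inv_pow, Real.sq_sqrt (a0 s).le]; exact inv_mul_cancel₀ (a0 s).ne'
  have eβ : ∀ s, β s ^ 2 * (a s * c s - b s ^ 2) = 1 := fun s => by
    simp only [hβ, inv_pow, Real.sq_sqrt (D0 s).le]; exact inv_mul_cancel₀ (D0 s).ne'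
  set p := fun s => conn G (γ s) (ξ s) (Pi.single 0 1) 0 with hp
  set q := fun s => conn G (γ s) (ξ s) (Pi.single 0 1) 1 with hq
  set r := fun s => conn G (γ s) (ξ s) (Pi.single 1 1) 0 with hr
  set u := fun s => conn G (γ s) (ξ s) (Pi.single 1 1) 1 with hu
  set A := fun s => ∑ i, ξ s i * pd (fun y => G y 0 0) i (γ s) with hA
  set B := fun s => ∑ i, ξ s i * pd (fun y => G y 0 1) i (γ s) with hB
  set C := fun s => ∑ i, ξ s i * pd (fun y => G y 1 1) i (γ s) with hC
  have da : ∀ s, HasDerivAt a (A s) s := fun s =>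
    hasDerivAt_comp_curve ((h.1 0 0).differentiableAt_top (γ s)) (dγ s)
  have db : ∀ s, HasDerivAt b (B s) s := fun s =>
    hasDerivAt_comp_curve ((h.1 0 1).differentiableAt_top (γ s)) (dγ s)
  have dc : ∀ s, HasDerivAt c (C s) s := fun s =>
    hasDerivAt_comp_curve ((h.1 1 1).differentiableAt_top (γ s)) (dγ s)
  have dα : ∀ s, HasDerivAt α (-(1/2) * α s ^ 3 * A s) s := fun s =>
    hasDerivAt_inv_sqrt (da s) (a0 s)
  have dβ : ∀ s, HasDerivAt β (-(1/2) * β s ^ 3 * (A s * c s + a s * C s - 2 * b s * B s)) s :=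
    fun s => by
      refine (hasDerivAt_inv_sqrt (((da s).mul (dc s)).sub ((db s).pow 2)) (D0 s)).congr_deriv ?_
      show -(1/2) * β s ^ 3 * _ = _
      norm_num
  set ω := fun s => (a s * c s - b s ^ 2) * β s * α s ^ 2 * q s with hω
  have cω : Continuous ω := by
    have ca : Continuous a := (h.1 0 0).continuous.comp hγ.continuous
    have cb : Continuous b := (h.1 0 1).continuous.comp hγ.continuous
    have cc : Continuous c := (h.1 1 1).continuous.comp hγ.continuous
    have cq : Continuous q := (continuous_apply 1).comp
      (h.continuous_conn hγ.continuous cξ continuous_const)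
    have cα : Continuous α := (continuous_iff_continuousAt.2 fun s => (dα s).continuousAt)
    have cβ : Continuous β := (continuous_iff_continuousAt.2 fun s => (dβ s).continuousAt)
    fun_prop
  set θ := fun s => -∫ r in (0:ℝ)..s, ω r with hθ
  have dθ : ∀ s, HasDerivAt θ (-ω s) s := fun s =>
    (intervalIntegral.integral_hasDerivAt_right (cω.intervalIntegrable _ _)
      (cω.stronglyMeasurableAtFilter _ _) cω.continuousAt).neg
  have lin : ∀ s (W : Fin 2 → ℝ) k, conn G (γ s) (ξ s) W k =
      W 0 * conn G (γ s) (ξ s) (Pi.single 0 1) k + W 1 * conn G (γ s) (ξ s) (Pi.single 1 1) k := by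
    intro s W k
    simp [conn, Fin.sum_univ_two]; ring
  refine ⟨![fun s => ![Real.cos (θ s) * α s + Real.sin (θ s) * (-(b s * (α s * β s))),
      Real.sin (θ s) * (a s * (α s * β s))],
    fun s => ![-Real.sin (θ s) * α s + Real.cos (θ s) * (-(b s * (α s * β s))),
      Real.cos (θ s) * (a s * (α s * β s))]], ?_, ?_⟩
  · intro i s
    obtain ⟨m1, m2, m3⟩ := h.metric_along (γ s) (ξ s)
    obtain ⟨k1, k2, k3, k4⟩ := moving_frame_identity (eα s) (eβ s) (p := p s) (q := q s)
      (r := r s) (u := u s) (a' := A s) (b' := B s) (c' := C s) m1 m2 m3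
    have hωs : (a s * c s - b s ^ 2) * β s * α s ^ 2 * q s = ω s := rfl
    rw [hωs] at k1 k2 k3
    have dc' := (dθ s).cos
    have ds' := (dθ s).sin
    have d1 := ((db s).mul ((dα s).mul (dβ s))).neg
    have d2 := (da s).mul ((dα s).mul (dβ s))
    rw [hasDerivAt_pi]
    intro k
    rw [Pi.neg_apply, lin]
    fin_cases i <;> fin_cases k
    · refine ((dc'.mul (dα s)).add (ds'.mul d1)).congr_deriv ?_
      show _ =
          -((Real.cos (θ s) * α s + Real.sin (θ s) * (-(b s * (α s * β s)))) * p s +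
          (Real.sin (θ s) * (a s * (α s * β s))) * r s)
      simp only [Pi.mul_apply, Pi.neg_apply]
      linear_combination Real.cos (θ s) * k1 + Real.sin (θ s) * k3
    · refine (ds'.mul d2).congr_deriv ?_
      show _ =
          -((Real.cos (θ s) * α s + Real.sin (θ s) * (-(b s * (α s * β s)))) * q s +
          (Real.sin (θ s) * (a s * (α s * β s))) * u s)
      simp only [Pi.mul_apply]
      linear_combination Real.cos (θ s) * k2 + Real.sin (θ s) * k4
    · refine ((ds'.neg.mul (dα s)).add (dc'.mul d1)).congr_deriv ?_
      show _ =
          -((-Real.sin (θ s) * α s + Real.cos (θ s) * (-(b s * (α s * β s)))) * p s +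
          (Real.cos (θ s) * (a s * (α s * β s))) * r s)
      simp only [Pi.mul_apply, Pi.neg_apply]
      linear_combination -Real.sin (θ s) * k1 + Real.cos (θ s) * k3
    · refine (dc'.mul d2).congr_deriv ?_
      show _ =
          -((-Real.sin (θ s) * α s + Real.cos (θ s) * (-(b s * (α s * β s)))) * q s +
          (Real.cos (θ s) * (a s * (α s * β s))) * u s)
      simp only [Pi.mul_apply]
      linear_combination -Real.sin (θ s) * k2 + Real.cos (θ s) * k4
  · intro s k l
    obtain ⟨i00, i01, i10, i11⟩ := h.inv_apply (γ s)
    have cs := Real.sin_sq_add_cos_sq (θ s)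
    have z1 : α s ^ 2 = 1 / a s := by rw [eq_div_iff (a0 s).ne']; exact eα s
    have z2 : β s ^ 2 = 1 / (a s * c s - b s ^ 2) := by rw [eq_div_iff (D0 s).ne']; exact eβ s
    have z0 := (a0 s).ne'
    have zD := (D0 s).ne'
    fin_cases k <;> fin_cases l
    · refine Eq.trans ?_ i00.symm
      calc _ = (Real.sin (θ s) ^ 2 + Real.cos (θ s) ^ 2) * (α s ^ 2 + b s ^ 2 * α s ^ 2 * β s ^ 2) := by
            simp [-Real.sin_sq_add_cos_sq]; ring
        _ = c s / (a s * c s - b s ^ 2) := by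
            rw [cs, z1, z2]; field_simp; ring
    · refine Eq.trans ?_ i01.symm
      calc _ = (Real.sin (θ s) ^ 2 + Real.cos (θ s) ^ 2) * (-(b s * a s) * α s ^ 2 * β s ^ 2) := by
            simp [-Real.sin_sq_add_cos_sq]; ring
        _ = -b s / (a s * c s - b s ^ 2) := by
            rw [cs, z1, z2]; field_simp
    · refine Eq.trans ?_ i10.symm
      calc _ = (Real.sin (θ s) ^ 2 + Real.cos (θ s) ^ 2) * (-(b s * a s) * α s ^ 2 * β s ^ 2) := by
            simp [-Real.sin_sq_add_cos_sq]; ring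
        _ = -b s / (a s * c s - b s ^ 2) := by
            rw [cs, z1, z2]; field_simp
    · refine Eq.trans ?_ i11.symm
      calc _ = (Real.sin (θ s) ^ 2 + Real.cos (θ s) ^ 2) * (a s ^ 2 * α s ^ 2 * β s ^ 2) := by
            simp [-Real.sin_sq_add_cos_sq]; ring
        _ = a s / (a s * c s - b s ^ 2) := by
            rw [cs, z1, z2]; field_simp

end SmoothMetric

end ParallelFrame

section FlowRegularity

lemma contDiffOn_pd_slice {f : (Fin n → ℝ) × ℝ → ℝ} {Ω : Set ((Fin n → ℝ) × ℝ)} (hΩ : IsOpen Ω)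
    (hf : ContDiffOn ℝ (⊤ : ℕ∞) f Ω) (i : Fin n) :
    ContDiffOn ℝ (⊤ : ℕ∞) (fun p : (Fin n → ℝ) × ℝ => pd (fun y => f (y, p.2)) i p.1) Ω := by
  have hf1 : ContDiffOn ℝ (⊤ : ℕ∞) (fderiv ℝ f) Ω := hf.fderiv_of_isOpen hΩ (by simp)
  refine (hf1.clm_apply contDiffOn_const (g := fun _ => (Pi.single i 1, 0))).congr ?_
  rintro ⟨x, t⟩ hz
  exact (fderiv_slice ((hf.contDiffAt (hΩ.mem_nhds hz)).differentiableAt (by simp)) _).symm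

/-- A two-dimensional Ricci flow on `[0, T]`. -/
structure RicciFlowTwo (g : (Fin 2 → ℝ) → ℝ → Matrix (Fin 2) (Fin 2) ℝ) (T : ℝ) : Prop where
  smooth : SmoothMetricFamily g (Icc 0 T)
  flow : IsRicciFlow g (Icc 0 T)

/-- The Gauss curvature of a time-dependent metric, as a function on space-time. -/
def curv (g : (Fin 2 → ℝ) → ℝ → Matrix (Fin 2) (Fin 2) ℝ) (p : (Fin 2 → ℝ) × ℝ) : ℝ :=
  gaussCurv (fun y => g y p.2) p.1

namespace RicciFlowTwo

variable {g : (Fin 2 → ℝ) → ℝ → Matrix (Fin 2) (Fin 2) ℝ} {T : ℝ}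

lemma isOpen_domain : IsOpen ((univ : Set (Fin 2 → ℝ)) ×ˢ Ioo (0:ℝ) T) := isOpen_univ.prod isOpen_Ioo

lemma domain_subset :
    ((univ : Set (Fin 2 → ℝ)) ×ˢ Ioo (0:ℝ) T) ⊆ univ ×ˢ Icc (0:ℝ) T :=
  prod_mono Subset.rfl Ioo_subset_Icc_self

lemma slice (h : RicciFlowTwo g T) {t : ℝ} (ht : t ∈ Icc 0 T) : SmoothMetric (fun y => g y t) := by
  refine ⟨fun i j => contDiffOn_univ.1 ?_, fun x => h.smooth.2 x t ht⟩
  exact (h.smooth.1 i j).comp (f := fun y : Fin 2 → ℝ => (y, t)) (by fun_prop)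
    (fun y _ => ⟨mem_univ _, ht⟩)

lemma slice' (h : RicciFlowTwo g T) {t : ℝ} (ht : t ∈ Ioo 0 T) : SmoothMetric (fun y => g y t) :=
  h.slice (Ioo_subset_Icc_self ht)

lemma entry (h : RicciFlowTwo g T) (a b : Fin 2) : ContDiffOn ℝ (⊤ : ℕ∞)
    (fun p : (Fin 2 → ℝ) × ℝ => g p.1 p.2 a b) (univ ×ˢ Ioo (0:ℝ) T) :=
  (h.smooth.1 a b).mono domain_subset

lemma differentiableWithinAt_time (h : RicciFlowTwo g T) (x : Fin 2 → ℝ) {t : ℝ} (ht : t ∈ Icc 0 T)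
    (a b : Fin 2) : DifferentiableWithinAt ℝ (fun r => g x r a b) (Icc 0 T) t := by
  have h1 : ContDiffOn ℝ (⊤ : ℕ∞) (fun r => g x r a b) (Icc 0 T) :=
    (h.smooth.1 a b).comp (f := fun r : ℝ => (x, r)) (by fun_prop) (fun y hy => ⟨mem_univ _, hy⟩)
  exact h1.differentiableOn (by simp) t ht

lemma hasDerivWithinAt_time (h : RicciFlowTwo g T) (x : Fin 2 → ℝ) {t : ℝ} (ht : t ∈ Icc 0 T)
    (a b : Fin 2) :
    HasDerivWithinAt (fun r => g x r a b) (-2 * curv g (x, t) * g x t a b) (Icc 0 T) t := by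
  have h2 := (h.differentiableWithinAt_time x ht a b).hasDerivWithinAt
  rw [h.flow x t ht a b, (h.slice ht).ricci_eq_gaussCurv] at h2
  exact h2.congr_deriv (by simp only [curv]; ring)

lemma hasDerivAt_time (h : RicciFlowTwo g T) (x : Fin 2 → ℝ) {t : ℝ} (ht : t ∈ Ioo 0 T)
    (a b : Fin 2) : HasDerivAt (fun r => g x r a b) (-2 * curv g (x, t) * g x t a b) t :=
  (h.hasDerivWithinAt_time x (Ioo_subset_Icc_self ht) a b).hasDerivAt (Icc_mem_nhds ht.1 ht.2)

lemma contDiffOn_curv (h : RicciFlowTwo g T) (hT : 0 < T) :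
    ContDiffOn ℝ (⊤ : ℕ∞) (curv g) (univ ×ˢ Icc (0:ℝ) T) := by
  set S : Set ((Fin 2 → ℝ) × ℝ) := univ ×ˢ Icc (0:ℝ) T with hS
  set f : (Fin 2 → ℝ) × ℝ → ℝ := fun p => g p.1 p.2 0 0 with hf
  have uS : UniqueDiffOn ℝ S := uniqueDiffOn_univ.prod (uniqueDiffOn_Icc hT)
  have h1 : ContDiffOn ℝ (⊤ : ℕ∞) (fderivWithin ℝ f S) S := (h.smooth.1 0 0).fderivWithin uS (by simp)
  have h2 : ContDiffOn ℝ (⊤ : ℕ∞) (fun p => -(1/2) * (fderivWithin ℝ f S p (0, 1) / f p)) S := by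
    refine contDiffOn_const.mul ((h1.clm_apply contDiffOn_const).div (h.smooth.1 0 0) ?_)
    rintro ⟨x, t⟩ hp
    exact ((h.slice hp.2).diag_pos x).ne'
  refine h2.congr ?_
  rintro ⟨x, t⟩ hp
  have d1 : HasFDerivWithinAt f (fderivWithin ℝ f S (x, t)) S (x, t) :=
    ((h.smooth.1 0 0).differentiableOn (by simp) _ hp).hasFDerivWithinAt
  have d2 : HasDerivWithinAt (fun r : ℝ => (x, r)) (0, 1) (Icc 0 T) t :=
    (hasDerivWithinAt_const t _ x).prodMk (hasDerivWithinAt_id t _)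
  have d3 := d1.comp_hasDerivWithinAt t d2 (fun r hr => ⟨mem_univ _, hr⟩)
  have e := (uniqueDiffOn_Icc hT t hp.2).eq_deriv _ d3 (h.hasDerivWithinAt_time x hp.2 0 0)
  have := ((h.slice hp.2).diag_pos x).ne'
  rw [e]
  simp only [hf]
  field_simp

lemma contDiffOn_inv (h : RicciFlowTwo g T) (a b : Fin 2) : ContDiffOn ℝ (⊤ : ℕ∞)
    (fun p : (Fin 2 → ℝ) × ℝ => (g p.1 p.2)⁻¹ a b) (univ ×ˢ Icc (0:ℝ) T) := by
  have hD := ((h.smooth.1 0 0).mul (h.smooth.1 1 1)).sub ((h.smooth.1 0 1).pow 2)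
  have hD0 : ∀ p ∈ (univ : Set (Fin 2 → ℝ)) ×ˢ Icc (0:ℝ) T,
      g p.1 p.2 0 0 * g p.1 p.2 1 1 - g p.1 p.2 0 1 ^ 2 ≠ 0 := fun p hp =>
    ((h.slice hp.2).det_pos p.1).ne'
  have I := fun p (hp : p ∈ (univ : Set (Fin 2 → ℝ)) ×ˢ Icc (0:ℝ) T) => (h.slice hp.2).inv_apply p.1
  fin_cases a <;> fin_cases b
  · exact ((h.smooth.1 1 1).div hD hD0).congr fun p hp => (I p hp).1
  · exact ((h.smooth.1 0 1).neg.div hD hD0).congr fun p hp => (I p hp).2.1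
  · exact ((h.smooth.1 0 1).neg.div hD hD0).congr fun p hp => (I p hp).2.2.1
  · exact ((h.smooth.1 0 0).div hD hD0).congr fun p hp => (I p hp).2.2.2

lemma contDiffOn_christoffel (h : RicciFlowTwo g T) (k i j : Fin 2) : ContDiffOn ℝ (⊤ : ℕ∞)
    (fun p : (Fin 2 → ℝ) × ℝ => christoffel (fun y => g y p.2) p.1 k i j)
      (univ ×ˢ Ioo (0:ℝ) T) := by
  have P : ∀ a b i, ContDiffOn ℝ (⊤ : ℕ∞)
      (fun p : (Fin 2 → ℝ) × ℝ => pd (fun y => g y p.2 a b) i p.1) (univ ×ˢ Ioo (0:ℝ) T) :=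
    fun a b i => contDiffOn_pd_slice isOpen_domain (h.entry a b) i
  unfold christoffel
  refine contDiffOn_const.mul (ContDiffOn.sum fun l _ =>
    ((h.contDiffOn_inv k l).mono domain_subset).mul ?_)
  exact ((P _ _ _).add (P _ _ _)).sub (P _ _ _)

lemma contDiffOn_drift (h : RicciFlowTwo g T) (a : Fin 2) : ContDiffOn ℝ (⊤ : ℕ∞)
    (fun p : (Fin 2 → ℝ) × ℝ => drift (fun y => g y p.2) p.1 a) (univ ×ˢ Ioo (0:ℝ) T) :=
  (ContDiffOn.sum fun c _ => ContDiffOn.sum fun d _ =>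
    ((h.contDiffOn_inv c d).mono domain_subset).mul (h.contDiffOn_christoffel a c d)).neg

end RicciFlowTwo

end FlowRegularity

section Bounded

variable {ι : Type*} {f f' : ι → ℝ}

/-- Boundedness of a real-valued function. -/
def IsBdd (f : ι → ℝ) : Prop := ∃ B, ∀ i, |f i| ≤ B

namespace IsBdd

lemma add (h : IsBdd f) (h' : IsBdd f') : IsBdd fun i => f i + f' i := by
  obtain ⟨B, hB⟩ := h
  obtain ⟨B', hB'⟩ := h'
  exact ⟨B + B', fun i => (abs_add_le _ _).trans (add_le_add (hB i) (hB' i))⟩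

lemma mul (h : IsBdd f) (h' : IsBdd f') : IsBdd fun i => f i * f' i := by
  obtain ⟨B, hB⟩ := h
  obtain ⟨B', hB'⟩ := h'
  refine ⟨B * B', fun i => ?_⟩
  rw [abs_mul]
  exact mul_le_mul (hB i) (hB' i) (abs_nonneg _) ((abs_nonneg _).trans (hB i))

lemma const (c : ℝ) : IsBdd fun _ : ι => c := ⟨|c|, fun _ => le_rfl⟩

lemma neg (h : IsBdd f) : IsBdd fun i => -f i := by
  obtain ⟨B, hB⟩ := h
  exact ⟨B, fun i => by rw [abs_neg]; exact hB i⟩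

lemma sub (h : IsBdd f) (h' : IsBdd f') : IsBdd fun i => f i - f' i := by
  simpa only [sub_eq_add_neg] using h.add h'.neg

lemma pow (h : IsBdd f) (m : ℕ) : IsBdd fun i => f i ^ m := by
  induction m with
  | zero => simpa using const 1
  | succ m ih => simpa only [pow_succ] using ih.mul h

lemma sum {κ : Type*} (s : Finset κ) {f : κ → ι → ℝ} (h : ∀ k, IsBdd (f k)) :
    IsBdd fun i => ∑ k ∈ s, f k i := by
  choose B hB using h
  exact ⟨∑ k ∈ s, B k, fun i => (Finset.abs_sum_le_sum_abs _ _).trans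
    (Finset.sum_le_sum fun k _ => hB k i)⟩

lemma of_compact {E : Type*} [TopologicalSpace E] {F : E → ℝ} {K : Set E} (hK : IsCompact K)
    (hF : ContinuousOn F K) {p : ι → E} (hp : ∀ i, p i ∈ K) : IsBdd fun i => F (p i) := by
  obtain ⟨B, hB⟩ := hK.exists_bound_of_continuousOn hF
  exact ⟨B, fun i => hB _ (hp i)⟩

end IsBdd

lemma HasExpansion.exact' {F : ℝ → ι → ℝ} {a b c : ι → ℝ} (ha : IsBdd a) (hb : IsBdd b)
    (hc : IsBdd c) (hF : ∀ h i, F h i = a i + b i * h + c i * h ^ 2) : HasExpansion F a b c := by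
  obtain ⟨A, hA⟩ := ha
  obtain ⟨B, hB⟩ := hb
  obtain ⟨C, hC⟩ := hc
  exact HasExpansion.exact (B := max A (max B C)) (fun i => (hA i).trans (le_max_left _ _))
    (fun i => (hB i).trans ((le_max_left _ _).trans (le_max_right _ _)))
    (fun i => (hC i).trans ((le_max_right _ _).trans (le_max_right _ _))) hF

/-- Expansion of a quadratic form. -/
lemma HasExpansion.quad {Q : Fin 2 → Fin 2 → ℝ → ι → ℝ} {q q' q'' : Fin 2 → Fin 2 → ι → ℝ}
    {X : Fin 2 → ℝ → ι → ℝ} {ξ ξ' ξ'' : Fin 2 → ι → ℝ}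
    (hQ : ∀ a b, HasExpansion (Q a b) (q a b) (q' a b) (q'' a b))
    (hX : ∀ a, HasExpansion (X a) (ξ a) (ξ' a) (ξ'' a)) :
    HasExpansion (fun r i => ∑ a, ∑ b, Q a b r i * X a r i * X b r i)
      (fun i => ∑ a, ∑ b, q a b i * ξ a i * ξ b i)
      (fun i => ∑ a, ∑ b, (q a b i * (ξ a i * ξ' b i + ξ' a i * ξ b i)
        + q' a b i * (ξ a i * ξ b i)))
      (fun i => ∑ a, ∑ b, (q a b i * (ξ a i * ξ'' b i + ξ' a i * ξ' b i + ξ'' a i * ξ b i)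
        + q' a b i * (ξ a i * ξ' b i + ξ' a i * ξ b i) + q'' a b i * (ξ a i * ξ b i))) := by
  refine HasExpansion.sum _ fun a => HasExpansion.sum _ fun b => ?_
  have := (hQ a b).mul ((hX a).mul (hX b))
  simp only [← mul_assoc] at this
  refine this.congr (fun i => by ring) (fun i => by ring) (fun i => by ring)

end Bounded

section Density

variable {g : (Fin 2 → ℝ) → ℝ → Matrix (Fin 2) (Fin 2) ℝ} {T : ℝ}

/-- The squared length of the vector `ξ`. -/
def normSq (G : Matrix (Fin 2) (Fin 2) ℝ) (ξ : Fin 2 → ℝ) : ℝ := ∑ a, ∑ b, G a b * ξ a * ξ b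

/-- Position of the varied curve. -/
def varPos (g : (Fin 2 → ℝ) → ℝ → Matrix (Fin 2) (Fin 2) ℝ) (x : Fin 2 → ℝ) (t : ℝ)
    (V : Fin 2 → ℝ) (η h : ℝ) : Fin 2 → ℝ :=
  x + h • (η • V) + h ^ 2 • ((η ^ 2 / 4) • drift (fun y => g y t) x)

/-- Velocity of the varied curve. -/
def varVel (g : (Fin 2 → ℝ) → ℝ → Matrix (Fin 2) (Fin 2) ℝ) (x : Fin 2 → ℝ) (t : ℝ)
    (V ξ : Fin 2 → ℝ) (ζ η h : ℝ) (b : Fin 2) : ℝ :=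
  ξ b + SmoothMetric.velOne (fun y => g y t) x ξ V ζ η b * h
    + SmoothMetric.velTwo (fun y => g y t) x ξ ζ η b * h ^ 2

/-- Energy density of the varied curve at the earlier time `t - h ^ 2 / 4`. -/
def varDensity (g : (Fin 2 → ℝ) → ℝ → Matrix (Fin 2) (Fin 2) ℝ) (x : Fin 2 → ℝ) (t : ℝ)
    (V ξ : Fin 2 → ℝ) (ζ η h : ℝ) : ℝ :=
  normSq (g (varPos g x t V η h) (t - h ^ 2 / 4)) (varVel g x t V ξ ζ η h)

/-- Second order coefficient of `varDensity`. -/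
def densityTwo (G : (Fin 2 → ℝ) → Matrix (Fin 2) (Fin 2) ℝ) (x V ξ : Fin 2 → ℝ) (ζ η k : ℝ) : ℝ :=
  ∑ a, ∑ b, (G x a b * (ξ a * SmoothMetric.velTwo G x ξ ζ η b
        + SmoothMetric.velOne G x ξ V ζ η a * SmoothMetric.velOne G x ξ V ζ η b
        + SmoothMetric.velTwo G x ξ ζ η a * ξ b)
      + (∑ c, (η • V) c * pd (fun y => G y a b) c x) *
        (ξ a * SmoothMetric.velOne G x ξ V ζ η b + SmoothMetric.velOne G x ξ V ζ η a * ξ b)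
      + (∑ c, ((η ^ 2 / 4) • drift G x) c * pd (fun y => G y a b) c x
          - (-2 * k * G x a b) / 4
          + (∑ c, ∑ d, (η • V) c * (η • V) d * pd (pd (fun y => G y a b) c) d x) / 2) *
        (ξ a * ξ b))

lemma SmoothMetric.densityTwo_add {G : (Fin 2 → ℝ) → Matrix (Fin 2) (Fin 2) ℝ}
    (h : SmoothMetric G) (x ξ : Fin 2 → ℝ) (V : Fin 2 → Fin 2 → ℝ) (ζ η : ℝ)
    (hV : ∀ c d, V 0 c * V 0 d + V 1 c * V 1 d = (G x)⁻¹ c d) (k : ℝ) :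
    densityTwo G x (V 0) ξ ζ η k + densityTwo G x (V 1) ξ ζ η k =
      2 * ζ ^ 2 + (k - gaussCurv G x * η ^ 2) * normSq (G x) ξ := by
  rw [normSq, ← h.density_second x ξ V ζ η hV k, Fin.sum_univ_two]
  rfl

namespace RicciFlowTwo

lemma density_expansion (h : RicciFlowTwo g T) {ι : Type*} {K : Set ((Fin 2 → ℝ) × ℝ)}
    (hK : IsCompact K) (hKΩ : K ⊆ univ ×ˢ Ioo (0:ℝ) T) {x V ξ : ι → Fin 2 → ℝ} {t ζ η : ι → ℝ}
    (hxt : ∀ i, (x i, t i) ∈ K) {B : ℝ} (hV : ∀ i, ‖V i‖ ≤ B) (hξ : ∀ i, ‖ξ i‖ ≤ B)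
    (hζ : ∀ i, |ζ i| ≤ B) (hη : ∀ i, |η i| ≤ 1) :
    HasExpansion (fun r i => varDensity g (x i) (t i) (V i) (ξ i) (ζ i) (η i) r)
      (fun i => normSq (g (x i) (t i)) (ξ i))
      (fun i => 2 * ζ i * ∑ a, ∑ b, g (x i) (t i) a b * ξ i a * V i b)
      (fun i => densityTwo (fun y => g y (t i)) (x i) (V i) (ξ i) (ζ i) (η i) (curv g (x i, t i))) := by
  have bV : ∀ a, IsBdd fun i => V i a := fun a => ⟨B, fun i => (norm_le_pi_norm (V i) a).trans (hV i)⟩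
  have bξ : ∀ a, IsBdd fun i => ξ i a := fun a => ⟨B, fun i => (norm_le_pi_norm (ξ i) a).trans (hξ i)⟩
  have bζ : IsBdd ζ := ⟨B, hζ⟩
  have bη : IsBdd η := ⟨1, hη⟩
  have bΓ : ∀ k e f, IsBdd fun i => christoffel (fun y => g y (t i)) (x i) k e f := fun k e f =>
    IsBdd.of_compact (F := fun p : (Fin 2 → ℝ) × ℝ => christoffel (fun y => g y p.2) p.1 k e f)
      (p := fun i => (x i, t i)) hK ((h.contDiffOn_christoffel k e f).continuousOn.mono hKΩ) hxt
  have bH : ∀ b, IsBdd fun i => drift (fun y => g y (t i)) (x i) b := fun b =>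
    IsBdd.of_compact (F := fun p : (Fin 2 → ℝ) × ℝ => drift (fun y => g y p.2) p.1 b)
      (p := fun i => (x i, t i)) hK ((h.contDiffOn_drift b).continuousOn.mono hKΩ) hxt
  have bH' : ∀ b e, IsBdd fun i => pd (fun y => drift (fun y => g y (t i)) y b) e (x i) := fun b e =>
    IsBdd.of_compact
      (F := fun p : (Fin 2 → ℝ) × ℝ => pd (fun y => drift (fun y => g y p.2) y b) e p.1)
      (p := fun i => (x i, t i)) hK ((contDiffOn_pd_slice isOpen_domain
      (h.contDiffOn_drift b) e).continuousOn.mono hKΩ) hxt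
  have b1 : ∀ b, IsBdd fun i =>
      SmoothMetric.velOne (fun y => g y (t i)) (x i) (ξ i) (V i) (ζ i) (η i) b := fun b =>
    (bζ.mul (bV b)).sub (bη.mul (IsBdd.sum _ fun e => IsBdd.sum _ fun f =>
      ((bΓ b e f).mul (bξ e)).mul (bV f)))
  have b2 : ∀ b, IsBdd fun i =>
      SmoothMetric.velTwo (fun y => g y (t i)) (x i) (ξ i) (ζ i) (η i) b := fun b =>
    (IsBdd.const _).mul ((((((IsBdd.const 2).mul bη).mul bζ).mul (bH b))).add
      ((bη.pow 2).mul (IsBdd.sum _ fun e => (bH' b e).mul (bξ e))))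
  have sη : ∀ i, |η i| ^ 2 ≤ 1 := fun i => pow_le_one₀ (abs_nonneg _) (hη i)
  obtain ⟨MH0, hMH0⟩ := bH 0
  obtain ⟨MH1, hMH1⟩ := bH 1
  have Q : ∀ a b, HasExpansion
      (fun r i => g (varPos g (x i) (t i) (V i) (η i) r) (t i - r ^ 2 / 4) a b) _ _ _ := fun a b =>
    HasExpansion.of_contDiffOn isOpen_domain (h.entry a b) hK hKΩ hxt
      (V := fun i => η i • V i) (W := fun i => (η i ^ 2 / 4) • drift (fun y => g y (t i)) (x i))
      (B := max B (max MH0 MH1)) (fun i => by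
        rw [norm_smul, Real.norm_eq_abs]
        exact (mul_le_of_le_one_left (norm_nonneg _) (hη i)).trans ((hV i).trans (le_max_left _ _)))
      (fun i => by
        rw [norm_smul, Real.norm_eq_abs, abs_div, abs_pow]
        refine (mul_le_of_le_one_left (norm_nonneg _) ?_).trans ?_
        · rw [abs_of_pos (by norm_num : (0:ℝ) < 4)]; linarith [sη i]
        · refine le_trans ?_ (le_max_right _ _)
          refine (pi_norm_le_iff_of_nonneg ((abs_nonneg _).trans ((hMH0 i).trans
            (le_max_left _ _)))).2 fun c => ?_
          fin_cases c
          · exact (hMH0 i).trans (le_max_left _ _)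
          · exact (hMH1 i).trans (le_max_right _ _))
  have X : ∀ b, HasExpansion (fun r i => varVel g (x i) (t i) (V i) (ξ i) (ζ i) (η i) r b)
      (fun i => ξ i b)
      (fun i => SmoothMetric.velOne (fun y => g y (t i)) (x i) (ξ i) (V i) (ζ i) (η i) b)
      (fun i => SmoothMetric.velTwo (fun y => g y (t i)) (x i) (ξ i) (ζ i) (η i) b) := fun b =>
    HasExpansion.exact' (bξ b) (b1 b) (b2 b) fun r i => rfl
  have R := HasExpansion.quad
    (Q := fun a b r i => g (varPos g (x i) (t i) (V i) (η i) r) (t i - r ^ 2 / 4) a b)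
    (X := fun b r i => varVel g (x i) (t i) (V i) (ξ i) (ζ i) (η i) r b) Q X
  refine R.congr (fun i => rfl) (fun i => ?_) (fun i => ?_)
  · exact (h.slice' (hKΩ (hxt i)).2).density_first (x i) (ξ i) (V i) (ζ i) (η i)
  · unfold densityTwo
    refine Finset.sum_congr rfl fun a _ => Finset.sum_congr rfl fun b _ => ?_
    have e := (h.hasDerivAt_time (x i) (hKΩ (hxt i)).2 a b).deriv
    exact congrArg _ (congrArg (fun z => (_ - z / 4 + _) * _) e)

end RicciFlowTwo
end Density

section Bounds

variable {G : (Fin 2 → ℝ) → Matrix (Fin 2) (Fin 2) ℝ}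

namespace SmoothMetric

lemma sq_le_normSq (h : SmoothMetric G) (x ξ : Fin 2 → ℝ) (c : Fin 2) :
    ξ c ^ 2 ≤ (G x)⁻¹ c c * normSq (G x) ξ := by
  have hD := h.det_pos x
  obtain ⟨i00, -, -, i11⟩ := h.inv_apply x
  revert c
  simp only [Fin.forall_fin_two, normSq, Fin.sum_univ_two, i00, i11, h.symm]
  constructor
  · rw [div_mul_eq_mul_div, le_div_iff₀ hD]
    linarith [sq_nonneg (G x 0 1 * ξ 0 + G x 1 1 * ξ 1)]
  · rw [div_mul_eq_mul_div, le_div_iff₀ hD]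
    linarith [sq_nonneg (G x 0 0 * ξ 0 + G x 0 1 * ξ 1)]

lemma normSq_nonneg (h : SmoothMetric G) (x ξ : Fin 2 → ℝ) : 0 ≤ normSq (G x) ξ := by
  have h1 := (sq_nonneg _).trans (h.sq_le_normSq x ξ 1)
  rw [(h.inv_apply x).2.2.2] at h1
  exact nonneg_of_mul_nonneg_right h1 (div_pos (h.diag_pos x) (h.det_pos x))

lemma frame_inner (h : SmoothMetric G) (x ξ : Fin 2 → ℝ) {V : Fin 2 → Fin 2 → ℝ}
    (hV : ∀ c d, V 0 c * V 0 d + V 1 c * V 1 d = (G x)⁻¹ c d) :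
    (∑ a, ∑ b, G x a b * ξ a * V 0 b) ^ 2 + (∑ a, ∑ b, G x a b * ξ a * V 1 b) ^ 2 =
      normSq (G x) ξ := by
  have hD := h.det_pos x
  obtain ⟨i00, i01, i10, i11⟩ := h.inv_apply x
  have h00 := hV 0 0
  have h01 := hV 0 1
  have h11 := hV 1 1
  rw [i00] at h00
  rw [i01] at h01
  rw [i11] at h11
  simp only [normSq, Fin.sum_univ_two, h.symm]
  rw [show ∀ a b c p q u v u' v' : ℝ, (a * p * u + b * p * v + (b * q * u + c * q * v)) ^ 2
      + (a * p * u' + b * p * v' + (b * q * u' + c * q * v')) ^ 2 =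
      (a * p + b * q) ^ 2 * (u * u + u' * u') + 2 * (a * p + b * q) * (b * p + c * q) *
        (u * v + u' * v') + (b * p + c * q) ^ 2 * (v * v + v' * v') by intros; ring, h00, h01, h11]
  generalize G x 0 0 = a at *
  generalize G x 0 1 = b at *
  generalize G x 1 1 = c at *
  generalize hDD : a * c - b ^ 2 = D at *
  field_simp
  subst hDD
  ring

end SmoothMetric

lemma frame_sq_le {M : Matrix (Fin 2) (Fin 2) ℝ} {V : Fin 2 → Fin 2 → ℝ}
    (hV : ∀ c d, V 0 c * V 0 d + V 1 c * V 1 d = M c d) (i c : Fin 2) : V i c ^ 2 ≤ M c c := by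
  rw [← hV]
  revert i
  simp only [Fin.forall_fin_two]
  constructor <;> nlinarith [sq_nonneg (V 1 c), sq_nonneg (V 0 c)]

end Bounds

section DensityBounds

variable {g : (Fin 2 → ℝ) → ℝ → Matrix (Fin 2) (Fin 2) ℝ} {T : ℝ}

lemma normSq_smul (M : Matrix (Fin 2) (Fin 2) ℝ) (c : ℝ) (ξ : Fin 2 → ℝ) :
    normSq M (c • ξ) = c ^ 2 * normSq M ξ := by
  simp only [normSq, Fin.sum_univ_two, Pi.smul_apply, smul_eq_mul]
  ring

lemma varDensity_smul (x : Fin 2 → ℝ) (t : ℝ) (V ξ : Fin 2 → ℝ) (c ζ η h : ℝ) :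
    varDensity g x t V (c • ξ) (c * ζ) η h = c ^ 2 * varDensity g x t V ξ ζ η h := by
  rw [varDensity, varDensity, ← normSq_smul]
  congr 1
  funext b
  simp only [varVel, SmoothMetric.velOne, SmoothMetric.velTwo, Fin.sum_univ_two, Pi.smul_apply,
    smul_eq_mul]
  ring

set_option maxHeartbeats 1000000 in
/-- Uniform estimates for the change of the energy density under the variation. -/
lemma RicciFlowTwo.density_bounds (h : RicciFlowTwo g T) {K : Set ((Fin 2 → ℝ) × ℝ)}
    (hK : IsCompact K) (hKΩ : K ⊆ univ ×ˢ Ioo (0:ℝ) T) {A : ℝ} (hA : 0 ≤ A) :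
    ∃ h₀ > 0, ∃ M ≥ 0, ∀ x t, (x, t) ∈ K → ∀ V : Fin 2 → Fin 2 → ℝ,
      (∀ c d, V 0 c * V 0 d + V 1 c * V 1 d = (g x t)⁻¹ c d) → ∀ (ξ : Fin 2 → ℝ) (ζ η : ℝ),
      |η| ≤ 1 → |ζ| ≤ 1 + A * √(normSq (g x t) ξ) → |curv g (x, t) * (1 - η ^ 2)| ≤ A →
      ∀ r, |r| ≤ h₀ →
        (∀ i, |varDensity g x t (V i) ξ ζ η r - normSq (g x t) ξ| ≤
          (8 * (1 + A) ^ 2 * |r| + M * r ^ 2) * (1 + normSq (g x t) ξ)) ∧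
        ∑ i, (varDensity g x t (V i) ξ ζ η r + varDensity g x t (V i) ξ ζ η (-r)) ≤
          4 * normSq (g x t) ξ + 8 * (1 + A) ^ 2 * r ^ 2 * (1 + normSq (g x t) ξ)
            + M * |r| ^ 3 * (1 + normSq (g x t) ξ) := by
  have i1 : ∀ s : ℝ, (1 + A * s) * s ≤ (1 + A) * (1 + s ^ 2) := fun s => by
    nlinarith [sq_nonneg (1 - s)]
  have i2 : ∀ s : ℝ, 2 * (1 + A * s) ^ 2 + A * s ^ 2 ≤ 4 * (1 + A) ^ 2 * (1 + s ^ 2) := fun s => by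
    nlinarith [sq_nonneg (A - s), mul_nonneg hA (sq_nonneg s)]
  have i3 : ∀ s : ℝ, 0 ≤ s → 1 + A * s ≤ (1 + s) * (1 + A) := fun s hs => by linarith
  have i4 : 1 + A ≤ (1 + A) ^ 2 := by nlinarith
  have i5 : ∀ s : ℝ, (1 + s) ^ 2 ≤ 2 * (1 + s ^ 2) := fun s => by nlinarith [sq_nonneg (1 - s)]
  have cI : ∀ c, ContinuousOn (fun p : (Fin 2 → ℝ) × ℝ => (g p.1 p.2)⁻¹ c c) K := fun c =>
    ((h.contDiffOn_inv c c).continuousOn.mono domain_subset).mono hKΩ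
  obtain ⟨B0, hB0⟩ := hK.exists_bound_of_continuousOn (cI 0)
  obtain ⟨B1, hB1⟩ := hK.exists_bound_of_continuousOn (cI 1)
  set B : ℝ := 1 + A + |B0| + |B1| with hB
  have hBA : 1 + A ≤ B := by linarith [abs_nonneg B0, abs_nonneg B1]
  have hBc : ∀ p ∈ K, ∀ c, (g p.1 p.2)⁻¹ c c ≤ B := fun p hp c => by
    revert c
    rw [Fin.forall_fin_two]
    have e0 := (le_abs_self _).trans ((hB0 p hp).trans (le_abs_self _))
    have e1 := (le_abs_self _).trans ((hB1 p hp).trans (le_abs_self _))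
    constructor <;> linarith [abs_nonneg B0, abs_nonneg B1]
  have hsq : ∀ y : Fin 2 → ℝ, (∀ c, y c ^ 2 ≤ B) → ‖y‖ ≤ B := fun y hy => by
    refine (pi_norm_le_iff_of_nonneg (by linarith)).2 fun c => ?_
    rw [Real.norm_eq_abs]
    refine abs_le_of_sq_le_sq ((hy c).trans ?_) (by linarith)
    nlinarith
  let ι := {p : ((Fin 2 → ℝ) × ℝ) × ((Fin 2 → ℝ) × (Fin 2 → ℝ)) × (ℝ × ℝ) //
    p.1 ∈ K ∧ ‖p.2.1.1‖ ≤ B ∧ ‖p.2.1.2‖ ≤ B ∧ |p.2.2.1| ≤ B ∧ |p.2.2.2| ≤ 1}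
  obtain ⟨h₁, hh₁, M₁, H⟩ := h.density_expansion hK hKΩ (ι := ι) (x := fun p => p.1.1.1)
    (t := fun p => p.1.1.2) (V := fun p => p.1.2.1.1) (ξ := fun p => p.1.2.1.2)
    (ζ := fun p => p.1.2.2.1) (η := fun p => p.1.2.2.2) (B := B) (fun p => p.2.1)
    (fun p => p.2.2.1) (fun p => p.2.2.2.1) (fun p => p.2.2.2.2.1) (fun p => p.2.2.2.2.2)
  refine ⟨min h₁ 1, lt_min hh₁ one_pos, 8 * |M₁|, by positivity,
    fun x t hxt V hV ξ ζ η hη hζ hc r hr => ?_⟩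
  have hG := h.slice' (hKΩ hxt).2
  set q := normSq (g x t) ξ with hq
  have hq0 : 0 ≤ q := hG.normSq_nonneg x ξ
  set s := √q with hs
  have hs0 : 0 ≤ s := Real.sqrt_nonneg _
  have hsq' : s ^ 2 = q := Real.sq_sqrt hq0
  have hlam : 0 < 1 + s := by linarith
  have hξ' : ‖(1 + s)⁻¹ • ξ‖ ≤ B := hsq _ fun c => by
    have e1 := hG.sq_le_normSq x ξ c
    have e2 := hBc _ hxt c
    rw [Pi.smul_apply, smul_eq_mul, mul_pow, inv_pow, inv_mul_le_iff₀ (by positivity)]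
    refine (e1.trans (mul_le_mul_of_nonneg_right e2 hq0)).trans ?_
    rw [mul_comm]
    exact mul_le_mul_of_nonneg_right (hsq'.symm.trans_le (pow_le_pow_left₀ hs0 (by linarith) 2))
      (by linarith)
  have hζ' : |(1 + s)⁻¹ * ζ| ≤ B := by
    rw [abs_mul, abs_of_pos (by positivity), inv_mul_le_iff₀ hlam]
    exact hζ.trans ((i3 s hs0).trans (mul_le_mul_of_nonneg_left hBA hlam.le))
  have hV' : ∀ i, ‖V i‖ ≤ B := fun i => hsq _ fun c => (frame_sq_le hV i c).trans (hBc _ hxt c)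
  have e1 : ξ = (1 + s) • (1 + s)⁻¹ • ξ := (smul_inv_smul₀ hlam.ne' ξ).symm
  have e2 : ζ = (1 + s) * ((1 + s)⁻¹ * ζ) := (mul_inv_cancel_left₀ hlam.ne' ζ).symm
  generalize (1 + s)⁻¹ • ξ = ξ' at e1 hξ'
  generalize (1 + s)⁻¹ * ζ = ζ' at e2 hζ'
  have H' := fun i => H ⟨((x, t), (V i, ξ'), (ζ', η)), hxt, hV' i, hξ', hζ', hη⟩
  simp only at H'
  clear H
  have hD : ∀ i r, varDensity g x t (V i) ξ ζ η r = (1 + s) ^ 2 * varDensity g x t (V i) ξ' ζ' η r :=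
    fun i r => by rw [e1, e2, varDensity_smul]
  have hqq : q = (1 + s) ^ 2 * normSq (g x t) ξ' := by rw [hq, e1, normSq_smul]
  have hin := hG.frame_inner x ξ' hV
  have htwo := SmoothMetric.densityTwo_add hG x ξ' V ζ' η hV (curv g (x, t))
  have hgc : gaussCurv (fun y => g y t) x = curv g (x, t) := rfl
  rw [hgc] at htwo
  set q' := normSq (g x t) ξ' with hq'
  set P : Fin 2 → ℝ := fun i => ∑ a, ∑ b, g x t a b * ξ' a * V i b with hP
  set d : Fin 2 → ℝ := fun i => densityTwo (fun y => g y t) x (V i) ξ' ζ' η (curv g (x, t)) with hd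
  change P 0 ^ 2 + P 1 ^ 2 = q' at hin
  change d 0 + d 1 = 2 * ζ' ^ 2 + (curv g (x, t) - curv g (x, t) * η ^ 2) * q' at htwo
  change ∀ i, |q'| ≤ M₁ ∧ |2 * ζ' * P i| ≤ M₁ ∧ |d i| ≤ M₁ ∧ ∀ r, |r| ≤ h₁ →
    |varDensity g x t (V i) ξ' ζ' η r - (q' + 2 * ζ' * P i * r + d i * r ^ 2)| ≤ M₁ * |r| ^ 3 at H'
  clear_value P d q q' s
  have hM₁ : 0 ≤ M₁ := (abs_nonneg _).trans (H' 0).1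
  have hr1 : |r| ≤ 1 := hr.trans (min_le_right _ _)
  have hrh : |r| ≤ h₁ := hr.trans (min_le_left _ _)
  rw [abs_of_nonneg hM₁]
  have hr3 : |r| ^ 3 ≤ r ^ 2 := by
    rw [← sq_abs r]; exact pow_le_pow_of_le_one (abs_nonneg r) hr1 (by norm_num)
  have hL : (1 + s) ^ 2 ≤ 2 * (1 + q) := hsq' ▸ i5 s
  have hζζ : (1 + s) * |ζ'| ≤ 1 + A * s := by
    rwa [← abs_of_pos hlam, ← abs_mul, ← e2]
  have hPs : ∀ i, (1 + s) * |P i| ≤ s := fun i => by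
    rw [← abs_of_pos hlam, ← abs_mul]
    refine abs_le_of_sq_le_sq ?_ hs0
    have : P i ^ 2 ≤ q' := by
      revert i
      rw [Fin.forall_fin_two]
      constructor <;> linarith [sq_nonneg (P 0), sq_nonneg (P 1)]
    rw [mul_pow, hsq', hqq]
    exact mul_le_mul_of_nonneg_left this (sq_nonneg _)
  constructor
  · intro i
    obtain ⟨-, -, hdi, hE⟩ := H' i
    have hE := hE r hrh
    rw [hD, hqq, ← mul_sub, abs_mul, abs_of_nonneg (sq_nonneg (1 + s)), ← hqq]
    have k1 : |varDensity g x t (V i) ξ' ζ' η r - q'| ≤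
        2 * (|ζ'| * |P i|) * |r| + M₁ * r ^ 2 + M₁ * r ^ 2 := by
      have := mul_le_mul_of_nonneg_left hr3 hM₁
      have k2 : |2 * ζ' * P i * r| = 2 * (|ζ'| * |P i|) * |r| := by
        rw [abs_mul, abs_mul, abs_mul, abs_two]; ring
      have k3 : |d i * r ^ 2| ≤ M₁ * r ^ 2 := by
        rw [abs_mul, abs_of_nonneg (sq_nonneg r)]
        exact mul_le_mul_of_nonneg_right hdi (sq_nonneg r)
      rw [← k2]
      have k4 : varDensity g x t (V i) ξ' ζ' η r - q' =
        (varDensity g x t (V i) ξ' ζ' η r - (q' + 2 * ζ' * P i * r + d i * r ^ 2))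
          + 2 * ζ' * P i * r + d i * r ^ 2 := by ring
      rw [k4]
      refine (abs_add_le _ _).trans ((add_le_add (abs_add_le _ _) k3).trans ?_)
      linarith [hE]
    have k5 : (1 + s) ^ 2 * (|ζ'| * |P i|) ≤ (1 + A * s) * s := by
      calc (1 + s) ^ 2 * (|ζ'| * |P i|) = ((1 + s) * |ζ'|) * ((1 + s) * |P i|) := by ring
        _ ≤ _ := mul_le_mul hζζ (hPs i) (by positivity) (by positivity)
    have k6 : (1 + A * s) * s ≤ (1 + A) * (1 + q) := hsq' ▸ i1 s
    calc (1 + s) ^ 2 * |varDensity g x t (V i) ξ' ζ' η r - q'|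
        ≤ (1 + s) ^ 2 * (2 * (|ζ'| * |P i|) * |r| + M₁ * r ^ 2 + M₁ * r ^ 2) :=
          mul_le_mul_of_nonneg_left k1 (sq_nonneg _)
      _ = 2 * ((1 + s) ^ 2 * (|ζ'| * |P i|)) * |r| + (1 + s) ^ 2 * (2 * M₁ * r ^ 2) := by ring
      _ ≤ 2 * ((1 + A) * (1 + q)) * |r| + 2 * (1 + q) * (2 * M₁ * r ^ 2) :=
          add_le_add (mul_le_mul_of_nonneg_right (mul_le_mul_of_nonneg_left (k5.trans k6)
            zero_le_two) (abs_nonneg r)) (mul_le_mul_of_nonneg_right hL (by positivity))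
      _ ≤ (8 * (1 + A) ^ 2 * |r| + 8 * M₁ * r ^ 2) * (1 + q) := by
          have : (1 + A) * |r| ≤ (1 + A) ^ 2 * |r| :=
            mul_le_mul_of_nonneg_right i4 (abs_nonneg r)
          have h1q : 0 ≤ 1 + q := by linarith
          have t1 := mul_le_mul_of_nonneg_right this h1q
          have t2 : 0 ≤ M₁ * r ^ 2 * (1 + q) := by positivity
          have t3 : 0 ≤ (1 + A) * |r| * (1 + q) := by positivity
          linarith
  · have hE : ∀ i, varDensity g x t (V i) ξ ζ η r + varDensity g x t (V i) ξ ζ η (-r) ≤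
        2 * q + (1 + s) ^ 2 * (2 * d i * r ^ 2 + 2 * (M₁ * |r| ^ 3)) := fun i => by
      have k1 := (abs_le.1 ((H' i).2.2.2 r hrh)).2
      have k2 := (abs_le.1 ((H' i).2.2.2 (-r) (by rwa [abs_neg]))).2
      rw [abs_neg] at k2
      rw [hD, hD, hqq]
      have := mul_le_mul_of_nonneg_left (add_le_add k1 k2) (sq_nonneg (1 + s))
      linarith
    rw [Fin.sum_univ_two]
    have k3 := add_le_add (hE 0) (hE 1)
    have k4 : (1 + s) ^ 2 * (d 0 + d 1) ≤ 2 * (1 + A * s) ^ 2 + A * q := by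
      rw [htwo]
      have k5 := abs_le.1 hc
      have k6 : ((1 + s) * ζ') ^ 2 ≤ (1 + A * s) ^ 2 := by
        rw [← sq_abs, abs_mul, abs_of_pos hlam]
        exact pow_le_pow_left₀ (by positivity) hζζ 2
      have k7 := mul_le_mul_of_nonneg_right k5.2 hq0
      rw [hqq] at k7 ⊢
      linarith
    have k8 : 2 * (1 + A * s) ^ 2 + A * q ≤ 4 * (1 + A) ^ 2 * (1 + q) := hsq' ▸ i2 s
    have k9 := mul_le_mul_of_nonneg_right (k4.trans k8) (sq_nonneg r)
    have k10 := mul_le_mul_of_nonneg_right hL (by positivity : 0 ≤ M₁ * |r| ^ 3)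
    linarith

end DensityBounds

section Energy

variable {g : (Fin 2 → ℝ) → ℝ → Matrix (Fin 2) (Fin 2) ℝ} {T : ℝ}

/-- The energy of a curve. -/
def energy (G : (Fin 2 → ℝ) → Matrix (Fin 2) (Fin 2) ℝ) (γ : ℝ → Fin 2 → ℝ) : ℝ :=
  ∫ s in (0:ℝ)..1, normSq (G (γ s)) (deriv γ s)

lemma SmoothMetric.continuous_normSq {G : (Fin 2 → ℝ) → Matrix (Fin 2) (Fin 2) ℝ}
    (h : SmoothMetric G) {ι : Type*} [TopologicalSpace ι] {x ξ : ι → Fin 2 → ℝ}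
    (hx : Continuous x) (hξ : Continuous ξ) : Continuous fun i => normSq (G (x i)) (ξ i) := by
  unfold normSq
  refine continuous_finsetSum _ fun a _ => continuous_finsetSum _ fun b _ => ?_
  exact (((h.1 a b).continuous.comp hx).mul ((continuous_apply a).comp hξ)).mul
    ((continuous_apply b).comp hξ)

lemma SmoothMetric.continuous_energyDensity {G : (Fin 2 → ℝ) → Matrix (Fin 2) (Fin 2) ℝ}
    (h : SmoothMetric G) {γ : ℝ → Fin 2 → ℝ} (hγ : ContDiff ℝ 1 γ) :
    Continuous fun s => normSq (G (γ s)) (deriv γ s) :=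
  h.continuous_normSq hγ.continuous (hγ.continuous_deriv le_rfl)

lemma SmoothMetric.energy_nonneg {G : (Fin 2 → ℝ) → Matrix (Fin 2) (Fin 2) ℝ}
    (h : SmoothMetric G) (γ : ℝ → Fin 2 → ℝ) : 0 ≤ energy G γ :=
  intervalIntegral.integral_nonneg zero_le_one fun _ _ => h.normSq_nonneg _ _

lemma hasDerivAt_varCurve {t : ℝ} (hG : SmoothMetric fun y => g y t) {γ V : ℝ → Fin 2 → ℝ}
    {η : ℝ → ℝ} {ξ : Fin 2 → ℝ} {ζ s : ℝ} (hγ : HasDerivAt γ ξ s)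
    (hV : HasDerivAt V (-conn (fun y => g y t) (γ s) ξ (V s)) s) (hη : HasDerivAt η ζ s) (r : ℝ) :
    HasDerivAt (fun s => varPos g (γ s) t (V s) (η s) r) (varVel g (γ s) t (V s) ξ ζ (η s) r) s := by
  rw [hasDerivAt_pi]
  intro b
  have h1 := (hasDerivAt_pi.1 hγ b)
  have h2 := (hasDerivAt_pi.1 hV b)
  have h3 := hasDerivAt_comp_curve (((hG.contDiff_drift b).differentiable (by simp)) (γ s)) hγ
  refine HasDerivAt.congr_deriv ((h1.add ((hη.mul h2).const_mul r)).add
    (((hη.pow 2).div_const 4 |>.mul h3).const_mul (r ^ 2))) ?_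
  simp only [varVel, SmoothMetric.velOne, SmoothMetric.velTwo, conn, Fin.sum_univ_two,
    Pi.neg_apply, Pi.pow_apply]
  ring

lemma contDiff_varCurve {t : ℝ} (hG : SmoothMetric fun y => g y t) {γ V : ℝ → Fin 2 → ℝ}
    {η : ℝ → ℝ} (hγ : ContDiff ℝ 1 γ)
    (hV : ∀ s, HasDerivAt V (-conn (fun y => g y t) (γ s) (deriv γ s) (V s)) s)
    (hη : ContDiff ℝ 1 η) (r : ℝ) :
    ContDiff ℝ 1 (fun s => varPos g (γ s) t (V s) (η s) r) := by
  have cV : ContDiff ℝ 1 V := by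
    rw [contDiff_one_iff_deriv]
    have c : Continuous V := continuous_iff_continuousAt.2 fun s => (hV s).continuousAt
    refine ⟨fun s => (hV s).differentiableAt, ?_⟩
    rw [show deriv V = _ from funext fun s => (hV s).deriv]
    exact (hG.continuous_conn hγ.continuous (hγ.continuous_deriv le_rfl) c).neg
  have cH : ContDiff ℝ 1 fun s => drift (fun y => g y t) (γ s) :=
    contDiff_pi.2 fun b => ((hG.contDiff_drift b).of_le (by simp)).comp hγ
  unfold varPos
  fun_prop

end Energy

section Variation

variable {g : (Fin 2 → ℝ) → ℝ → Matrix (Fin 2) (Fin 2) ℝ} {T : ℝ}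

/-- Control of the cut-off factor of the variation and of its derivative along a curve. -/
lemma RicciFlowTwo.exists_cutoff (h : RicciFlowTwo g T) (x₀ : Fin 2 → ℝ) {T₁ : ℝ}
    (hT₁ : T₁ ∈ Ioo 0 T) : ∃ φ : (Fin 2 → ℝ) → ℝ, ContDiff ℝ 1 φ ∧ φ x₀ = 1 ∧
      (∀ x, φ x ∈ Icc (0:ℝ) 1) ∧ ∃ A ≥ 0, ∀ t ∈ Icc 0 T₁, ∀ x, ∀ θ ∈ Icc (0:ℝ) 1,
        |curv g (x, t) * (1 - (1 - θ * φ x) ^ 2)| ≤ A ∧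
        ∀ ξ : Fin 2 → ℝ, |φ x - θ * ∑ a, ξ a * pd φ a x| ≤ 1 + A * √(normSq (g x t) ξ) := by
  let φ : ContDiffBump x₀ := ⟨1, 2, one_pos, one_lt_two⟩
  have hφ : ContDiff ℝ 1 φ := φ.contDiff
  have h01 : ∀ x, φ x ∈ Icc (0:ℝ) 1 := fun x => ⟨φ.nonneg, φ.le_one⟩
  have hsub : Metric.closedBall x₀ 2 ×ˢ Icc 0 T₁ ⊆ (univ : Set (Fin 2 → ℝ)) ×ˢ Icc 0 T :=
    prod_mono (subset_univ _) (Icc_subset_Icc_right hT₁.2.le)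
  have hK : IsCompact (Metric.closedBall x₀ 2 ×ˢ Icc 0 T₁) :=
    (isCompact_closedBall x₀ 2).prod isCompact_Icc
  obtain ⟨A₁, hA₁⟩ := hK.exists_bound_of_continuousOn
    ((h.contDiffOn_curv (hT₁.1.trans hT₁.2)).continuousOn.mono hsub)
  obtain ⟨A₂, hA₂⟩ := hK.exists_bound_of_continuousOn
    ((h.contDiffOn_inv 0 0).continuousOn.mono hsub)
  obtain ⟨A₃, hA₃⟩ := hK.exists_bound_of_continuousOn
    ((h.contDiffOn_inv 1 1).continuousOn.mono hsub)
  obtain ⟨A₄, hA₄⟩ := (isCompact_closedBall x₀ 2).exists_bound_of_continuousOn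
    (hφ.continuous_fderiv (by simp)).continuousOn
  set B : ℝ := |A₂| + |A₃| with hB
  have hB0 : 0 ≤ B := by positivity
  refine ⟨φ, hφ, φ.one_of_mem_closedBall (by simp [φ]), h01, |A₁| + |A₄| * √B,
    by positivity, fun t ht x θ hθ => ?_⟩
  by_cases hx : x ∈ Metric.closedBall x₀ 2
  · have hxt : (x, t) ∈ Metric.closedBall x₀ 2 ×ˢ Icc 0 T₁ := ⟨hx, ht⟩
    constructor
    · have k1 : |curv g (x, t)| ≤ |A₁| := (hA₁ _ hxt).trans (le_abs_self _)
      have k2 : 0 ≤ θ * φ x := mul_nonneg hθ.1 (h01 x).1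
      have k3 : θ * φ x ≤ 1 := mul_le_one₀ hθ.2 (h01 x).1 (h01 x).2
      have k4 : |1 - (1 - θ * φ x) ^ 2| ≤ 1 := by
        rw [abs_le]; constructor <;> nlinarith
      rw [abs_mul]
      have := mul_le_mul k1 k4 (abs_nonneg _) (abs_nonneg _)
      have : 0 ≤ |A₄| * √B := by positivity
      linarith
    · intro ξ
      have hG := h.slice (t := t) ⟨ht.1, ht.2.trans hT₁.2.le⟩
      have hq := hG.normSq_nonneg x ξ
      have k1 : ‖ξ‖ ≤ √B * √(normSq (g x t) ξ) := by
        refine (pi_norm_le_iff_of_nonneg (by positivity)).2 fun c => ?_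
        rw [Real.norm_eq_abs, ← Real.sqrt_mul hB0]
        refine Real.abs_le_sqrt ((hG.sq_le_normSq x ξ c).trans ?_)
        refine mul_le_mul_of_nonneg_right ?_ hq
        have e0 := (le_abs_self _).trans ((hA₂ _ hxt).trans (le_abs_self _))
        have e1 := (le_abs_self _).trans ((hA₃ _ hxt).trans (le_abs_self _))
        revert c
        rw [Fin.forall_fin_two]
        constructor
        · exact e0.trans (le_add_of_nonneg_right (abs_nonneg _))
        · exact e1.trans (le_add_of_nonneg_left (abs_nonneg _))
      rw [← fderiv_apply_eq_sum_pd]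
      have k2 : |fderiv ℝ φ x ξ| ≤ |A₄| * (√B * √(normSq (g x t) ξ)) :=
        ((fderiv ℝ φ x).le_opNorm ξ).trans (mul_le_mul ((hA₄ _ hx).trans (le_abs_self _)) k1
          (norm_nonneg _) (abs_nonneg _))
      have k3 : |θ * fderiv ℝ φ x ξ| ≤ |fderiv ℝ φ x ξ| := by
        rw [abs_mul, abs_of_nonneg hθ.1]
        exact mul_le_of_le_one_left (abs_nonneg _) hθ.2
      have k4 : |φ x| ≤ 1 := by rw [abs_of_nonneg (h01 x).1]; exact (h01 x).2
      have k5 : 0 ≤ |A₁| * √(normSq (g x t) ξ) := by positivity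
      have k6 := abs_sub (φ x) (θ * fderiv ℝ φ x ξ)
      linarith
  · have h0 : φ x = 0 := φ.zero_of_le_dist (not_le.1 hx).le
    have hd : fderiv ℝ φ x = 0 := by
      refine image_eq_zero_of_notMem_tsupport fun hx' => hx ?_
      rw [← φ.tsupport_eq]
      exact tsupport_fderiv_subset ℝ hx'
    constructor
    · rw [h0]; simp; positivity
    · intro ξ
      simp only [h0, pd, hd]
      simp
      positivity

end Variation

section Variation

variable {g : (Fin 2 → ℝ) → ℝ → Matrix (Fin 2) (Fin 2) ℝ} {T : ℝ}

lemma abs_integral_sub_le {u v : ℝ → ℝ} (hu : Continuous u) (hv : Continuous v) {c : ℝ}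
    (H : ∀ s ∈ Icc (0:ℝ) 1, |u s - v s| ≤ c * (1 + v s)) :
    |(∫ s in (0:ℝ)..1, u s) - ∫ s in (0:ℝ)..1, v s| ≤ c * (1 + ∫ s in (0:ℝ)..1, v s) := by
  rw [← intervalIntegral.integral_sub (hu.intervalIntegrable _ _) (hv.intervalIntegrable _ _)]
  refine (intervalIntegral.abs_integral_le_integral_abs zero_le_one).trans ?_
  have e : c * (1 + ∫ s in (0:ℝ)..1, v s) = ∫ s in (0:ℝ)..1, c * (1 + v s) := by
    rw [intervalIntegral.integral_const_mul, intervalIntegral.integral_add (by simp)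
      (hv.intervalIntegrable _ _)]
    simp
  rw [e]
  exact intervalIntegral.integral_mono_on zero_le_one
    ((hu.sub hv).abs.intervalIntegrable _ _)
    ((continuous_const.mul (continuous_const.add hv)).intervalIntegrable _ _) H

/-- Every curve from `x₀` has four variations, reaching earlier times, whose energies are controlled
to second order. -/
lemma RicciFlowTwo.exists_energy_variation (h : RicciFlowTwo g T) (x₀ : Fin 2 → ℝ) {T₁ : ℝ}
    (hT₁ : T₁ ∈ Ioo 0 T) : ∃ C ≥ 1, ∀ τ₀ ∈ Ioc 0 T₁, ∀ Rb : ℝ, ∃ h₀ > 0, ∃ M ≥ 0,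
      ∀ t ∈ Icc τ₀ T₁, ∀ γ : ℝ → Fin 2 → ℝ, ContDiff ℝ 1 γ → γ 0 = x₀ →
      (∀ s ∈ Icc (0:ℝ) 1, ‖γ s‖ ≤ Rb) → ∃ V : Fin 2 → Fin 2 → ℝ,
      (∀ c d, V 0 c * V 0 d + V 1 c * V 1 d = (g (γ 1) t)⁻¹ c d) ∧
      ∃ Γ : Fin 2 → ℝ → ℝ → Fin 2 → ℝ, ∀ r, |r| ≤ h₀ →
        (∀ i, ContDiff ℝ 1 (Γ i r) ∧ Γ i r 0 = x₀ ∧ Γ i r 1 = varPos g (γ 1) t (V i) 1 r ∧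
          |energy (fun y => g y (t - r ^ 2 / 4)) (Γ i r) - energy (fun y => g y t) γ| ≤
            (C * |r| + M * r ^ 2) * (1 + energy (fun y => g y t) γ)) ∧
        ∑ i, (energy (fun y => g y (t - r ^ 2 / 4)) (Γ i r)
          + energy (fun y => g y (t - r ^ 2 / 4)) (Γ i (-r))) ≤ 4 * energy (fun y => g y t) γ
            + (C * r ^ 2 + M * |r| ^ 3) * (1 + energy (fun y => g y t) γ) := by
  obtain ⟨φ, hφ, hφ0, h01, A, hA, hcut⟩ := h.exists_cutoff x₀ hT₁
  refine ⟨8 * (1 + A) ^ 2, by nlinarith, fun τ₀ hτ₀ Rb => ?_⟩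
  have hKΩ : Metric.closedBall (0 : Fin 2 → ℝ) Rb ×ˢ Icc τ₀ T₁ ⊆ univ ×ˢ Ioo 0 T :=
    prod_mono (subset_univ _) (Icc_subset_Ioo hτ₀.1 hT₁.2)
  obtain ⟨h₁, hh₁, M, hM, H⟩ := h.density_bounds
    ((isCompact_closedBall (0 : Fin 2 → ℝ) Rb).prod isCompact_Icc) hKΩ hA
  refine ⟨min h₁ (√τ₀), lt_min hh₁ (Real.sqrt_pos.2 hτ₀.1), M, hM, fun t ht γ hγ hγ0 hb => ?_⟩
  have htI : t ∈ Ioo 0 T := ⟨hτ₀.1.trans_le ht.1, ht.2.trans_lt hT₁.2⟩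
  have hG := h.slice' htI
  obtain ⟨V, hV, hVV⟩ := hG.exists_parallel_frame hγ
  set η : ℝ → ℝ := fun s => 1 - (1 - s) * φ (γ s) with hη
  have cη : ContDiff ℝ 1 η :=
    contDiff_const.sub ((contDiff_const.sub contDiff_id).mul (hφ.comp hγ))
  have dγ : ∀ s, HasDerivAt γ (deriv γ s) s := fun s => (hγ.differentiable (by simp) s).hasDerivAt
  set ζ : ℝ → ℝ := fun s => φ (γ s) - (1 - s) * ∑ a, deriv γ s a * pd φ a (γ s) with hζ
  have dη : ∀ s, HasDerivAt η (ζ s) s := fun s => by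
    have h1 := hasDerivAt_comp_curve ((hφ.differentiable (by simp)) (γ s)) (dγ s)
    refine HasDerivAt.congr_deriv (((((hasDerivAt_id s).const_sub 1)).mul h1).const_sub 1) ?_
    simp only [hζ, id]
    ring
  set Γ : Fin 2 → ℝ → ℝ → Fin 2 → ℝ := fun i r s => varPos g (γ s) t (V i s) (η s) r with hΓ
  have cΓ : ∀ i r, ContDiff ℝ 1 (Γ i r) := fun i r => contDiff_varCurve hG hγ (hV i) cη r
  have dΓ : ∀ i r s, deriv (Γ i r) s = varVel g (γ s) t (V i s) (deriv γ s) (ζ s) (η s) r :=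
    fun i r s => (hasDerivAt_varCurve hG (dγ s) (hV i s) (dη s) r).deriv
  have dens : ∀ i r s, normSq (g (Γ i r s) (t - r ^ 2 / 4)) (deriv (Γ i r) s) =
      varDensity g (γ s) t (V i s) (deriv γ s) (ζ s) (η s) r := fun i r s => by
    rw [dΓ]; rfl
  have HB : ∀ s ∈ Icc (0:ℝ) 1, ∀ r, |r| ≤ h₁ → _ := fun s hs r hr =>
    H (γ s) t ⟨by simpa using hb s hs, ht⟩ (fun i => V i s) (hVV s) (deriv γ s) (ζ s) (η s)
      (by
        have h1 := h01 (γ s)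
        have k2 : 0 ≤ (1 - s) * φ (γ s) := mul_nonneg (by linarith [hs.2]) h1.1
        have k3 : (1 - s) * φ (γ s) ≤ 1 := mul_le_one₀ (by linarith [hs.1]) h1.1 h1.2
        rw [abs_le]; constructor <;> simp only [hη] <;> linarith)
      ((hcut t ⟨htI.1.le, ht.2⟩ (γ s) (1 - s) ⟨by linarith [hs.2], by linarith [hs.1]⟩).2 _)
      ((hcut t ⟨htI.1.le, ht.2⟩ (γ s) (1 - s) ⟨by linarith [hs.2], by linarith [hs.1]⟩).1)
      r hr
  have time : ∀ r, |r| ≤ min h₁ (√τ₀) → t - r ^ 2 / 4 ∈ Ioo 0 T := fun r hr => by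
    have h1 : r ^ 2 ≤ τ₀ := by
      rw [← sq_abs, ← Real.sq_sqrt hτ₀.1.le]
      exact pow_le_pow_left₀ (abs_nonneg r) (hr.trans (min_le_right _ _)) 2
    exact ⟨by linarith [ht.1, hτ₀.1], by linarith [sq_nonneg r, htI.2]⟩
  have cq := hG.continuous_energyDensity hγ
  refine ⟨fun i => V i 1, hVV 1, Γ, fun r hr => ⟨fun i => ⟨cΓ i r, ?_, ?_, ?_⟩, ?_⟩⟩
  · simp [hΓ, hη, varPos, hγ0, hφ0]
  · simp [hΓ, hη]
  · refine abs_integral_sub_le ((h.slice' (time r hr)).continuous_energyDensity (cΓ i r)) cq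
      fun s hs => ?_
    rw [dens]
    exact (HB s hs r (hr.trans (min_le_left _ _))).1 i
  · have hr' : |-r| ≤ min h₁ (√τ₀) := by rwa [abs_neg]
    have cu : ∀ i, Continuous fun s => normSq (g (Γ i r s) (t - r ^ 2 / 4)) (deriv (Γ i r) s) :=
      fun i => (h.slice' (time r hr)).continuous_energyDensity (cΓ i r)
    have cu' : ∀ i, Continuous fun s =>
        normSq (g (Γ i (-r) s) (t - r ^ 2 / 4)) (deriv (Γ i (-r)) s) :=
      fun i => (h.slice' (time r hr)).continuous_energyDensity (cΓ i (-r))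
    have dens' : ∀ i s, normSq (g (Γ i (-r) s) (t - r ^ 2 / 4)) (deriv (Γ i (-r)) s) =
        varDensity g (γ s) t (V i s) (deriv γ s) (ζ s) (η s) (-r) := fun i s => by
      rw [← dens, neg_sq]
    set C := 8 * (1 + A) ^ 2 * r ^ 2 + M * |r| ^ 3 with hC
    have e1 : ∑ i, (energy (fun y => g y (t - r ^ 2 / 4)) (Γ i r)
          + energy (fun y => g y (t - r ^ 2 / 4)) (Γ i (-r))) =
        ∫ s in (0:ℝ)..1, ∑ i, (normSq (g (Γ i r s) (t - r ^ 2 / 4)) (deriv (Γ i r) s)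
          + normSq (g (Γ i (-r) s) (t - r ^ 2 / 4)) (deriv (Γ i (-r)) s)) := by
      rw [intervalIntegral.integral_finsetSum fun i _ =>
        ((cu i).fun_add (cu' i)).intervalIntegrable _ _]
      refine Finset.sum_congr rfl fun i _ => ?_
      rw [intervalIntegral.integral_add ((cu i).intervalIntegrable _ _)
        ((cu' i).intervalIntegrable _ _)]
      rfl
    have e2 : 4 * energy (fun y => g y t) γ + C * (1 + energy (fun y => g y t) γ) =
        ∫ s in (0:ℝ)..1, (4 * normSq (g (γ s) t) (deriv γ s)
          + C * (1 + normSq (g (γ s) t) (deriv γ s))) := by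
      rw [intervalIntegral.integral_add ((continuous_const.fun_mul cq).intervalIntegrable _ _)
        ((continuous_const.fun_mul (continuous_const.fun_add cq)).intervalIntegrable _ _),
        intervalIntegral.integral_const_mul, intervalIntegral.integral_const_mul,
        intervalIntegral.integral_add (by simp) (cq.intervalIntegrable _ _)]
      simp [energy]
    rw [e1, e2]
    refine intervalIntegral.integral_mono_on zero_le_one
      ((continuous_finsetSum _ fun i _ => (cu i).add (cu' i)).intervalIntegrable _ _)
      (((continuous_const.mul cq).add
        (continuous_const.mul (continuous_const.add cq))).intervalIntegrable _ _) fun s hs => ?_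
    have := (HB s hs r (hr.trans (min_le_left _ _))).2
    simp only [dens, dens']
    refine this.trans (le_of_eq ?_)
    rw [hC]
    ring

end Variation

section Endpoint

variable {g : (Fin 2 → ℝ) → ℝ → Matrix (Fin 2) (Fin 2) ℝ} {T : ℝ}

/-- The mean of a function over the endpoints of the varied curves. -/
lemma RicciFlowTwo.exists_endpoint_expansion (h : RicciFlowTwo g T) {u : (Fin 2 → ℝ) × ℝ → ℝ}
    (hu : ContDiffOn ℝ (⊤ : ℕ∞) u (univ ×ˢ Ioo (0:ℝ) T)) {K : Set ((Fin 2 → ℝ) × ℝ)}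
    (hK : IsCompact K) (hKΩ : K ⊆ univ ×ˢ Ioo (0:ℝ) T) :
    ∃ h₀ > 0, ∃ M ≥ 0, ∀ x t, (x, t) ∈ K → ∀ V : Fin 2 → Fin 2 → ℝ,
      (∀ c d, V 0 c * V 0 d + V 1 c * V 1 d = (g x t)⁻¹ c d) → ∀ r, |r| ≤ h₀ →
        4 * u (x, t) - r ^ 2 * (deriv (fun s => u (x, s)) t
            - lap (fun y => g y t) (fun y => u (y, t)) x) - M * |r| ^ 3 ≤
          ∑ i, (u (varPos g x t (V i) 1 r, t - r ^ 2 / 4)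
            + u (varPos g x t (V i) 1 (-r), t - r ^ 2 / 4)) := by
  have cI : ∀ c, ContinuousOn (fun p : (Fin 2 → ℝ) × ℝ => (g p.1 p.2)⁻¹ c c) K := fun c =>
    ((h.contDiffOn_inv c c).continuousOn.mono domain_subset).mono hKΩ
  have cD : ∀ c, ContinuousOn (fun p : (Fin 2 → ℝ) × ℝ => drift (fun y => g y p.2) p.1 c) K :=
    fun c => (h.contDiffOn_drift c).continuousOn.mono hKΩ
  choose B hB using fun c => hK.exists_bound_of_continuousOn (cI c)
  choose D hD using fun c => hK.exists_bound_of_continuousOn (cD c)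
  set A : ℝ := 1 + |B 0| + |B 1| + |D 0| + |D 1| with hA
  have hA1 : 1 ≤ A := by
    linarith [abs_nonneg (B 0), abs_nonneg (B 1), abs_nonneg (D 0), abs_nonneg (D 1)]
  have hBA : ∀ c, |B c| ≤ A := by
    rw [Fin.forall_fin_two]
    constructor <;>
      linarith [abs_nonneg (B 0), abs_nonneg (B 1), abs_nonneg (D 0), abs_nonneg (D 1)]
  have hDA : ∀ c, |D c| ≤ A := by
    rw [Fin.forall_fin_two]
    constructor <;>
      linarith [abs_nonneg (B 0), abs_nonneg (B 1), abs_nonneg (D 0), abs_nonneg (D 1)]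
  let ι := {p : ((Fin 2 → ℝ) × ℝ) × (Fin 2 → ℝ) // p.1 ∈ K ∧ ‖p.2‖ ≤ A}
  obtain ⟨h₀, hh₀, M, H⟩ := HasExpansion.of_contDiffOn (ι := ι) isOpen_domain hu hK hKΩ
    (x := fun p => p.1.1.1) (t := fun p => p.1.1.2) (V := fun p => (1:ℝ) • p.1.2)
    (W := fun p => ((1:ℝ) ^ 2 / 4) • drift (fun y => g y p.1.1.2) p.1.1.1) (B := A)
    (fun p => p.2.1) (fun p => by rw [one_smul]; exact p.2.2) (fun p => by
      refine (pi_norm_le_iff_of_nonneg (by linarith)).2 fun c => ?_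
      rw [Pi.smul_apply, norm_smul, Real.norm_eq_abs, abs_of_pos (by norm_num)]
      have e := (hD c _ p.2.1).trans ((le_abs_self _).trans (hDA c))
      have := norm_nonneg (drift (fun y => g y p.1.1.2) p.1.1.1 c)
      linarith)
  refine ⟨h₀, hh₀, 4 * |M|, by positivity, fun x t hxt V hV r hr => ?_⟩
  have hVA : ∀ i, ‖V i‖ ≤ A := fun i => by
    refine (pi_norm_le_iff_of_nonneg (by linarith)).2 fun c => ?_
    rw [Real.norm_eq_abs]
    refine abs_le_of_sq_le_sq ((frame_sq_le hV i c).trans ?_) (by linarith)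
    have e := (le_abs_self _).trans ((hB c _ hxt).trans ((le_abs_self _).trans (hBA c)))
    refine e.trans ?_
    nlinarith
  have key : ∀ i, ∀ s, |s| = |r| → _ := fun i s hs =>
    (abs_le.1 ((H ⟨((x, t), V i), hxt, hVA i⟩).2.2.2 s (hs.trans_le hr))).1
  have k00 := key 0 r rfl
  have k01 := key 0 (-r) (abs_neg r)
  have k10 := key 1 r rfl
  have k11 := key 1 (-r) (abs_neg r)
  have hM : M * |r| ^ 3 ≤ |M| * |r| ^ 3 := mul_le_mul_of_nonneg_right (le_abs_self M) (by positivity)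
  simp only [abs_neg, neg_sq] at k00 k01 k10 k11
  rw [lap]
  simp only [varPos, neg_sq, Fin.sum_univ_two, ← hV, one_smul, Pi.smul_apply, smul_eq_mul]
    at k00 k01 k10 k11 ⊢
  linarith

end Endpoint

section RealInequalities

lemma mul_pow_four_le {p e v S : ℝ} (hp : 0 < p) (he : |e| ≤ p / 2) (hS : 0 ≤ S)
    (hv : v * (p - e) ^ 2 ≤ S) : v * p ^ 4 ≤ S * (p ^ 2 + 2 * p * e + 8 * e ^ 2) := by
  obtain ⟨e1, e2⟩ := abs_le.1 he
  have hd : 0 < (p - e) ^ 2 := by have : 0 < p - e := by linarith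
                                  positivity
  have k : p ^ 4 ≤ (p - e) ^ 2 * (p ^ 2 + 2 * p * e + 8 * e ^ 2) := by
    nlinarith [mul_nonneg (sq_nonneg e) (mul_nonneg (by linarith : 0 ≤ p - 2 * e)
      (by linarith : 0 ≤ 5 * p - 4 * e))]
  rcases le_or_gt v 0 with h | h
  · have : 0 ≤ p ^ 2 + 2 * p * e + 8 * e ^ 2 := by nlinarith [sq_nonneg (p + e), sq_nonneg e]
    exact (mul_nonpos_of_nonpos_of_nonneg h (by positivity)).trans (mul_nonneg hS this)
  · have k2 : 0 ≤ p ^ 2 + 2 * p * e + 8 * e ^ 2 := by nlinarith [sq_nonneg (p + e), sq_nonneg e]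
    calc v * p ^ 4 ≤ v * ((p - e) ^ 2 * (p ^ 2 + 2 * p * e + 8 * e ^ 2)) := by gcongr
      _ = (v * (p - e) ^ 2) * (p ^ 2 + 2 * p * e + 8 * e ^ 2) := by ring
      _ ≤ _ := by gcongr

lemma log_one_add_sub_le {a b : ℝ} (ha : 0 ≤ a) (hb : 0 ≤ b) :
    Real.log (1 + b) - Real.log (1 + a) ≤ (b - a) / (1 + a) := by
  rw [← Real.log_div (by positivity) (by positivity)]
  refine (Real.log_le_sub_one_of_pos (by positivity)).trans (le_of_eq ?_)
  field_simp
  ring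

end RealInequalities

section RealInequalities

lemma le_of_forall_mem_Ioc {f f' : ℝ → ℝ} (hf : Continuous f) (hf' : Continuous f') {a : ℝ}
    (ha : 0 < a) (H : ∀ x ∈ Ioc 0 a, f x ≤ f' x) : f 0 ≤ f' 0 := by
  have l1 := (hf.tendsto 0).mono_left (nhdsWithin_le_nhds (s := Ioi 0))
  have l2 := (hf'.tendsto 0).mono_left (nhdsWithin_le_nhds (s := Ioi 0))
  refine le_of_tendsto_of_tendsto l1 l2 ?_
  filter_upwards [Ioc_mem_nhdsGT ha] with x hx using H x hx

lemma sup_le_of_quadratic_estimate {c S R C M M' a : ℝ} (hS : 0 < S) (hR : 1 ≤ R)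
    (hC : 1 ≤ C) (ha : 0 < a)
    (H : ∀ ε ∈ Ioc 0 (S / 2), ∀ r ∈ Ioc 0 a, c * r ^ 2 * (S - ε) ^ 2 ≤ 4 * ε * R ^ 2
      + S * (2 * R * (C * r ^ 2 + M * r ^ 3) + 32 * (C * r + M * r ^ 2) ^ 2) + M' * r ^ 3 * R ^ 4) :
    c * S ≤ 34 * C ^ 2 * R := by
  have h1 : ∀ r ∈ Ioc 0 a, c * S ^ 2 ≤
      S * (2 * R * (C + M * r) + 32 * (C + M * r) ^ 2) + M' * r * R ^ 4 := fun r hr => by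
    have := le_of_forall_mem_Ioc (f := fun ε => c * r ^ 2 * (S - ε) ^ 2)
      (f' := fun ε => 4 * ε * R ^ 2 + S * (2 * R * (C * r ^ 2 + M * r ^ 3)
        + 32 * (C * r + M * r ^ 2) ^ 2) + M' * r ^ 3 * R ^ 4) (by fun_prop) (by fun_prop)
      (half_pos hS) (fun ε hε => H ε hε r hr)
    have hr2 : 0 < r ^ 2 := pow_pos hr.1 2
    refine le_of_mul_le_mul_left ?_ hr2
    simp only [sub_zero] at this
    linarith
  have h2 := le_of_forall_mem_Ioc (f := fun r => c * S ^ 2)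
      (f' := fun r => S * (2 * R * (C + M * r) + 32 * (C + M * r) ^ 2) + M' * r * R ^ 4)
      (by fun_prop) (by fun_prop) ha h1
  refine le_of_mul_le_mul_left ?_ hS
  have h3 : 2 * R * C + 32 * C ^ 2 ≤ 34 * C ^ 2 * R := by
    have e1 : C ≤ C ^ 2 := by nlinarith
    have e2 : R * C ≤ R * C ^ 2 := mul_le_mul_of_nonneg_left e1 (by linarith)
    have e3 : C ^ 2 * 1 ≤ C ^ 2 * R := mul_le_mul_of_nonneg_left hR (sq_nonneg C)
    linarith
  have h4 := mul_le_mul_of_nonneg_left h3 hS.le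
  simp only [mul_zero, add_zero, zero_mul] at h2
  linarith

lemma quadratic_estimate {c S ε u p R r D M' b d : ℝ} {v e : Fin 2 → Bool → ℝ}
    (hc : 0 ≤ c) (hS : 0 ≤ S) (hp : 0 < p) (hpR : p ≤ R) (hr : 0 ≤ r) (hM' : 0 ≤ M') (hb : 0 ≤ b)
    (hε : 0 ≤ ε) (hεS : ε ≤ S) (hJ : S - ε ≤ u * p ^ 2) (hD : D ≤ -c * u ^ 2)
    (hsum : 4 * u - r ^ 2 * D - M' * r ^ 3 ≤ ∑ i, (v i true + v i false))
    (hv : ∀ i s, v i s * (p - e i s) ^ 2 ≤ S) (he : ∀ i s, |e i s| ≤ d) (hd : d ≤ p / 2)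
    (hes : ∑ i, (e i true + e i false) ≤ b) :
    c * r ^ 2 * (S - ε) ^ 2 ≤
      4 * ε * R ^ 2 + S * (2 * R * b + 32 * d ^ 2) + M' * r ^ 3 * R ^ 4 := by
  have k : ∀ i s, v i s * p ^ 4 ≤ S * (p ^ 2 + 2 * p * e i s + 8 * d ^ 2) := fun i s => by
    refine (mul_pow_four_le hp ((he i s).trans hd) hS (hv i s)).trans ?_
    have : e i s ^ 2 ≤ d ^ 2 := sq_le_sq' (abs_le.1 (he i s)).1 (abs_le.1 (he i s)).2
    gcongr
  have k0 := k 0 true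
  have k1 := k 0 false
  have k2 := k 1 true
  have k3 := k 1 false
  rw [Fin.sum_univ_two] at hsum hes
  have p4 : 0 ≤ p ^ 4 := by positivity
  have q1 := mul_le_mul_of_nonneg_right hsum p4
  have q2 : r ^ 2 * p ^ 4 * D ≤ r ^ 2 * p ^ 4 * (-c * u ^ 2) :=
    mul_le_mul_of_nonneg_left hD (by positivity)
  have q3 : c * r ^ 2 * (S - ε) ^ 2 ≤ c * r ^ 2 * (u * p ^ 2) ^ 2 := by
    have : 0 ≤ S - ε := by linarith
    gcongr
  have q4 : (S - ε) * p ^ 2 ≤ u * p ^ 2 * p ^ 2 := mul_le_mul_of_nonneg_right hJ (by positivity)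
  have q5 : S * (2 * p) * (e 0 true + e 0 false + (e 1 true + e 1 false)) ≤ S * (2 * p) * b := by
    gcongr
  have q6 : S * (2 * p) * b ≤ S * (2 * R) * b := by gcongr
  have q7 : M' * r ^ 3 * p ^ 4 ≤ M' * r ^ 3 * R ^ 4 := by gcongr
  have q8 : 4 * ε * p ^ 2 ≤ 4 * ε * R ^ 2 := by gcongr
  linarith

end RealInequalities

section MaximumPrinciple

variable {g : (Fin 2 → ℝ) → ℝ → Matrix (Fin 2) (Fin 2) ℝ} {T : ℝ}

/-- Curves of bounded energy issuing from `x₀` stay in a fixed compact set, uniformly in time. -/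
def UniformlyProper (g : (Fin 2 → ℝ) → ℝ → Matrix (Fin 2) (Fin 2) ℝ) (x₀ : Fin 2 → ℝ) (T₁ : ℝ) :
    Prop :=
  ∀ r, ∃ Rb, ∀ t ∈ Icc 0 T₁, ∀ γ : ℝ → Fin 2 → ℝ, ContDiff ℝ 1 γ → γ 0 = x₀ →
    energy (fun y => g y t) γ ≤ r → ∀ s ∈ Icc (0:ℝ) 1, ‖γ s‖ ≤ Rb

lemma RicciFlowTwo.weighted_bound (h : RicciFlowTwo g T) {x₀ : Fin 2 → ℝ} {T₁ : ℝ}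
    (hT₁ : T₁ ∈ Ioo 0 T) (hU : UniformlyProper g x₀ T₁) {u : (Fin 2 → ℝ) × ℝ → ℝ}
    (hu : ContDiffOn ℝ (⊤ : ℕ∞) u (univ ×ˢ Ioo (0:ℝ) T))
    (huc : ContinuousOn u (univ ×ˢ Icc (0:ℝ) T₁)) (hu0 : ∀ x, u (x, 0) ≤ 0) {c : ℝ} (hc : 0 < c)
    (hpde : ∀ x, ∀ t ∈ Ioc 0 T₁, 0 < u (x, t) → deriv (fun s => u (x, s)) t
      - lap (fun y => g y t) (fun y => u (y, t)) x ≤ -c * u (x, t) ^ 2) :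
    ∃ C ≥ 0, ∀ R ≥ 1, ∀ t ∈ Icc 0 T₁, ∀ γ : ℝ → Fin 2 → ℝ, ContDiff ℝ 1 γ → γ 0 = x₀ →
      Real.log (1 + energy (fun y => g y t) γ) < R →
      u (γ 1, t) * (R - Real.log (1 + energy (fun y => g y t) γ)) ^ 2 ≤ C * R := by
  obtain ⟨C, hC, HC⟩ := h.exists_energy_variation x₀ hT₁
  refine ⟨34 * C ^ 2 / c, by positivity, fun R hR => ?_⟩
  have hE : ∀ t ∈ Icc 0 T₁, ∀ γ, 0 ≤ energy (fun y => g y t) γ := fun t ht γ =>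
    (h.slice ⟨ht.1, ht.2.trans hT₁.2.le⟩).energy_nonneg γ
  set adm : (ℝ → Fin 2 → ℝ) → ℝ → Prop := fun γ t => t ∈ Icc 0 T₁ ∧ ContDiff ℝ 1 γ ∧ γ 0 = x₀ ∧
    Real.log (1 + energy (fun y => g y t) γ) < R with hadm
  set φ : (ℝ → Fin 2 → ℝ) → ℝ → ℝ := fun γ t => R - Real.log (1 + energy (fun y => g y t) γ) with hφ
  set A : Set ℝ := {j | ∃ γ t, adm γ t ∧ j = u (γ 1, t) * φ γ t ^ 2} with hA
  obtain ⟨Rb, hRb⟩ := hU (Real.exp R)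
  have hbd : ∀ γ t, adm γ t → ∀ s ∈ Icc (0:ℝ) 1, ‖γ s‖ ≤ Rb := fun γ t ⟨ht, hγ, hγ0, hl⟩ =>
    hRb t ht γ hγ hγ0 (by
      have := (Real.log_lt_iff_lt_exp (by linarith [hE t ht γ])).1 hl
      linarith)
  have hφp : ∀ γ t, adm γ t → 0 < φ γ t := fun γ t ha => sub_pos.2 ha.2.2.2
  have hφR : ∀ γ t, adm γ t → φ γ t ≤ R := fun γ t ha =>
    sub_le_self _ (Real.log_nonneg (by linarith [hE t ha.1 γ]))
  have hKc : IsCompact (Metric.closedBall (0 : Fin 2 → ℝ) Rb ×ˢ Icc 0 T₁) :=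
    (isCompact_closedBall _ _).prod isCompact_Icc
  have hKs : ∀ a, Metric.closedBall (0 : Fin 2 → ℝ) Rb ×ˢ Icc a T₁ ⊆ univ ×ˢ Icc a T₁ := fun a =>
    prod_mono (subset_univ _) Subset.rfl
  have hmem : ∀ γ t, adm γ t → (γ 1, t) ∈ Metric.closedBall (0 : Fin 2 → ℝ) Rb ×ˢ Icc 0 T₁ :=
    fun γ t ha => ⟨mem_closedBall_zero_iff.2 (hbd γ t ha 1 (by simp)), ha.1⟩
  obtain ⟨U₀, hU₀⟩ := hKc.exists_bound_of_continuousOn (huc.mono (hKs 0))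
  set U := |U₀| + 1 with hUdef
  have hUpos : 0 < U := by positivity
  have huU : ∀ γ t, adm γ t → u (γ 1, t) ≤ U := fun γ t ha => by
    have := (le_abs_self _).trans ((hU₀ _ (hmem γ t ha)).trans (le_abs_self _))
    linarith
  have hAb : BddAbove A := by
    refine ⟨U * R ^ 2, ?_⟩
    rintro _ ⟨γ, t, ha, rfl⟩
    have := hφp γ t ha
    have := hφR γ t ha
    have := huU γ t ha
    gcongr
  set S := sSup A with hS
  have hle : ∀ γ t, adm γ t → u (γ 1, t) * φ γ t ^ 2 ≤ S := fun γ t ha => le_csSup hAb ⟨γ, t, ha, rfl⟩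
  suffices hmain : S ≤ 34 * C ^ 2 / c * R from fun t ht γ h1 h2 h3 =>
    (hle γ t ⟨ht, h1, h2, h3⟩).trans hmain
  rcases le_or_gt S 0 with hS0 | hS0
  · exact hS0.trans (by positivity)
  have hne : A.Nonempty := by
    by_contra hcon
    rw [not_nonempty_iff_eq_empty] at hcon
    rw [hS, hcon, Real.sSup_empty] at hS0
    exact lt_irrefl _ hS0
  have hlow : ∀ γ t, adm γ t → S / 2 ≤ u (γ 1, t) * φ γ t ^ 2 →
      S / (2 * R ^ 2) ≤ u (γ 1, t) ∧ √(S / (2 * U)) ≤ φ γ t := fun γ t ha hj => by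
    have p1 := hφp γ t ha
    have p2 := hφR γ t ha
    have p3 := huU γ t ha
    have p4 : 0 < u (γ 1, t) := pos_of_mul_pos_left (lt_of_lt_of_le (half_pos hS0) hj) (sq_nonneg _)
    constructor
    · rw [div_le_iff₀ (by positivity)]
      have : u (γ 1, t) * φ γ t ^ 2 ≤ u (γ 1, t) * R ^ 2 := by gcongr
      linarith
    · rw [Real.sqrt_le_left p1.le, div_le_iff₀ (by positivity)]
      have : u (γ 1, t) * φ γ t ^ 2 ≤ U * φ γ t ^ 2 := by gcongr
      linarith
  obtain ⟨δ, hδ, Hδ⟩ := Metric.uniformContinuousOn_iff.1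
    (hKc.uniformContinuousOn_of_continuous (huc.mono (hKs 0))) (S / (2 * R ^ 2)) (by positivity)
  set τ₀ := min δ T₁ with hτ₀
  have hτ : τ₀ ∈ Ioc 0 T₁ := ⟨lt_min hδ hT₁.1, min_le_right _ _⟩
  have hlate : ∀ γ t, adm γ t → S / 2 ≤ u (γ 1, t) * φ γ t ^ 2 → τ₀ ≤ t := fun γ t ha hj => by
    by_contra! hcon
    have := Hδ (γ 1, t) (hmem γ t ha) (γ 1, 0) ⟨(hmem γ t ha).1, le_rfl, hT₁.1.le⟩ (by
      rw [Prod.dist_eq, dist_self, max_eq_right dist_nonneg, Real.dist_eq, sub_zero,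
        abs_of_nonneg ha.1.1]
      exact hcon.trans_le (min_le_left _ _))
    rw [Real.dist_eq] at this
    have := (abs_lt.1 this).2
    linarith [hu0 (γ 1), (hlow γ t ha hj).1]
  obtain ⟨h₀, hh₀, M, hM, HV⟩ := HC τ₀ hτ Rb
  obtain ⟨h₁, hh₁, M', hM', HE⟩ := h.exists_endpoint_expansion hu
    (K := Metric.closedBall (0 : Fin 2 → ℝ) Rb ×ˢ Icc τ₀ T₁)
    ((isCompact_closedBall _ _).prod isCompact_Icc)
    (prod_mono (subset_univ _) fun t ht => ⟨hτ.1.trans_le ht.1, ht.2.trans_lt hT₁.2⟩)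
  set p₀ := √(S / (2 * U)) with hp₀
  have hp₀' : 0 < p₀ := Real.sqrt_pos.2 (by positivity)
  set a := min (min h₀ h₁) (min (min τ₀ 1) (p₀ / (2 * (C + M)))) with ha
  have ha0 : 0 < a := lt_min (lt_min hh₀ hh₁) (lt_min (lt_min hτ.1 one_pos) (by positivity))
  rw [div_mul_eq_mul_div, le_div_iff₀ hc, mul_comm]
  refine sup_le_of_quadratic_estimate (M := M) (M' := M') hS0 hR hC ha0 fun ε hε r hr => ?_
  obtain ⟨_, ⟨γ, t, hadm', rfl⟩, hJ⟩ := exists_lt_of_lt_csSup hne (sub_lt_self S hε.1)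
  have hJ2 : S / 2 ≤ u (γ 1, t) * φ γ t ^ 2 := by linarith [hε.2]
  obtain ⟨hul, hφl⟩ := hlow γ t hadm' hJ2
  have htτ := hlate γ t hadm' hJ2
  have hr0 : |r| = r := abs_of_pos hr.1
  have hrh₀ : r ≤ h₀ := hr.2.trans ((min_le_left _ _).trans (min_le_left _ _))
  have hrh₁ : r ≤ h₁ := hr.2.trans ((min_le_left _ _).trans (min_le_right _ _))
  have hrτ : r ≤ τ₀ := hr.2.trans ((min_le_right _ _).trans ((min_le_left _ _).trans (min_le_left _ _)))
  have hr1 : r ≤ 1 := hr.2.trans ((min_le_right _ _).trans ((min_le_left _ _).trans (min_le_right _ _)))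
  have hrp : r ≤ p₀ / (2 * (C + M)) := hr.2.trans ((min_le_right _ _).trans (min_le_right _ _))
  have hr2 : r ^ 2 ≤ r := by nlinarith [hr.1]
  have hd : C * r + M * r ^ 2 ≤ φ γ t / 2 := by
    rw [le_div_iff₀ (by positivity)] at hrp
    nlinarith
  obtain ⟨V, hV, Γ, HΓ⟩ := HV t ⟨htτ, hadm'.1.2⟩ γ hadm'.2.1 hadm'.2.2.1 (hbd γ t hadm')
  have HEx := HE (γ 1) t ⟨(hmem γ t hadm').1, htτ, hadm'.1.2⟩ V hV r (hr0.trans_le hrh₁)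
  have Hp := HΓ r (hr0.trans_le hrh₀)
  have Hm := HΓ (-r) (((abs_neg r).trans hr0).trans_le hrh₀)
  have htr : t - r ^ 2 / 4 ∈ Icc 0 T₁ := ⟨by linarith [hτ.1], by nlinarith [hadm'.1.2]⟩
  set E := energy (fun y => g y t) γ with hEdef
  have hE0 : 0 ≤ E := hE t hadm'.1 γ
  have hE1 : 0 < 1 + E := by linarith
  let sg : Bool → ℝ := fun s => if s then r else -r
  have hsg : ∀ s, (∀ i, ContDiff ℝ 1 (Γ i (sg s)) ∧ Γ i (sg s) 0 = x₀ ∧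
      Γ i (sg s) 1 = varPos g (γ 1) t (V i) 1 (sg s) ∧
      |energy (fun y => g y (t - r ^ 2 / 4)) (Γ i (sg s)) - E| ≤ (C * r + M * r ^ 2) * (1 + E)) := by
    intro s
    cases s
    · have := Hm.1
      rw [abs_neg, hr0, neg_sq] at this
      exact this
    · have := Hp.1
      rw [hr0] at this
      exact this
  let e : Fin 2 → Bool → ℝ := fun i s =>
    (energy (fun y => g y (t - r ^ 2 / 4)) (Γ i (sg s)) - E) / (1 + E)
  have he : ∀ i s, |e i s| ≤ C * r + M * r ^ 2 := fun i s => by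
    rw [abs_div, abs_of_pos hE1, div_le_iff₀ hE1]
    exact (hsg s i).2.2.2
  refine quadratic_estimate (u := u (γ 1, t)) (p := φ γ t) (e := e)
    (v := fun i s => u (varPos g (γ 1) t (V i) 1 (sg s), t - r ^ 2 / 4)) hc.le hS0.le
    (hφp γ t hadm') (hφR γ t hadm') hr.1.le hM'
    (b := C * r ^ 2 + M * r ^ 3) (add_nonneg (by positivity) (mul_nonneg hM (pow_nonneg hr.1.le 3)))
    hε.1.le (by linarith [hε.2])
    hJ.le (hpde (γ 1) t ⟨hτ.1.trans_le htτ, hadm'.1.2⟩ (lt_of_lt_of_le (by positivity) hul))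
    (by rw [← hr0]; exact hr0.symm ▸ HEx) (fun i s => ?_) he hd ?_
  · obtain ⟨g1, g2, g3, -⟩ := hsg s i
    have hl := log_one_add_sub_le hE0 (hE _ htr (Γ i (sg s)))
    have hei := (abs_le.1 (he i s)).2
    have hl' : φ γ t - e i s ≤ φ (Γ i (sg s)) (t - r ^ 2 / 4) := by
      simp only [hφ, e]
      linarith
    have hpos := hφp γ t hadm'
    have hpe : 0 ≤ φ γ t - e i s := by linarith
    have hadm2 : adm (Γ i (sg s)) (t - r ^ 2 / 4) := ⟨htr, g1, g2, by
      have : 0 < φ (Γ i (sg s)) (t - r ^ 2 / 4) := by linarith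
      exact sub_pos.1 this⟩
    have hv := hle _ _ hadm2
    rw [g3] at hv
    rcases le_or_gt (u (varPos g (γ 1) t (V i) 1 (sg s), t - r ^ 2 / 4)) 0 with hv0 | hv0
    · exact (mul_nonpos_of_nonpos_of_nonneg hv0 (sq_nonneg _)).trans hS0.le
    · refine le_trans ?_ hv
      gcongr
  · have := Hp.2
    rw [hr0] at this
    simp only [e, sg, ← add_div, ← Finset.sum_div, if_true, Bool.false_eq_true, if_false]
    rw [div_le_iff₀ hE1]
    rw [Fin.sum_univ_two] at this ⊢
    linarith

end MaximumPrinciple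

section MaximumPrinciple

variable {g : (Fin 2 → ℝ) → ℝ → Matrix (Fin 2) (Fin 2) ℝ} {T : ℝ}

/-- Maximum principle: a subsolution which is initially nonpositive and satisfies
`∂ₜ u - Δ u ≤ -c u ^ 2` where it is positive stays nonpositive. -/
theorem RicciFlowTwo.nonpos_of_subsolution (h : RicciFlowTwo g T) {x₀ : Fin 2 → ℝ} {T₁ : ℝ}
    (hT₁ : T₁ ∈ Ioo 0 T) (hU : UniformlyProper g x₀ T₁) {u : (Fin 2 → ℝ) × ℝ → ℝ}
    (hu : ContDiffOn ℝ (⊤ : ℕ∞) u (univ ×ˢ Ioo (0:ℝ) T))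
    (huc : ContinuousOn u (univ ×ˢ Icc (0:ℝ) T₁)) (hu0 : ∀ x, u (x, 0) ≤ 0) {c : ℝ} (hc : 0 < c)
    (hpde : ∀ x, ∀ t ∈ Ioc 0 T₁, 0 < u (x, t) → deriv (fun s => u (x, s)) t
      - lap (fun y => g y t) (fun y => u (y, t)) x ≤ -c * u (x, t) ^ 2) :
    ∀ x, ∀ t ∈ Icc 0 T₁, u (x, t) ≤ 0 := by
  obtain ⟨C, hC, H⟩ := h.weighted_bound hT₁ hU hu huc hu0 hc hpde
  intro x t ht
  by_contra! hcon
  set γ : ℝ → Fin 2 → ℝ := fun s => x₀ + s • (x - x₀) with hγ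
  set L := Real.log (1 + energy (fun y => g y t) γ) with hL
  have hL0 : 0 ≤ L := Real.log_nonneg (by
    linarith [(h.slice ⟨ht.1, ht.2.trans hT₁.2.le⟩).energy_nonneg γ])
  have key : ∀ m ≥ 1, u (x, t) * m ^ 2 ≤ C * (L + m) := fun m hm => by
    have := H (L + m) (by linarith) t ht γ (by fun_prop) (by simp [hγ]) (by linarith)
    rwa [← hL, add_sub_cancel_left, show γ 1 = x by simp [hγ]] at this
  set m := C * (L + 1) / u (x, t) + 1 with hm
  have hm1 : 1 ≤ m := le_add_of_nonneg_left (by positivity)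
  have h1 := key m hm1
  have h2 : u (x, t) * m = C * (L + 1) + u (x, t) := by
    rw [hm, mul_add, mul_div_cancel₀ _ hcon.ne', mul_one]
  have h3 : C * (L + m) ≤ C * (L + 1) * m := by
    rw [mul_assoc]
    exact mul_le_mul_of_nonneg_left (by nlinarith) hC
  have h4 : u (x, t) * m ^ 2 = C * (L + 1) * m + u (x, t) * m := by linear_combination m * h2
  have h5 : 0 < u (x, t) * m := by positivity
  linarith

end MaximumPrinciple

section Curves

variable {G : (Fin 2 → ℝ) → Matrix (Fin 2) (Fin 2) ℝ}

/-- Length of the part of a curve between two parameters. -/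
def arcLength (G : (Fin 2 → ℝ) → Matrix (Fin 2) (Fin 2) ℝ) (γ : ℝ → Fin 2 → ℝ) (a b : ℝ) : ℝ :=
  ∫ s in a..b, √(normSq (G (γ s)) (deriv γ s))

lemma arcLength_nonneg (γ : ℝ → Fin 2 → ℝ) {a b : ℝ} (hab : a ≤ b) : 0 ≤ arcLength G γ a b :=
  intervalIntegral.integral_nonneg hab fun _ _ => Real.sqrt_nonneg _

lemma arcLength_congr {γ γ' : ℝ → Fin 2 → ℝ} {a b : ℝ} (hab : a ≤ b) (h : EqOn γ γ' (Ioo a b)) :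
    arcLength G γ a b = arcLength G γ' a b := by
  unfold arcLength
  rw [intervalIntegral.integral_of_le hab, intervalIntegral.integral_of_le hab,
    integral_Ioc_eq_integral_Ioo, integral_Ioc_eq_integral_Ioo]
  refine setIntegral_congr_fun measurableSet_Ioo fun s hs => ?_
  have e : γ =ᶠ[nhds s] γ' := h.eventuallyEq_of_mem (Ioo_mem_nhds hs.1 hs.2)
  rw [e.deriv_eq, h hs]

namespace SmoothMetric

lemma continuous_speed (h : SmoothMetric G) {γ : ℝ → Fin 2 → ℝ} (hγ : ContDiff ℝ 1 γ) :
    Continuous fun s => √(normSq (G (γ s)) (deriv γ s)) :=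
  (h.continuous_energyDensity hγ).sqrt

lemma arcLength_add (h : SmoothMetric G) {γ : ℝ → Fin 2 → ℝ} (hγ : ContDiff ℝ 1 γ) (a b c : ℝ) :
    arcLength G γ a b + arcLength G γ b c = arcLength G γ a c :=
  intervalIntegral.integral_add_adjacent_intervals
    ((h.continuous_speed hγ).intervalIntegrable _ _) ((h.continuous_speed hγ).intervalIntegrable _ _)

lemma speed_comp (γ : ℝ → Fin 2 → ℝ) (hγ : ContDiff ℝ 1 γ) (f : ℝ → ℝ) (hf : ContDiff ℝ 1 f)
    (s : ℝ) : √(normSq (G ((γ ∘ f) s)) (deriv (γ ∘ f) s)) =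
      √(normSq (G (γ (f s))) (deriv γ (f s))) * |deriv f s| := by
  rw [deriv.scomp s (hγ.differentiable (by simp) _) (hf.differentiable (by simp) _), normSq_smul,
    Real.sqrt_mul (sq_nonneg _), Real.sqrt_sq_eq_abs, mul_comm, Function.comp_apply]

lemma arcLength_comp (h : SmoothMetric G) {γ : ℝ → Fin 2 → ℝ} (hγ : ContDiff ℝ 1 γ) {f : ℝ → ℝ}
    (hf : ContDiff ℝ 1 f) (hm : Monotone f) (a b : ℝ) :
    arcLength G (γ ∘ f) a b = arcLength G γ (f a) (f b) := by
  unfold arcLength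
  rw [← intervalIntegral.integral_comp_mul_deriv (f' := deriv f)
    (fun x _ => (hf.differentiable (by simp) x).hasDerivAt) (hf.continuous_deriv le_rfl).continuousOn
    (h.continuous_speed hγ)]
  refine intervalIntegral.integral_congr fun s _ => ?_
  rw [speed_comp γ hγ f hf, abs_of_nonneg hm.deriv_nonneg]
  rfl

lemma arcLength_reverse {γ : ℝ → Fin 2 → ℝ} (hγ : ContDiff ℝ 1 γ) :
    arcLength G (γ ∘ fun s => 1 - s) 0 1 = arcLength G γ 0 1 := by
  unfold arcLength
  have := intervalIntegral.integral_comp_sub_left (a := 0) (b := 1)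
    (fun s => √(normSq (G (γ s)) (deriv γ s))) 1
  rw [sub_zero, sub_self] at this
  rw [← this]
  refine intervalIntegral.integral_congr fun s _ => ?_
  rw [speed_comp γ hγ (fun s => 1 - s) (by fun_prop)]
  simp

end SmoothMetric

/-- `y` can be joined to `x` by a curve of length less than `r`. -/
def Reach (G : (Fin 2 → ℝ) → Matrix (Fin 2) (Fin 2) ℝ) (x y : Fin 2 → ℝ) (r : ℝ) : Prop :=
  ∃ γ : ℝ → Fin 2 → ℝ, ContDiff ℝ 1 γ ∧ γ 0 = x ∧ γ 1 = y ∧ arcLength G γ 0 1 < r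

namespace Reach

variable {x y z : Fin 2 → ℝ} {r r' : ℝ}

lemma mono (h : Reach G x y r) (hr : r ≤ r') : Reach G x y r' := by
  obtain ⟨γ, h1, h2, h3, h4⟩ := h
  exact ⟨γ, h1, h2, h3, h4.trans_le hr⟩

lemma refl (x : Fin 2 → ℝ) (hr : 0 < r) : Reach G x x r :=
  ⟨fun _ => x, contDiff_const, rfl, rfl, by simpa [arcLength, normSq] using hr⟩

lemma symm (h : Reach G x y r) : Reach G y x r := by
  obtain ⟨γ, h1, h2, h3, h4⟩ := h
  refine ⟨γ ∘ fun s => 1 - s, h1.comp (by fun_prop), by simpa using h3, by simpa using h2, ?_⟩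
  rwa [SmoothMetric.arcLength_reverse h1]

lemma trans (hG : SmoothMetric G) (h : Reach G x y r) (h' : Reach G y z r') :
    Reach G x z (r + r') := by
  obtain ⟨γ, h1, h2, h3, h4⟩ := h
  obtain ⟨γ', h1', h2', h3', h4'⟩ := h'
  have sm : ContDiff ℝ 1 Real.smoothTransition := Real.smoothTransition.contDiff (n := 1)
  set f : ℝ → ℝ := fun s => Real.smoothTransition (2 * s) with hf
  set f' : ℝ → ℝ := fun s => Real.smoothTransition (2 * s - 1) with hf'
  have cf : ContDiff ℝ 1 f := sm.comp (by fun_prop)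
  have cf' : ContDiff ℝ 1 f' := sm.comp (by fun_prop)
  have mf : Monotone f := fun a b hab => Real.smoothTransition.monotone (by linarith)
  have mf' : Monotone f' := fun a b hab => Real.smoothTransition.monotone (by linarith)
  set c : ℝ → Fin 2 → ℝ := fun s => γ (f s) + γ' (f' s) - y with hc
  have cc : ContDiff ℝ 1 c := ((h1.comp cf).add (h1'.comp cf')).sub contDiff_const
  have f0 : f 0 = 0 := by simp [hf]
  have f1 : ∀ s, 1 / 2 ≤ s → f s = 1 := fun s hs =>
    Real.smoothTransition.one_of_one_le (by linarith)
  have f0' : ∀ s, s ≤ 1 / 2 → f' s = 0 := fun s hs =>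
    Real.smoothTransition.zero_of_nonpos (by linarith)
  have f1' : f' 1 = 1 := Real.smoothTransition.one_of_one_le (by norm_num)
  have e1 : EqOn c (γ ∘ f) (Ioo 0 (1 / 2)) := fun s hs => by simp [hc, f0' s hs.2.le, h2']
  have e2 : EqOn c (γ' ∘ f') (Ioo (1 / 2) 1) := fun s hs => by simp [hc, f1 s hs.1.le, h3]
  refine ⟨c, cc, by simp [hc, f0, f0' 0 (by norm_num), h2, h2'], by
    simp [hc, f1 1 (by norm_num), f1', h3, h3'], ?_⟩
  rw [← hG.arcLength_add cc 0 (1 / 2) 1, arcLength_congr (by norm_num) e1,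
    arcLength_congr (by norm_num) e2, hG.arcLength_comp h1 cf mf, hG.arcLength_comp h1' cf' mf', f0,
    f1 _ le_rfl, f0' _ le_rfl, f1']
  exact add_lt_add h4 h4'

lemma riemDist_lt (h : Reach G x y r) : riemDist G x y < r := by
  obtain ⟨γ, h1, h2, h3, h4⟩ := h
  refine lt_of_le_of_lt (csInf_le ⟨0, ?_⟩ ⟨γ, h1.contDiffOn, h2, h3, rfl⟩) h4
  rintro _ ⟨c, -, -, -, rfl⟩
  exact arcLength_nonneg c zero_le_one

lemma of_arcLength_lt (hG : SmoothMetric G) {γ : ℝ → Fin 2 → ℝ} (hγ : ContDiff ℝ 1 γ) {a b : ℝ}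
    (hab : a ≤ b) (hl : arcLength G γ a b < r) : Reach G (γ a) (γ b) r := by
  have hf : ContDiff ℝ 1 fun s : ℝ => a + (b - a) * s := by fun_prop
  refine ⟨γ ∘ fun s => a + (b - a) * s, hγ.comp hf, by simp, by simp, ?_⟩
  rw [hG.arcLength_comp hγ hf fun u v huv => by
    have := mul_le_mul_of_nonneg_left huv (sub_nonneg.2 hab)
    linarith]
  simpa using hl

/-- A curve can be cut at its midpoint. -/
lemma split (hG : SmoothMetric G) (h : Reach G x y (2 * r)) :
    ∃ z, Reach G x z r ∧ Reach G z y r := by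
  obtain ⟨γ, h1, h2, h3, h4⟩ := h
  have hcont : Continuous fun s => arcLength G γ 0 s :=
    intervalIntegral.continuous_primitive
      (fun a b => (hG.continuous_speed h1).intervalIntegrable a b) 0
  obtain ⟨s, hs, hs'⟩ := intermediate_value_Icc (zero_le_one : (0:ℝ) ≤ 1) hcont.continuousOn
    (show arcLength G γ 0 1 / 2 ∈ _ by
      have := arcLength_nonneg (G := G) γ zero_le_one
      have e : arcLength G γ 0 0 = 0 := intervalIntegral.integral_same
      constructor <;> linarith)
  have hadd := hG.arcLength_add h1 0 s 1
  beta_reduce at hs'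
  refine ⟨γ s, ?_, ?_⟩
  · rw [← h2]
    exact of_arcLength_lt hG h1 hs.1 (by linarith)
  · rw [← h3]
    exact of_arcLength_lt hG h1 hs.2 (by linarith)

end Reach

end Curves

section HopfRinow

variable {G : (Fin 2 → ℝ) → Matrix (Fin 2) (Fin 2) ℝ}

namespace SmoothMetric

lemma continuous_inv (h : SmoothMetric G) (a b : Fin 2) : Continuous fun x => (G x)⁻¹ a b :=
  (h.contDiff_inv a b).continuous

lemma norm_le_mul_sqrt_normSq (h : SmoothMetric G) (x ξ : Fin 2 → ℝ) :
    ‖ξ‖ ≤ √(|(G x)⁻¹ 0 0| + |(G x)⁻¹ 1 1|) * √(normSq (G x) ξ) := by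
  refine (pi_norm_le_iff_of_nonneg (by positivity)).2 fun c => ?_
  rw [Real.norm_eq_abs, ← Real.sqrt_mul (by positivity)]
  refine Real.abs_le_sqrt ((h.sq_le_normSq x ξ c).trans
    (mul_le_mul_of_nonneg_right ?_ (h.normSq_nonneg x ξ)))
  revert c
  rw [Fin.forall_fin_two]
  constructor <;> linarith [le_abs_self ((G x)⁻¹ 0 0), le_abs_self ((G x)⁻¹ 1 1),
    abs_nonneg ((G x)⁻¹ 0 0), abs_nonneg ((G x)⁻¹ 1 1)]

/-- A compactly supported function has bounded gradient. -/
lemma exists_gradient_bound (h : SmoothMetric G) {χ : (Fin 2 → ℝ) → ℝ} (hχ : ContDiff ℝ 1 χ)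
    (hs : HasCompactSupport χ) :
    ∃ A > 0, ∀ x ξ, |fderiv ℝ χ x ξ| ≤ A * √(normSq (G x) ξ) := by
  have hF : Continuous fun x => ‖fderiv ℝ χ x‖ * √(|(G x)⁻¹ 0 0| + |(G x)⁻¹ 1 1|) :=
    (hχ.continuous_fderiv one_ne_zero).norm.mul
      ((h.continuous_inv 0 0).abs.add (h.continuous_inv 1 1).abs).sqrt
  obtain ⟨B, hB⟩ := hs.isCompact.exists_bound_of_continuousOn hF.continuousOn
  refine ⟨|B| + 1, by positivity, fun x ξ => ?_⟩
  have h1 : |fderiv ℝ χ x ξ| ≤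
      ‖fderiv ℝ χ x‖ * √(|(G x)⁻¹ 0 0| + |(G x)⁻¹ 1 1|) * √(normSq (G x) ξ) := by
    refine ((fderiv ℝ χ x).le_opNorm ξ).trans ?_
    rw [mul_assoc]
    exact mul_le_mul_of_nonneg_left (h.norm_le_mul_sqrt_normSq x ξ) (norm_nonneg _)
  refine h1.trans (mul_le_mul_of_nonneg_right ?_ (Real.sqrt_nonneg _))
  by_cases hx : x ∈ tsupport χ
  · linarith [le_abs_self B, (le_abs_self _).trans (hB x hx)]
  · have : fderiv ℝ χ x = 0 := by
      by_contra hne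
      exact hx (support_fderiv_subset ℝ hne)
    rw [this, norm_zero, zero_mul]
    positivity

lemma integrableOn_speed (h : SmoothMetric G) {γ : ℝ → Fin 2 → ℝ} (hγ : ContDiffOn ℝ 1 γ (Icc 0 1)) :
    IntegrableOn (fun s => √(normSq (G (γ s)) (deriv γ s))) (Icc 0 1) := by
  have c : ContinuousOn (fun s => √(normSq (G (γ s)) (derivWithin γ (Icc 0 1) s))) (Icc 0 1) := by
    have c1 := hγ.continuousOn_derivWithin (uniqueDiffOn_Icc zero_lt_one) le_rfl
    have c2 := hγ.continuousOn
    refine ContinuousOn.sqrt (continuousOn_iff_continuous_domRestrict.2 ?_)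
    exact h.continuous_normSq (continuousOn_iff_continuous_domRestrict.1 c2)
      (continuousOn_iff_continuous_domRestrict.1 c1)
  have i := c.integrableOn_Icc (μ := volume)
  rw [integrableOn_Icc_iff_integrableOn_Ioo] at i ⊢
  refine i.congr_fun (fun s hs => ?_) measurableSet_Ioo
  beta_reduce
  rw [derivWithin_of_mem_nhds (Icc_mem_nhds hs.1 hs.2)]

lemma sub_le_mul_pathLength (h : SmoothMetric G) {χ : (Fin 2 → ℝ) → ℝ} (hχ : ContDiff ℝ 1 χ)
    {A : ℝ} (hA : 0 ≤ A) (H : ∀ x ξ, |fderiv ℝ χ x ξ| ≤ A * √(normSq (G x) ξ)) {γ : ℝ → Fin 2 → ℝ}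
    (hγ : ContDiffOn ℝ 1 γ (Icc 0 1)) {a b : ℝ} (ha : a ∈ Icc (0:ℝ) 1) (hb : b ∈ Icc (0:ℝ) 1)
    (hab : a ≤ b) : |χ (γ b) - χ (γ a)| ≤ A * pathLength G γ := by
  have hsub : Icc a b ⊆ Icc 0 1 := Icc_subset_Icc ha.1 hb.2
  have hi : IntegrableOn (fun s => A * √(normSq (G (γ s)) (deriv γ s))) (Icc 0 1) :=
    (h.integrableOn_speed hγ).const_mul A
  have hc : ContinuousOn (fun s => χ (γ s)) (Icc a b) :=
    hχ.continuous.comp_continuousOn (hγ.continuousOn.mono hsub)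
  have hd : ∀ s ∈ Ioo a b, HasDerivAt (fun s => χ (γ s)) (fderiv ℝ χ (γ s) (deriv γ s)) s :=
    fun s hs => by
      have hγs : HasDerivAt γ (deriv γ s) s := ((hγ.contDiffAt (Icc_mem_nhds
        (ha.1.trans_lt hs.1) (hs.2.trans_le hb.2))).differentiableAt (by simp)).hasDerivAt
      exact (hχ.differentiable (by simp) (γ s)).hasFDerivAt.comp_hasDerivAt s hγs
  have hle : (∫ s in a..b, A * √(normSq (G (γ s)) (deriv γ s))) ≤ A * pathLength G γ := by
    rw [show A * pathLength G γ = ∫ s in (0:ℝ)..1, A * √(normSq (G (γ s)) (deriv γ s)) from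
      (intervalIntegral.integral_const_mul _ _).symm, intervalIntegral.integral_of_le hab,
      intervalIntegral.integral_of_le zero_le_one, ← integral_Icc_eq_integral_Ioc,
      ← integral_Icc_eq_integral_Ioc]
    exact setIntegral_mono_set hi (ae_of_all _ fun s => by positivity) hsub.eventuallyLE
  have k1 := intervalIntegral.sub_le_integral_of_hasDeriv_right_of_le hab hc
    (fun s hs => (hd s hs).hasDerivWithinAt) (hi.mono_set hsub)
    fun s _ => (le_abs_self _).trans (H (γ s) (deriv γ s))
  have k2 := intervalIntegral.sub_le_integral_of_hasDeriv_right_of_le hab hc.neg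
    (fun s hs => (hd s hs).neg.hasDerivWithinAt) (hi.mono_set hsub)
    fun s _ => (neg_le_abs _).trans (H (γ s) (deriv γ s))
  simp only [Pi.neg_apply] at k2
  rw [abs_le]
  constructor <;> linarith

/-- Short curves which meet a ball stay in a slightly larger ball. -/
lemma exists_trap (h : SmoothMetric G) (z : Fin 2 → ℝ) {r : ℝ} (hr : 0 < r) :
    ∃ δ > 0, ∀ γ : ℝ → Fin 2 → ℝ, ContDiffOn ℝ 1 γ (Icc 0 1) → pathLength G γ < δ →
      γ 0 ∈ Metric.closedBall z r ∨ γ 1 ∈ Metric.closedBall z r →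
      γ 0 ∈ Metric.ball z (r + 1) ∧ γ 1 ∈ Metric.ball z (r + 1) := by
  let χ : ContDiffBump z := ⟨r, r + 1, hr, by linarith⟩
  obtain ⟨A, hA, H⟩ := h.exists_gradient_bound χ.contDiff χ.hasCompactSupport
  refine ⟨A⁻¹, by positivity, fun γ hγ hl hm => ?_⟩
  have k := h.sub_le_mul_pathLength χ.contDiff hA.le H hγ (left_mem_Icc.2 zero_le_one)
    (right_mem_Icc.2 zero_le_one) zero_le_one
  have k' : A * pathLength G γ < 1 := by rwa [← lt_inv_mul_iff₀ hA, mul_one]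
  have hpos : ∀ x, 0 < χ x → x ∈ Metric.ball z (r + 1) := fun x hx => by
    by_contra hcon
    rw [Metric.mem_ball, not_lt] at hcon
    exact hx.ne' (χ.zero_of_le_dist hcon)
  have hsub : Metric.closedBall z r ⊆ Metric.ball z (r + 1) :=
    Metric.closedBall_subset_ball (by linarith)
  obtain ⟨k1, k2⟩ := abs_le.1 k
  rcases hm with hm | hm
  · have e : χ (γ 0) = 1 := χ.one_of_mem_closedBall hm
    exact ⟨hsub hm, hpos _ (by linarith)⟩
  · have e : χ (γ 1) = 1 := χ.one_of_mem_closedBall hm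
    exact ⟨hpos _ (by linarith), hsub hm⟩

lemma normSq_le_norm_sq (M : Matrix (Fin 2) (Fin 2) ℝ) (ξ : Fin 2 → ℝ) :
    normSq M ξ ≤ (∑ a, ∑ b, |M a b|) * ‖ξ‖ ^ 2 := by
  rw [normSq, Finset.sum_mul]
  refine Finset.sum_le_sum fun a _ => ?_
  rw [Finset.sum_mul]
  refine Finset.sum_le_sum fun b _ => (le_abs_self _).trans ?_
  rw [abs_mul, abs_mul, mul_assoc, pow_two]
  refine mul_le_mul_of_nonneg_left ?_ (abs_nonneg _)
  exact mul_le_mul (norm_le_pi_norm ξ a) (norm_le_pi_norm ξ b) (abs_nonneg _) (norm_nonneg _)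

/-- Nearby points are joined by short curves. -/
lemma exists_reach (h : SmoothMetric G) (z : Fin 2 → ℝ) {ε : ℝ} (hε : 0 < ε) :
    ∃ δ > 0, ∀ y ∈ Metric.ball z δ, ∀ y' ∈ Metric.ball z δ, Reach G y y' ε := by
  have hc : Continuous fun x => ∑ a, ∑ b, |G x a b| :=
    continuous_finsetSum _ fun a _ => continuous_finsetSum _ fun b _ => (h.1 a b).continuous.abs
  obtain ⟨B, hB⟩ := (isCompact_closedBall z 1).exists_bound_of_continuousOn hc.continuousOn
  refine ⟨min 1 (ε / (2 * (√|B| + 1))), lt_min one_pos (by positivity), fun y hy y' hy' => ?_⟩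
  have hseg : ContDiff ℝ 1 fun s : ℝ => y + s • (y' - y) := by fun_prop
  refine ⟨fun s => y + s • (y' - y), hseg, by simp, by simp, ?_⟩
  have hd : ∀ s, deriv (fun s : ℝ => y + s • (y' - y)) s = y' - y := fun s => by
    have := ((hasDerivAt_id s).smul_const (y' - y)).const_add y
    simpa using this.deriv
  have hn : ‖y' - y‖ < ε / (√|B| + 1) := by
    rw [← dist_eq_norm]
    have e1 := (Metric.mem_ball.1 hy).trans_le (min_le_right _ _)
    have e2 := (Metric.mem_ball.1 hy').trans_le (min_le_right _ _)
    have e3 := dist_triangle_right y' y z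
    have e4 : ε / (2 * (√|B| + 1)) + ε / (2 * (√|B| + 1)) = ε / (√|B| + 1) := by field_simp; ring
    linarith
  have hsp : ∀ s ∈ Icc (0:ℝ) 1,
      √(normSq (G (y + s • (y' - y))) (deriv (fun s : ℝ => y + s • (y' - y)) s)) ≤
        √|B| * ‖y' - y‖ := fun s hs => by
    rw [hd, ← Real.sqrt_sq (norm_nonneg (y' - y)), ← Real.sqrt_mul (abs_nonneg _)]
    refine Real.sqrt_le_sqrt ((normSq_le_norm_sq _ _).trans
      (mul_le_mul_of_nonneg_right ?_ (sq_nonneg _)))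
    have hm : y + s • (y' - y) ∈ Metric.closedBall z 1 :=
      (convex_closedBall z 1).add_smul_sub_mem
        (Metric.ball_subset_closedBall (Metric.ball_subset_ball (min_le_left _ _) hy))
        (Metric.ball_subset_closedBall (Metric.ball_subset_ball (min_le_left _ _) hy')) hs
    exact (le_abs_self _).trans ((hB _ hm).trans (le_abs_self _))
  have := intervalIntegral.integral_mono_on zero_le_one
    ((h.continuous_speed hseg).intervalIntegrable 0 1) (intervalIntegrable_const (μ := volume)) hsp
  rw [intervalIntegral.integral_const, sub_zero, one_smul] at this
  refine lt_of_le_of_lt this ?_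
  rw [lt_div_iff₀ (by positivity)] at hn
  nlinarith [norm_nonneg (y' - y)]

end SmoothMetric

end HopfRinow

section HopfRinow

variable {G : (Fin 2 → ℝ) → Matrix (Fin 2) (Fin 2) ℝ}

/-- The metric ball of radius `r` about `x` is bounded in coordinates. -/
def Tame (G : (Fin 2 → ℝ) → Matrix (Fin 2) (Fin 2) ℝ) (x : Fin 2 → ℝ) (r : ℝ) : Prop :=
  ∃ R : ℝ, ∀ y, Reach G x y r → ‖y‖ ≤ R

namespace SmoothMetric

lemma exists_not_tame (h : SmoothMetric G) {x : Fin 2 → ℝ} {a : ℝ} (ha : 0 < a)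
    (hx : ¬ Tame G x a) : ∃ x', Reach G x x' a ∧ ¬ Tame G x' (2 / 3 * a) := by
  by_contra! hcon
  apply hx
  obtain ⟨R₀, hR₀⟩ := hcon x (Reach.refl x ha)
  have key : ∃ R : ℝ, ∀ y ∈ Metric.closedBall (0 : Fin 2 → ℝ) R₀, Reach G x y (a / 2) →
      ∀ w, Reach G y w (a / 2) → ‖w‖ ≤ R := by
    refine (isCompact_closedBall (0 : Fin 2 → ℝ) R₀).induction_on
      (p := fun s => ∃ R : ℝ, ∀ y ∈ s, Reach G x y (a / 2) →
        ∀ w, Reach G y w (a / 2) → ‖w‖ ≤ R) ⟨0, by simp⟩ ?_ ?_ ?_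
    · rintro s t hst ⟨R, hR⟩
      exact ⟨R, fun y hy => hR y (hst hy)⟩
    · rintro s t ⟨R, hR⟩ ⟨R', hR'⟩
      refine ⟨max R R', fun y hy hxy w hw => ?_⟩
      rcases hy with hy | hy
      · exact (hR y hy hxy w hw).trans (le_max_left _ _)
      · exact (hR' y hy hxy w hw).trans (le_max_right _ _)
    · intro z _
      obtain ⟨δ, hδ, hreach⟩ := h.exists_reach z (show 0 < a / 6 by positivity)
      refine ⟨Metric.ball z δ, mem_nhdsWithin_of_mem_nhds (Metric.ball_mem_nhds z hδ), ?_⟩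
      by_cases hy : ∃ y₀ ∈ Metric.ball z δ, Reach G x y₀ a
      · obtain ⟨y₀, hy₀, hxy₀⟩ := hy
        obtain ⟨R, hR⟩ := hcon y₀ hxy₀
        refine ⟨R, fun y hy hxy w hw => hR w ?_⟩
        exact ((hreach y₀ hy₀ y hy).trans h hw).mono (by linarith)
      · push Not at hy
        exact ⟨0, fun y hy' hxy => absurd (hxy.mono (by linarith)) (hy y hy')⟩
  obtain ⟨R, hR⟩ := key
  refine ⟨R, fun w hw => ?_⟩
  obtain ⟨y, hxy, hyw⟩ := Reach.split (r := a / 2) h (hw.mono (by linarith))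
  refine hR y ?_ hxy w hyw
  rw [mem_closedBall_zero_iff]
  exact hR₀ y (hxy.mono (by linarith))

lemma exists_pathLength_lt {x y : Fin 2 → ℝ} {r : ℝ} (hr : riemDist G x y < r) :
    ∃ γ : ℝ → Fin 2 → ℝ, ContDiffOn ℝ 1 γ (Icc 0 1) ∧ γ 0 = x ∧ γ 1 = y ∧ pathLength G γ < r := by
  have hne : {L : ℝ | ∃ γ : ℝ → Fin 2 → ℝ, ContDiffOn ℝ 1 γ (Icc 0 1) ∧ γ 0 = x ∧ γ 1 = y ∧
      L = pathLength G γ}.Nonempty :=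
    ⟨_, fun s : ℝ => x + s • (y - x), by fun_prop, by simp, by simp, rfl⟩
  obtain ⟨_, ⟨γ, h1, h2, h3, rfl⟩, h4⟩ := exists_lt_of_csInf_lt hne hr
  exact ⟨γ, h1, h2, h3, h4⟩

/-- Metric balls of a complete metric are bounded. -/
theorem tame_of_riemComplete (h : SmoothMetric G) (hc : riemComplete G) (x : Fin 2 → ℝ) (r : ℝ) :
    Tame G x r := by
  rcases le_or_gt r 0 with hr | hr
  · exact ⟨0, fun y ⟨γ, _, _, _, h4⟩ =>
      absurd (arcLength_nonneg (G := G) γ zero_le_one) (by linarith)⟩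
  by_contra hx
  set a : ℕ → ℝ := fun k => r * (2 / 3) ^ k with ha
  have apos : ∀ k, 0 < a k := fun k => by positivity
  have asucc : ∀ k, a (k + 1) = 2 / 3 * a k := fun k => by simp only [ha, pow_succ]; ring
  have step : ∀ (k : ℕ) (y : {y // ¬ Tame G y (a k)}),
      ∃ y' : {y // ¬ Tame G y (a (k + 1))}, Reach G y.1 y'.1 (a k) := fun k y => by
    obtain ⟨y', h1, h2⟩ := h.exists_not_tame (apos k) y.2
    exact ⟨⟨y', by rwa [asucc]⟩, h1⟩
  choose f hf using step
  let u : ∀ k, {y // ¬ Tame G y (a k)} := fun k =>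
    Nat.rec ⟨x, by simpa [ha] using hx⟩ (fun k y => f k y) k
  have hu : ∀ k, Reach G (u k).1 (u (k + 1)).1 (a k) := fun k => hf k (u k)
  have hum : ∀ p m, Reach G (u p).1 (u (p + m)).1 (4 * a p - 3 * a (p + m)) := by
    intro p m
    induction m with
    | zero => exact Reach.refl _ (by have := apos p; simp; linarith)
    | succ m ih =>
      refine (ih.trans h (hu (p + m))).mono ?_
      rw [← add_assoc, asucc]
      linarith
  have alim : Filter.Tendsto a Filter.atTop (nhds 0) := by
    simpa using (tendsto_pow_atTop_nhds_zero_of_lt_one (r := (2/3 : ℝ)) (by norm_num)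
      (by norm_num)).const_mul r
  have asmall : ∀ ε > 0, ∃ N, ∀ k ≥ N, a k < ε := fun ε hε =>
    Filter.eventually_atTop.1 (alim.eventually (gt_mem_nhds hε))
  obtain ⟨z, hz⟩ := hc (fun k => (u k).1) fun ε hε => by
    obtain ⟨N, hN⟩ := asmall (ε / 8) (by positivity)
    refine ⟨N, fun p hp q hq => ?_⟩
    have hNp : ∀ p ≥ N, Reach G (u N).1 (u p).1 (ε / 2) := fun p hp => by
      obtain ⟨m, rfl⟩ := Nat.exists_eq_add_of_le hp
      refine (hum N m).mono ?_
      have := hN N le_rfl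
      have := apos (N + m)
      linarith
    exact (((hNp p hp).symm.trans h (hNp q hq)).mono (by linarith)).riemDist_lt
  obtain ⟨δ₁, hδ₁, T₁⟩ := h.exists_trap z one_pos
  obtain ⟨δ₂, hδ₂, T₂⟩ := h.exists_trap z two_pos
  obtain ⟨N₁, hN₁⟩ := hz δ₁ hδ₁
  obtain ⟨N₂, hN₂⟩ := asmall δ₂ hδ₂
  set p := max N₁ N₂
  have hp : (u p).1 ∈ Metric.closedBall z 2 := by
    obtain ⟨γ, h1, h2, h3, h4⟩ := exists_pathLength_lt (hN₁ p (le_max_left _ _))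
    have := (T₁ γ h1 h4 (Or.inr (by rw [h3]; exact Metric.mem_closedBall_self zero_le_one))).1
    rw [h2] at this
    refine Metric.ball_subset_closedBall ?_
    convert this using 2
    norm_num
  refine (u p).2 ⟨‖z‖ + 3, fun y ⟨γ, h1, h2, h3, h4⟩ => ?_⟩
  have := (T₂ γ h1.contDiffOn (lt_trans h4 (hN₂ p (le_max_right _ _))) (Or.inl (by rwa [h2]))).2
  rw [h3, mem_ball_iff_norm] at this
  have h5 := norm_le_insert' y z
  linarith

end SmoothMetric

end HopfRinow

section Proper

variable {G : (Fin 2 → ℝ) → Matrix (Fin 2) (Fin 2) ℝ}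

lemma SmoothMetric.arcLength_le_energy (h : SmoothMetric G) {γ : ℝ → Fin 2 → ℝ}
    (hγ : ContDiff ℝ 1 γ) {σ : ℝ} (hσ : σ ∈ Icc (0:ℝ) 1) :
    arcLength G γ 0 σ ≤ (1 + energy G γ) / 2 := by
  have h1 := h.arcLength_add hγ 0 σ 1
  have h2 : 0 ≤ arcLength G γ σ 1 := arcLength_nonneg γ hσ.2
  have h3 : arcLength G γ 0 1 ≤
      ∫ s in (0:ℝ)..1, (1 / 2 + 1 / 2 * normSq (G (γ s)) (deriv γ s)) := by
    refine intervalIntegral.integral_mono_on zero_le_one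
      ((h.continuous_speed hγ).intervalIntegrable _ _)
      ((continuous_const.add ((h.continuous_energyDensity hγ).const_mul _)).intervalIntegrable _ _)
      fun s _ => ?_
    have e := Real.sq_sqrt (h.normSq_nonneg (γ s) (deriv γ s))
    nlinarith [sq_nonneg (√(normSq (G (γ s)) (deriv γ s)) - 1)]
  rw [intervalIntegral.integral_add (by simp)
    (((h.continuous_energyDensity hγ).const_mul _).intervalIntegrable _ _),
    intervalIntegral.integral_const_mul] at h3
  change _ ≤ _ + 1 / 2 * energy G γ at h3
  simp at h3
  linarith

namespace RicciFlowTwo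

variable {g : (Fin 2 → ℝ) → ℝ → Matrix (Fin 2) (Fin 2) ℝ} {T : ℝ}

/-- The flow preserves the conformal class. -/
theorem conformal (h : RicciFlowTwo g T) (x : Fin 2 → ℝ) {t : ℝ} (ht : t ∈ Icc 0 T) (a b : Fin 2) :
    g x t a b * g x 0 0 0 = g x t 0 0 * g x 0 a b := by
  have pos : ∀ s ∈ Icc 0 T, g x s 0 0 ≠ 0 := fun s hs => ((h.slice hs).diag_pos x).ne'
  have hd : ∀ s ∈ Icc 0 T,
      HasDerivWithinAt (fun r => g x r a b / g x r 0 0) 0 (Icc 0 T) s := fun s hs => by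
    refine ((h.hasDerivWithinAt_time x hs a b).fun_div (h.hasDerivWithinAt_time x hs 0 0)
      (pos s hs)).congr_deriv ?_
    rw [div_eq_zero_iff]
    left
    ring
  have k := constant_of_derivWithin_zero (fun s hs => (hd s hs).differentiableWithinAt)
    (fun s hs => (hd s (Ico_subset_Icc_self hs)).derivWithin
      (uniqueDiffOn_Icc (hs.1.trans_lt hs.2) s (Ico_subset_Icc_self hs))) t ht
  have p0 := pos 0 ⟨le_rfl, ht.1.trans ht.2⟩
  have pt := pos t ht
  field_simp at k
  linarith

lemma normSq_conformal (h : RicciFlowTwo g T) (x ξ : Fin 2 → ℝ) {t : ℝ} (ht : t ∈ Icc 0 T) :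
    normSq (g x t) ξ * g x 0 0 0 = g x t 0 0 * normSq (g x 0) ξ := by
  simp only [normSq, Finset.sum_mul, Finset.mul_sum]
  refine Finset.sum_congr rfl fun a _ => Finset.sum_congr rfl fun b _ => ?_
  linear_combination ξ a * ξ b * h.conformal x ht a b

lemma normSq_conformal_le (h : RicciFlowTwo g T) (x ξ : Fin 2 → ℝ) {t s C : ℝ} (ht : t ∈ Icc 0 T)
    (hs : s ∈ Icc 0 T) (hC : g x s 0 0 ≤ C * g x t 0 0) :
    normSq (g x s) ξ ≤ C * normSq (g x t) ξ := by
  have h0 := (h.slice ⟨le_rfl, ht.1.trans ht.2⟩ : SmoothMetric fun y => g y 0)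
  have p0 := h0.diag_pos x
  have k := mul_le_mul_of_nonneg_right hC (h0.normSq_nonneg x ξ)
  have e1 := h.normSq_conformal x ξ ht
  have e2 := h.normSq_conformal x ξ hs
  refine le_of_mul_le_mul_right ?_ p0
  rw [e2, mul_assoc, e1]
  linarith

lemma exists_bound_near (h : RicciFlowTwo g T) (hc : ∀ t ∈ Icc 0 T, riemComplete fun x => g x t)
    (x₀ : Fin 2 → ℝ) (r : ℝ) (t₀ : Icc (0:ℝ) T) :
    ∃ Rb, ∀ᶠ t : Icc (0:ℝ) T in nhds t₀, ∀ γ : ℝ → Fin 2 → ℝ, ContDiff ℝ 1 γ → γ 0 = x₀ →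
      energy (fun y => g y t) γ ≤ r → ∀ s ∈ Icc (0:ℝ) 1, ‖γ s‖ ≤ Rb := by
  obtain ⟨R₁, hR₁⟩ := (h.slice t₀.2).tame_of_riemComplete (hc t₀ t₀.2) x₀ (2 + r)
  set Rb := max R₁ ‖x₀‖ + 1 with hRb
  have hcont : Continuous fun p : Icc (0:ℝ) T × (Fin 2 → ℝ) => g p.2 p.1 0 0 :=
    (h.smooth.1 0 0).continuousOn.comp_continuous (f := fun p : Icc (0:ℝ) T × (Fin 2 → ℝ) =>
      (p.2, (p.1 : ℝ))) (by fun_prop) fun p => ⟨mem_univ _, p.1.2⟩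
  have hcont₀ : Continuous fun p : Icc (0:ℝ) T × (Fin 2 → ℝ) => g p.2 t₀ 0 0 :=
    hcont.comp (continuous_const.prodMk continuous_snd : Continuous
      fun p : Icc (0:ℝ) T × (Fin 2 → ℝ) => (t₀, p.2))
  have ev := (isCompact_closedBall (0 : Fin 2 → ℝ) Rb).eventually_forall_of_forall_eventually
    (x₀ := t₀) (P := fun t y => g y t₀ 0 0 < 4 * g y t 0 0) fun y _ =>
      hcont₀.continuousAt.eventually_lt (hcont.const_mul 4).continuousAt (by
        have := (h.slice t₀.2).diag_pos y
        dsimp only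
        linarith)
  refine ⟨Rb, ev.mono fun t hK γ hγ hγ0 hE s hs => ?_⟩
  by_contra! hlt
  have hcpt : IsCompact {s ∈ Icc (0:ℝ) 1 | Rb ≤ ‖γ s‖} :=
    isCompact_Icc.inter_right (isClosed_le continuous_const hγ.continuous.norm)
  obtain ⟨σ, ⟨hσ, hσR⟩, hmin⟩ := hcpt.exists_isLeast ⟨s, hs, hlt.le⟩
  have hin : ∀ u ∈ Ico 0 σ, ‖γ u‖ ≤ Rb := fun u hu => by
    by_contra! hcon
    exact absurd (hmin ⟨⟨hu.1, hu.2.le.trans hσ.2⟩, hcon.le⟩) (not_le.2 hu.2)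
  have hlen : arcLength (fun y => g y t₀) γ 0 σ ≤ 2 * arcLength (fun y => g y t) γ 0 σ := by
    unfold arcLength
    rw [← intervalIntegral.integral_const_mul]
    refine intervalIntegral.integral_mono_on_of_le_Ioo hσ.1
      (((h.slice t₀.2).continuous_speed hγ).intervalIntegrable _ _)
      ((((h.slice t.2).continuous_speed hγ).const_mul 2).intervalIntegrable _ _) fun u hu => ?_
    have e4 : (2:ℝ) = √4 := by rw [show (4:ℝ) = 2 ^ 2 by norm_num, Real.sqrt_sq two_pos.le]
    rw [e4, ← Real.sqrt_mul (by norm_num)]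
    exact Real.sqrt_le_sqrt (h.normSq_conformal_le _ _ t.2 t₀.2
      (hK _ (mem_closedBall_zero_iff.2 (hin u ⟨hu.1.le, hu.2⟩))).le)
  have hle := (h.slice t.2).arcLength_le_energy hγ hσ
  have hreach := Reach.of_arcLength_lt (r := 2 + r) (h.slice t₀.2) hγ hσ.1 (by linarith)
  rw [hγ0] at hreach
  have := hR₁ _ hreach
  have := le_max_left R₁ ‖x₀‖
  linarith

/-- A flow by complete metrics is uniformly proper. -/
theorem uniformlyProper (h : RicciFlowTwo g T) (hc : ∀ t ∈ Icc 0 T, riemComplete fun x => g x t)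
    (x₀ : Fin 2 → ℝ) {T₁ : ℝ} (hT₁ : T₁ ≤ T) : UniformlyProper g x₀ T₁ := by
  intro r
  suffices H : ∃ Rb, ∀ t ∈ (univ : Set (Icc (0:ℝ) T)), ∀ γ : ℝ → Fin 2 → ℝ, ContDiff ℝ 1 γ →
      γ 0 = x₀ → energy (fun y => g y t) γ ≤ r → ∀ s ∈ Icc (0:ℝ) 1, ‖γ s‖ ≤ Rb by
    obtain ⟨Rb, hRb⟩ := H
    exact ⟨Rb, fun t ht => hRb ⟨t, ht.1, ht.2.trans hT₁⟩ (mem_univ _)⟩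
  refine isCompact_univ.induction_on (p := fun S : Set (Icc (0:ℝ) T) => ∃ Rb, ∀ t ∈ S,
      ∀ γ : ℝ → Fin 2 → ℝ, ContDiff ℝ 1 γ → γ 0 = x₀ → energy (fun y => g y t) γ ≤ r →
        ∀ s ∈ Icc (0:ℝ) 1, ‖γ s‖ ≤ Rb) ⟨0, by simp⟩ ?_ ?_ ?_
  · rintro S S' hS ⟨R, hR⟩
    exact ⟨R, fun t ht => hR t (hS ht)⟩
  · rintro S S' ⟨R, hR⟩ ⟨R', hR'⟩
    refine ⟨max R R', fun t ht γ h1 h2 h3 s hs => ?_⟩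
    rcases ht with ht | ht
    · exact (hR t ht γ h1 h2 h3 s hs).trans (le_max_left _ _)
    · exact (hR' t ht γ h1 h2 h3 s hs).trans (le_max_right _ _)
  · intro t₀ _
    obtain ⟨R, hR⟩ := h.exists_bound_near hc x₀ r t₀
    exact ⟨{t | _}, by rw [nhdsWithin_univ]; exact hR, R, fun t ht => ht⟩

end RicciFlowTwo

end Proper

section TimePrimitive

variable {T : ℝ} {f : (Fin n → ℝ) × ℝ → ℝ}

lemma contDiffOn_pd_slice_Icc (hT : 0 < T)
    (hf : ContDiffOn ℝ (⊤ : ℕ∞) f (univ ×ˢ Icc 0 T)) (i : Fin n) :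
    ContDiffOn ℝ (⊤ : ℕ∞) (fun p : (Fin n → ℝ) × ℝ => pd (fun y => f (y, p.2)) i p.1)
      (univ ×ˢ Icc 0 T) := by
  have uS : UniqueDiffOn ℝ ((univ : Set (Fin n → ℝ)) ×ˢ Icc 0 T) :=
    uniqueDiffOn_univ.prod (uniqueDiffOn_Icc hT)
  refine ((hf.fderivWithin uS (m := (⊤ : ℕ∞)) (by simp)).clm_apply
    (contDiffOn_const (c := (Pi.single i 1, 0)))).congr ?_
  rintro ⟨x, t⟩ hp
  have d1 := (hf.differentiableOn (by simp) _ hp).hasFDerivWithinAt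
  have ev : ∀ᶠ y in nhds x, (y, t) ∈ (univ : Set (Fin n → ℝ)) ×ˢ Icc 0 T :=
    Filter.Eventually.of_forall fun _ => ⟨mem_univ _, hp.2⟩
  have d2 := d1.comp_hasFDerivAt x (hasFDerivAt_slice x t) ev
  change HasFDerivAt (fun y => f (y, t)) _ x at d2
  simp only [pd]
  rw [d2.fderiv]
  simp

lemma contDiff_slice_Icc (hf : ContDiffOn ℝ (⊤ : ℕ∞) f (univ ×ˢ Icc 0 T)) {t : ℝ}
    (ht : t ∈ Icc 0 T) : ContDiff ℝ (⊤ : ℕ∞) fun y => f (y, t) :=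
  contDiffOn_univ.1 (hf.comp (f := fun y => (y, t)) (by fun_prop) fun _ _ => ⟨mem_univ _, ht⟩)

/-- The nearest point of `[0, T]`. -/
def clamp (T s : ℝ) : ℝ := max 0 (min T s)

lemma clamp_mem (hT : 0 < T) (s : ℝ) : clamp T s ∈ Icc 0 T :=
  ⟨le_max_left _ _, max_le hT.le (min_le_left _ _)⟩

lemma clamp_of_mem {t : ℝ} (ht : t ∈ Icc 0 T) : clamp T t = t := by
  rw [clamp, min_eq_right ht.2, max_eq_right ht.1]

lemma continuous_clamp : Continuous (clamp T) := by
  unfold clamp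
  fun_prop

/-- The primitive in time of a function on `[0, T]`. -/
def timePrim (T : ℝ) (f : (Fin n → ℝ) × ℝ → ℝ) (p : (Fin n → ℝ) × ℝ) : ℝ :=
  ∫ s in (0:ℝ)..p.2, f (p.1, clamp T s)

lemma continuous_clamped (hT : 0 < T) (hf : ContinuousOn f (univ ×ˢ Icc 0 T)) :
    Continuous fun p : (Fin n → ℝ) × ℝ => f (p.1, clamp T p.2) :=
  hf.comp_continuous (continuous_fst.prodMk (continuous_clamp.comp continuous_snd))
    fun _ => ⟨mem_univ _, clamp_mem hT _⟩

lemma continuous_clamped_slice (hT : 0 < T) (hf : ContinuousOn f (univ ×ˢ Icc 0 T))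
    (x : Fin n → ℝ) : Continuous fun s : ℝ => f (x, clamp T s) :=
  (continuous_clamped hT hf).comp (continuous_const.prodMk continuous_id)

lemma continuous_timePrim (hT : 0 < T) (hf : ContinuousOn f (univ ×ˢ Icc 0 T)) :
    Continuous (timePrim T f) :=
  intervalIntegral.continuous_parametric_intervalIntegral_of_continuous
    (f := fun (p : (Fin n → ℝ) × ℝ) (s : ℝ) => f (p.1, clamp T s))
    ((continuous_clamped hT hf).comp (by fun_prop : Continuous
      fun q : ((Fin n → ℝ) × ℝ) × ℝ => (q.1.1, q.2))) continuous_snd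

lemma timePrim_zero (x : Fin n → ℝ) : timePrim T f (x, 0) = 0 :=
  intervalIntegral.integral_same

lemma hasDerivAt_timePrim (hT : 0 < T) (hf : ContinuousOn f (univ ×ˢ Icc 0 T)) (x : Fin n → ℝ)
    (t : ℝ) : HasDerivAt (fun s => timePrim T f (x, s)) (f (x, clamp T t)) t :=
  intervalIntegral.integral_hasDerivAt_right
    ((continuous_clamped_slice hT hf x).intervalIntegrable _ _)
    (continuous_clamped_slice hT hf x).stronglyMeasurable.stronglyMeasurableAtFilter
    (continuous_clamped_slice hT hf x).continuousAt

lemma hasFDerivAt_timePrim_slice (hT : 0 < T) (hf : ContDiffOn ℝ (⊤ : ℕ∞) f (univ ×ˢ Icc 0 T))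
    (x : Fin n → ℝ) (t : ℝ) : HasFDerivAt (fun y => timePrim T f (y, t))
      (∑ i, timePrim T (fun p => pd (fun y => f (y, p.2)) i p.1) (x, t) •
        (ContinuousLinearMap.proj i : (Fin n → ℝ) →L[ℝ] ℝ)) x := by
  set D : Fin n → (Fin n → ℝ) × ℝ → ℝ := fun i p => pd (fun y => f (y, p.2)) i p.1 with hD
  have cD : ∀ i, ContinuousOn (D i) (univ ×ˢ Icc 0 T) := fun i =>
    (contDiffOn_pd_slice_Icc hT hf i).continuousOn
  set F' : (Fin n → ℝ) → ℝ → (Fin n → ℝ) →L[ℝ] ℝ := fun y s =>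
    ∑ i, D i (y, clamp T s) • (ContinuousLinearMap.proj i : (Fin n → ℝ) →L[ℝ] ℝ) with hF'
  have cF' : Continuous fun q : (Fin n → ℝ) × ℝ => F' q.1 q.2 :=
    continuous_finsetSum _ fun i _ => (continuous_clamped hT (cD i)).smul continuous_const
  obtain ⟨B, hB⟩ := ((isCompact_closedBall x 1).prod
    (isCompact_uIcc (a := 0) (b := t))).exists_bound_of_continuousOn cF'.continuousOn
  have key := intervalIntegral.hasFDerivAt_integral_of_dominated_of_fderiv_le (μ := volume)
    (a := 0) (b := t) (F := fun y s => f (y, clamp T s)) (F' := F') (x₀ := x) (bound := fun _ => B)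
    (Metric.closedBall_mem_nhds x one_pos)
    (Filter.Eventually.of_forall fun y =>
      (continuous_clamped_slice hT hf.continuousOn y).aestronglyMeasurable)
    ((continuous_clamped_slice hT hf.continuousOn x).intervalIntegrable _ _)
    (cF'.comp (continuous_const.prodMk continuous_id)).aestronglyMeasurable
    (Filter.Eventually.of_forall fun s hs y hy => hB (y, s) ⟨hy, uIoc_subset_uIcc hs⟩)
    intervalIntegrable_const
    (Filter.Eventually.of_forall fun s _ y _ => by
      have d := ((contDiff_slice_Icc hf (clamp_mem hT s)).differentiable (by simp) y).hasFDerivAt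
      refine d.congr_fderiv (ContinuousLinearMap.ext fun v => ?_)
      rw [fderiv_apply_eq_sum_pd]
      simp [hF', hD, mul_comm])
  refine key.congr_fderiv ?_
  simp only [hF']
  have hI : ∀ i ∈ Finset.univ, IntervalIntegrable (fun s => D i (x, clamp T s) •
      (ContinuousLinearMap.proj i : (Fin n → ℝ) →L[ℝ] ℝ)) volume 0 t := fun i _ =>
    ((continuous_clamped_slice hT (cD i) x).smul continuous_const).intervalIntegrable _ _
  rw [intervalIntegral.integral_finsetSum hI]
  exact Finset.sum_congr rfl fun i _ => intervalIntegral.integral_smul_const _ _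

lemma pd_timePrim (hT : 0 < T) (hf : ContDiffOn ℝ (⊤ : ℕ∞) f (univ ×ˢ Icc 0 T)) (i : Fin n)
    (x : Fin n → ℝ) (t : ℝ) : pd (fun y => timePrim T f (y, t)) i x =
      timePrim T (fun p => pd (fun y => f (y, p.2)) i p.1) (x, t) := by
  rw [pd, (hasFDerivAt_timePrim_slice hT hf x t).fderiv]
  simp [Pi.single_apply]

lemma hasFDerivAt_timePrim (hT : 0 < T) (hf : ContDiffOn ℝ (⊤ : ℕ∞) f (univ ×ˢ Icc 0 T))
    (p : (Fin n → ℝ) × ℝ) : HasFDerivAt (timePrim T f)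
      ((∑ i, timePrim T (fun p => pd (fun y => f (y, p.2)) i p.1) p •
        (ContinuousLinearMap.proj i : (Fin n → ℝ) →L[ℝ] ℝ)).coprod
          (ContinuousLinearMap.toSpanSingleton ℝ (f (p.1, clamp T p.2)))) p := by
  have c1 : Continuous fun p : (Fin n → ℝ) × ℝ =>
      ∑ i, timePrim T (fun p => pd (fun y => f (y, p.2)) i p.1) p •
        (ContinuousLinearMap.proj i : (Fin n → ℝ) →L[ℝ] ℝ) :=
    continuous_finsetSum _ fun i _ => (continuous_timePrim hT
      (contDiffOn_pd_slice_Icc hT hf i).continuousOn).smul continuous_const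
  have c2 : Continuous fun p : (Fin n → ℝ) × ℝ =>
      ContinuousLinearMap.toSpanSingleton ℝ (f (p.1, clamp T p.2)) := by
    have := continuous_clamped hT hf.continuousOn
    exact (ContinuousLinearMap.toSpanSingletonCLE (𝕜 := ℝ) (E := ℝ)).continuous.comp this
  exact (hasStrictFDerivAt_uncurry_coprod (f := fun x t => timePrim T f (x, t))
    (f₁ := fun x t => ∑ i, timePrim T (fun p => pd (fun y => f (y, p.2)) i p.1) (x, t) •
        (ContinuousLinearMap.proj i : (Fin n → ℝ) →L[ℝ] ℝ))
    (f₂ := fun x t => ContinuousLinearMap.toSpanSingleton ℝ (f (x, clamp T t)))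
    (Filter.Eventually.of_forall fun v => hasFDerivAt_timePrim_slice hT hf v.1 v.2)
    (Filter.Eventually.of_forall fun v =>
      (hasDerivAt_timePrim hT hf.continuousOn v.1 v.2).hasFDerivAt)
    c1.continuousAt c2.continuousAt).hasFDerivAt

lemma contDiffOn_timePrim (hT : 0 < T) (hf : ContDiffOn ℝ (⊤ : ℕ∞) f (univ ×ˢ Icc 0 T)) :
    ContDiffOn ℝ (⊤ : ℕ∞) (timePrim T f) (univ ×ˢ Ioo 0 T) := by
  have hΩ : IsOpen ((univ : Set (Fin n → ℝ)) ×ˢ Ioo (0:ℝ) T) := isOpen_univ.prod isOpen_Ioo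
  refine contDiffOn_infty.2 fun m => ?_
  induction m generalizing f with
  | zero => exact contDiffOn_zero.2 (continuous_timePrim hT hf.continuousOn).continuousOn
  | succ m ih =>
    rw [Nat.cast_succ, contDiffOn_succ_iff_fderiv_of_isOpen hΩ]
    refine ⟨fun p _ => (hasFDerivAt_timePrim hT hf p).differentiableAt.differentiableWithinAt,
      by simp, ?_⟩
    have e : ∀ p ∈ (univ : Set (Fin n → ℝ)) ×ˢ Ioo (0:ℝ) T, fderiv ℝ (timePrim T f) p =
        ∑ i, timePrim T (fun p => pd (fun y => f (y, p.2)) i p.1) p •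
          ((ContinuousLinearMap.proj i : (Fin n → ℝ) →L[ℝ] ℝ).comp
            (ContinuousLinearMap.fst ℝ (Fin n → ℝ) ℝ)) +
          f p • ContinuousLinearMap.snd ℝ (Fin n → ℝ) ℝ := fun p hp => by
      rw [(hasFDerivAt_timePrim hT hf p).fderiv, clamp_of_mem (Ioo_subset_Icc_self hp.2)]
      refine ContinuousLinearMap.ext fun v => ?_
      simp [mul_comm]
    refine ContDiffOn.congr ?_ e
    refine ContDiffOn.add (ContDiffOn.sum fun i _ => ?_) ?_
    · exact (ih (contDiffOn_pd_slice_Icc hT hf i)).smul contDiffOn_const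
    · exact ((hf.mono (prod_mono_right Ioo_subset_Icc_self)).of_le (by exact_mod_cast le_top)).smul
        contDiffOn_const

end TimePrimitive

section LogFactor

section Laplacian

variable {G : (Fin 2 → ℝ) → Matrix (Fin 2) (Fin 2) ℝ} {u v : (Fin 2 → ℝ) → ℝ}

lemma lap_add (hu : ContDiff ℝ (⊤ : ℕ∞) u) (hv : ContDiff ℝ (⊤ : ℕ∞) v) (x : Fin 2 → ℝ) :
    lap G (fun y => u y + v y) x = lap G u x + lap G v x := by
  have e : ∀ a, pd (fun y => u y + v y) a = fun x => pd u a x + pd v a x := fun a =>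
    funext fun x => pd_add (hu.differentiableAt_top x) (hv.differentiableAt_top x) a
  have e2 : ∀ a b, pd (fun x => pd u a x + pd v a x) b x = pd (pd u a) b x + pd (pd v a) b x :=
    fun a b => pd_add ((contDiff_pd hu a).differentiableAt_top x)
      ((contDiff_pd hv a).differentiableAt_top x) b
  simp only [lap, e, e2, Fin.sum_univ_two]
  ring

lemma lap_const_mul (c : ℝ) (hu : ContDiff ℝ (⊤ : ℕ∞) u) (x : Fin 2 → ℝ) :
    lap G (fun y => c * u y) x = c * lap G u x := by
  have e : ∀ a, pd (fun y => c * u y) a = fun x => c * pd u a x := fun a =>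
    funext fun x => pd_const_mul c (hu.differentiableAt_top x) a
  have e2 : ∀ a b, pd (fun x => c * pd u a x) b x = c * pd (pd u a) b x :=
    fun a b => pd_const_mul c ((contDiff_pd hu a).differentiableAt_top x) b
  simp only [lap, e, e2, Fin.sum_univ_two]
  ring

lemma lap_const (c : ℝ) (x : Fin 2 → ℝ) : lap G (fun _ => c) x = 0 := by
  have e : ∀ a : Fin 2, pd (fun _ : Fin 2 → ℝ => c) a = fun _ => 0 := fun a =>
    funext fun x => pd_const c a
  simp [lap, e, pd_const]

lemma hasDerivAt_lap_timePrim {T : ℝ} {f : (Fin 2 → ℝ) × ℝ → ℝ} (hT : 0 < T)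
    (hf : ContDiffOn ℝ (⊤ : ℕ∞) f (univ ×ˢ Icc 0 T)) (x : Fin 2 → ℝ) (t : ℝ) :
    HasDerivAt (fun s => lap G (fun y => timePrim T f (y, s)) x)
      (lap G (fun y => f (y, clamp T t)) x) t := by
  have h1 := fun a => contDiffOn_pd_slice_Icc hT hf a
  have h2 := fun a b => contDiffOn_pd_slice_Icc hT (h1 a) b
  have e : ∀ a s, pd (fun y => timePrim T f (y, s)) a = fun y =>
      timePrim T (fun p => pd (fun y => f (y, p.2)) a p.1) (y, s) := fun a s =>
    funext fun y => pd_timePrim hT hf a y s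
  have e2 := fun a b s => pd_timePrim hT (h1 a) b x s
  simp only [lap, e, e2]
  exact (HasDerivAt.fun_sum fun a _ => HasDerivAt.fun_sum fun b _ =>
    (hasDerivAt_timePrim hT (h2 a b).continuousOn x t).const_mul _).fun_add
    (HasDerivAt.fun_sum fun a _ => (hasDerivAt_timePrim hT (h1 a).continuousOn x t).const_mul _)

end Laplacian

lemma eq_of_hasDerivWithinAt {φ ψ φ' : ℝ → ℝ} {T : ℝ}
    (hφ : ∀ t ∈ Icc 0 T, HasDerivWithinAt φ (φ' t) (Icc 0 T) t)
    (hψ : ∀ t ∈ Icc 0 T, HasDerivWithinAt ψ (φ' t) (Icc 0 T) t) (h0 : φ 0 = ψ 0) :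
    ∀ t ∈ Icc 0 T, φ t = ψ t := by
  intro t ht
  have hd : ∀ s ∈ Icc 0 T, HasDerivWithinAt (fun s => φ s - ψ s) 0 (Icc 0 T) s := fun s hs =>
    ((hφ s hs).fun_sub (hψ s hs)).congr_deriv (sub_self _)
  have k := constant_of_derivWithin_zero (fun s hs => (hd s hs).differentiableWithinAt)
    (fun s hs => (hd s (Ico_subset_Icc_self hs)).derivWithin
      (uniqueDiffOn_Icc (hs.1.trans_lt hs.2) s (Ico_subset_Icc_self hs))) t ht
  linarith

/-- The function `F` with `g(t) = exp(-F) g(0)`. -/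
def logFactor (g : (Fin 2 → ℝ) → ℝ → Matrix (Fin 2) (Fin 2) ℝ) (p : (Fin 2 → ℝ) × ℝ) : ℝ :=
  Real.log (g p.1 0 0 0) - Real.log (g p.1 p.2 0 0)

namespace RicciFlowTwo

variable {g : (Fin 2 → ℝ) → ℝ → Matrix (Fin 2) (Fin 2) ℝ} {T : ℝ}

lemma contDiffOn_logFactor (h : RicciFlowTwo g T) (hT : 0 < T) :
    ContDiffOn ℝ (⊤ : ℕ∞) (logFactor g) (univ ×ˢ Icc 0 T) := by
  have h0 : ContDiff ℝ (⊤ : ℕ∞) fun x => g x 0 0 0 := (h.slice ⟨le_rfl, hT.le⟩).1 0 0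
  refine ContDiffOn.sub ?_ ((h.smooth.1 0 0).log fun p hp => ((h.slice hp.2).diag_pos p.1).ne')
  exact ((h0.comp contDiff_fst).log fun p =>
    ((h.slice ⟨le_rfl, hT.le⟩).diag_pos p.1).ne').contDiffOn

lemma logFactor_zero (x : Fin 2 → ℝ) : logFactor g (x, 0) = 0 := sub_self _

lemma contDiff_logFactor_slice (h : RicciFlowTwo g T) (hT : 0 < T) {t : ℝ} (ht : t ∈ Icc 0 T) :
    ContDiff ℝ (⊤ : ℕ∞) fun y => logFactor g (y, t) :=
  contDiff_slice_Icc (h.contDiffOn_logFactor hT) ht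

lemma hasDerivWithinAt_logFactor (h : RicciFlowTwo g T) (x : Fin 2 → ℝ) {t : ℝ}
    (ht : t ∈ Icc 0 T) :
    HasDerivWithinAt (fun s => logFactor g (x, s)) (2 * curv g (x, t)) (Icc 0 T) t := by
  have hp := ((h.slice ht).diag_pos x).ne'
  refine HasDerivWithinAt.congr_deriv (((h.hasDerivWithinAt_time x ht 0 0).log hp).const_sub
    (Real.log (g x 0 0 0))) ?_
  field_simp

lemma hasDerivAt_logFactor (h : RicciFlowTwo g T) (x : Fin 2 → ℝ) {t : ℝ} (ht : t ∈ Ioo 0 T) :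
    HasDerivAt (fun s => logFactor g (x, s)) (2 * curv g (x, t)) t :=
  (h.hasDerivWithinAt_logFactor x (Ioo_subset_Icc_self ht)).hasDerivAt (Icc_mem_nhds ht.1 ht.2)

lemma exp_neg_logFactor (h : RicciFlowTwo g T) (x : Fin 2 → ℝ) {t : ℝ} (ht : t ∈ Icc 0 T) :
    Real.exp (-logFactor g (x, t)) = g x t 0 0 / g x 0 0 0 := by
  rw [logFactor, neg_sub, Real.exp_sub, Real.exp_log ((h.slice ht).diag_pos x),
    Real.exp_log ((h.slice ⟨le_rfl, ht.1.trans ht.2⟩).diag_pos x)]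

lemma eq_exp_logFactor (h : RicciFlowTwo g T) {t : ℝ} (ht : t ∈ Icc 0 T) (x : Fin 2 → ℝ)
    (a b : Fin 2) : g x t a b = Real.exp (-logFactor g (x, t)) * g x 0 a b := by
  have p0 := ((h.slice ⟨le_rfl, ht.1.trans ht.2⟩).diag_pos x).ne'
  rw [h.exp_neg_logFactor x ht]
  field_simp
  linarith [h.conformal x ht a b]

lemma lap_eq (h : RicciFlowTwo g T) (hT : 0 < T) {t : ℝ} (ht : t ∈ Icc 0 T)
    (u : (Fin 2 → ℝ) → ℝ) (x : Fin 2 → ℝ) : lap (fun y => g y t) u x =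
      Real.exp (logFactor g (x, t)) * lap (fun y => g y 0) u x := by
  have k := SmoothMetric.lap_conformal (h.slice ⟨le_rfl, hT.le⟩) (h.slice ht)
    (h.contDiff_logFactor_slice hT ht).neg (h.eq_exp_logFactor ht) u x
  rwa [neg_neg] at k

lemma curv_eq (h : RicciFlowTwo g T) (hT : 0 < T) {t : ℝ} (ht : t ∈ Icc 0 T) (x : Fin 2 → ℝ) :
    curv g (x, t) = Real.exp (logFactor g (x, t)) *
      (curv g (x, 0) + lap (fun y => g y 0) (fun y => logFactor g (y, t)) x / 2) := by
  have hF := h.contDiff_logFactor_slice hT ht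
  have k := SmoothMetric.gaussCurv_conformal (h.slice ⟨le_rfl, hT.le⟩) hF.neg (h.eq_exp_logFactor ht) x
  have e : lap (fun y => g y 0) (fun y => -logFactor g (y, t)) x =
      -lap (fun y => g y 0) (fun y => logFactor g (y, t)) x := by
    have := lap_const_mul (G := fun y => g y 0) (-1) hF x
    simpa using this
  rw [e, neg_neg] at k
  rw [curv, curv, k]
  ring

lemma lap_logFactor (h : RicciFlowTwo g T) (hT : 0 < T) {t : ℝ} (ht : t ∈ Icc 0 T)
    (x : Fin 2 → ℝ) : lap (fun y => g y 0) (fun y => logFactor g (y, t)) x =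
      2 * Real.exp (-logFactor g (x, t)) * curv g (x, t) - 2 * curv g (x, 0) := by
  have e : Real.exp (-logFactor g (x, t)) * Real.exp (logFactor g (x, t)) = 1 := by
    rw [← Real.exp_add, neg_add_cancel, Real.exp_zero]
  linear_combination -2 * Real.exp (-logFactor g (x, t)) * h.curv_eq hT ht x -
    (2 * curv g (x, 0) + lap (fun y => g y 0) (fun y => logFactor g (y, t)) x) * e

lemma logFactor_eq_timePrim (h : RicciFlowTwo g T) (hT : 0 < T) (x : Fin 2 → ℝ) {t : ℝ}
    (ht : t ∈ Icc 0 T) : logFactor g (x, t) = timePrim T (fun p => 2 * curv g p) (x, t) := by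
  have hc : ContinuousOn (fun p => 2 * curv g p) (univ ×ˢ Icc 0 T) :=
    continuousOn_const.mul (h.contDiffOn_curv hT).continuousOn
  refine eq_of_hasDerivWithinAt (φ := fun t => logFactor g (x, t))
    (ψ := fun t => timePrim T (fun p => 2 * curv g p) (x, t))
    (fun s hs => h.hasDerivWithinAt_logFactor x hs) (fun s hs => ?_)
    ((logFactor_zero x).trans (timePrim_zero x).symm) t ht
  have := hasDerivAt_timePrim hT hc x s
  rw [clamp_of_mem hs] at this
  exact this.hasDerivWithinAt

/-- Evolution of the Gauss curvature. -/
theorem hasDerivAt_curv (h : RicciFlowTwo g T) {t : ℝ} (ht : t ∈ Ioo 0 T) (x : Fin 2 → ℝ) :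
    HasDerivAt (fun s => curv g (x, s))
      (lap (fun y => g y t) (fun y => curv g (y, t)) x + 2 * curv g (x, t) ^ 2) t := by
  have hT : 0 < T := ht.1.trans ht.2
  have ht' := Ioo_subset_Icc_self ht
  have hsm : ContDiffOn ℝ (⊤ : ℕ∞) (fun p => 2 * curv g p) (univ ×ˢ Icc 0 T) :=
    contDiffOn_const.mul (h.contDiffOn_curv hT)
  have d := hasDerivAt_lap_timePrim (G := fun y => g y 0) hT hsm x t
  rw [clamp_of_mem ht', lap_const_mul 2 (contDiff_slice_Icc (h.contDiffOn_curv hT) ht')] at d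
  have k := (h.hasDerivAt_logFactor x ht).exp.fun_mul ((d.div_const 2).const_add (curv g (x, 0)))
  refine (k.congr_of_eventuallyEq ?_).congr_deriv ?_
  · filter_upwards [Icc_mem_nhds ht.1 ht.2] with s hs
    rw [h.curv_eq hT hs]
    simp only [h.logFactor_eq_timePrim hT _ hs]
  · rw [h.lap_eq hT ht']
    have e := h.curv_eq hT ht' x
    simp only [h.logFactor_eq_timePrim hT _ ht'] at e ⊢
    linear_combination (-2) * curv g (x, t) * e

lemma lap_timePrim_logFactor (h : RicciFlowTwo g T) (hT : 0 < T) (x : Fin 2 → ℝ) {t : ℝ}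
    (ht : t ∈ Icc 0 T) :
    lap (fun y => g y 0) (fun y => timePrim T (logFactor g) (y, t)) x =
      1 - Real.exp (-logFactor g (x, t)) - t * (2 * curv g (x, 0)) := by
  refine eq_of_hasDerivWithinAt
    (φ := fun t => lap (fun y => g y 0) (fun y => timePrim T (logFactor g) (y, t)) x)
    (ψ := fun t => 1 - Real.exp (-logFactor g (x, t)) - t * (2 * curv g (x, 0)))
    (φ' := fun s => 2 * Real.exp (-logFactor g (x, s)) * curv g (x, s) - 2 * curv g (x, 0))
    (fun s hs => ?_) (fun s hs => ?_) ?_ t ht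
  · have d := hasDerivAt_lap_timePrim (G := fun y => g y 0) hT (h.contDiffOn_logFactor hT) x s
    rw [clamp_of_mem hs, h.lap_logFactor hT hs] at d
    exact d.hasDerivWithinAt
  · refine ((((h.hasDerivWithinAt_logFactor x hs).fun_neg.exp).const_sub 1).fun_sub
      ((hasDerivWithinAt_id s _).mul_const _)).congr_deriv ?_
    ring
  · simp only [timePrim_zero, lap_const, logFactor_zero]
    simp

end RicciFlowTwo

end LogFactor

section Uniqueness

section PrimitiveBounds

variable {T : ℝ} {f : (Fin n → ℝ) × ℝ → ℝ}

lemma timePrim_le (hT : 0 < T) (hf : ContinuousOn f (univ ×ˢ Icc 0 T)) {x : Fin n → ℝ} {t C : ℝ}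
    (ht : t ∈ Icc 0 T) (hC : ∀ s ∈ Icc 0 t, f (x, s) ≤ C) : timePrim T f (x, t) ≤ t * C := by
  have k := intervalIntegral.integral_mono_on ht.1
    ((continuous_clamped_slice hT hf x).intervalIntegrable (μ := volume) 0 t)
    (intervalIntegrable_const (c := C)) fun s hs => by
      rw [clamp_of_mem ⟨hs.1, hs.2.trans ht.2⟩]
      exact hC s hs
  simpa [timePrim] using k

lemma le_timePrim (hT : 0 < T) (hf : ContinuousOn f (univ ×ˢ Icc 0 T)) {x : Fin n → ℝ} {t C : ℝ}
    (ht : t ∈ Icc 0 T) (hC : ∀ s ∈ Icc 0 t, C ≤ f (x, s)) : t * C ≤ timePrim T f (x, t) := by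
  have k := intervalIntegral.integral_mono_on ht.1 (intervalIntegrable_const (c := C))
    ((continuous_clamped_slice hT hf x).intervalIntegrable (μ := volume) 0 t) fun s hs => by
      rw [clamp_of_mem ⟨hs.1, hs.2.trans ht.2⟩]
      exact hC s hs
  simpa [timePrim] using k

lemma contDiff_timePrim_slice (hf : ContDiffOn ℝ (⊤ : ℕ∞) f (univ ×ˢ Icc 0 T)) {t : ℝ}
    (ht : t ∈ Ioo 0 T) : ContDiff ℝ (⊤ : ℕ∞) fun y => timePrim T f (y, t) :=
  contDiffOn_univ.1 ((contDiffOn_timePrim (ht.1.trans ht.2) hf).comp (f := fun y => (y, t))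
    (by fun_prop) fun _ _ => ⟨mem_univ _, ht⟩)

end PrimitiveBounds

/-- The scalar inequality behind the upper bound for the conformal factor. -/
lemma reaction_le {K₀ lam T' t R₀ F Q a F₀ : ℝ} (hK : 0 < K₀) (hT' : 0 < T') (hKT : K₀ * T' < 1)
    (hlam : lam = 2 * K₀ / (1 - K₀ * T')) (hF₀ : F₀ = max 1 (6 * (1 + 2 * lam) / K₀))
    (ha : a = lam * T' + (1 + lam * T') * F₀) (ht : t ∈ Icc 0 T') (hR : |R₀| ≤ K₀) (hQa : 0 < Q - a)
    (hQ : Q ≤ (1 + lam * T') * F + lam * T') :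
    R₀ * Real.exp F + lam * (F + 1 - (1 - t * R₀) * Real.exp F) ≤
      -(1 / (1 + lam * T') ^ 2) * (Q - a) ^ 2 := by
  have hd : 0 < 1 - K₀ * T' := by linarith
  have hl : 0 < lam := by rw [hlam]; positivity
  have hl' : lam * (1 - K₀ * T') = 2 * K₀ := by rw [hlam]; field_simp
  have hmu : 0 < 1 + lam * T' := by positivity
  have h1 : 1 ≤ F₀ := hF₀ ▸ le_max_left _ _
  have h2 : 6 * (1 + 2 * lam) ≤ F₀ * K₀ := by
    rw [← div_le_iff₀ hK]
    exact hF₀ ▸ le_max_right _ _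
  have hF : F₀ < F := by
    refine lt_of_mul_lt_mul_left ?_ hmu.le
    linarith
  have hexp : F ^ 3 / 6 ≤ Real.exp F := by
    have := Real.pow_div_factorial_le_exp F (by linarith) 3
    simpa [Nat.factorial] using this
  have hRb := abs_le.1 hR
  have htR : t * R₀ ≤ K₀ * T' := by
    have := mul_le_mul ht.2 hR (abs_nonneg R₀) hT'.le
    have h3 := mul_le_mul_of_nonneg_left (le_abs_self R₀) ht.1
    linarith
  have hcoef : 2 * K₀ ≤ lam * (1 - t * R₀) := by
    rw [← hl']
    exact mul_le_mul_of_nonneg_left (by linarith) hl.le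
  have hE := Real.exp_pos F
  have s1 : (R₀ - lam * (1 - t * R₀)) * Real.exp F ≤ -K₀ * Real.exp F :=
    mul_le_mul_of_nonneg_right (by linarith) hE.le
  have s2 : K₀ * (F ^ 3 / 6) ≤ K₀ * Real.exp F := mul_le_mul_of_nonneg_left hexp hK.le
  have s3 : (1 + 2 * lam) * F ^ 2 ≤ K₀ * (F ^ 3 / 6) := by
    have h4 : 6 * (1 + 2 * lam) ≤ F * K₀ := h2.trans (mul_le_mul_of_nonneg_right hF.le hK.le)
    have := mul_le_mul_of_nonneg_right h4 (sq_nonneg F)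
    nlinarith
  have s4 : lam * (F + 1) ≤ lam * (2 * F ^ 2) := by
    refine mul_le_mul_of_nonneg_left ?_ hl.le
    nlinarith
  have s5 : (Q - a) ^ 2 ≤ ((1 + lam * T') * F) ^ 2 := by
    refine pow_le_pow_left₀ hQa.le ?_ 2
    have : 0 < (1 + lam * T') * F₀ := by positivity
    linarith
  have s6 : 1 / (1 + lam * T') ^ 2 * (Q - a) ^ 2 ≤ F ^ 2 := by
    rw [one_div, inv_mul_le_iff₀ (by positivity)]
    rwa [mul_pow] at s5
  nlinarith

namespace RicciFlowTwo

variable {g : (Fin 2 → ℝ) → ℝ → Matrix (Fin 2) (Fin 2) ℝ} {T K₀ : ℝ}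

/-- A lower bound for the scalar curvature is preserved. -/
theorem neg_le_curv (h : RicciFlowTwo g T) (hc : ∀ t ∈ Icc 0 T, riemComplete fun x => g x t)
    (hK : 0 < K₀) (hbd : ∀ x, |2 * curv g (x, 0)| ≤ K₀) {T₁ : ℝ} (hT₁ : T₁ ∈ Ioo 0 T) :
    ∀ x, ∀ t ∈ Icc 0 T₁, -K₀ ≤ 2 * curv g (x, t) := by
  have hT : 0 < T := hT₁.1.trans hT₁.2
  have hs : ContDiffOn ℝ (⊤ : ℕ∞) (fun p => -2 * curv g p + -K₀) (univ ×ˢ Icc 0 T) :=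
    (contDiffOn_const.mul (h.contDiffOn_curv hT)).add contDiffOn_const
  intro x t ht
  have k := h.nonpos_of_subsolution hT₁ (h.uniformlyProper hc 0 hT₁.2.le) (c := 1)
    (hs.mono domain_subset)
    (hs.continuousOn.mono (prod_mono_right (Icc_subset_Icc_right hT₁.2.le)))
    (fun x => by
      have := (abs_le.1 (hbd x)).1
      linarith) one_pos (fun x t ht hpos => by
    have ht' : t ∈ Ioo 0 T := ⟨ht.1, ht.2.trans_lt hT₁.2⟩
    have hk := contDiff_slice_Icc (h.contDiffOn_curv hT) (Ioo_subset_Icc_self ht')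
    rw [(((h.hasDerivAt_curv ht' x).const_mul (-2)).add_const (-K₀)).deriv,
      lap_add (contDiff_const.mul hk) contDiff_const, lap_const_mul _ hk, lap_const]
    nlinarith) x t ht
  linarith

lemma logFactor_sub_ge (h : RicciFlowTwo g T) {T₁ : ℝ} (hT₁ : T₁ ∈ Ioo 0 T)
    (hR : ∀ x, ∀ t ∈ Icc 0 T₁, -K₀ ≤ 2 * curv g (x, t)) (x : Fin 2 → ℝ) {s t : ℝ} (hs : 0 ≤ s)
    (hst : s ≤ t) (ht : t ≤ T₁) : -K₀ * (t - s) ≤ logFactor g (x, t) - logFactor g (x, s) := by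
  have hd : ∀ r ∈ Icc 0 T₁,
      HasDerivWithinAt (fun r => logFactor g (x, r)) (2 * curv g (x, r)) (Icc 0 T₁) r :=
    fun r hr => (h.hasDerivWithinAt_logFactor x ⟨hr.1, hr.2.trans hT₁.2.le⟩).mono
      (Icc_subset_Icc_right hT₁.2.le)
  refine (convex_Icc 0 T₁).mul_sub_le_image_sub_of_le_deriv
    (fun r hr => (hd r hr).continuousWithinAt) (fun r hr => ?_) (fun r hr => ?_) s
    ⟨hs, hst.trans ht⟩ t ⟨hs.trans hst, ht⟩ hst
  · rw [interior_Icc] at hr ⊢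
    exact ((hd r (Ioo_subset_Icc_self hr)).differentiableWithinAt).mono Ioo_subset_Icc_self
  · rw [interior_Icc] at hr
    rw [((hd r (Ioo_subset_Icc_self hr)).hasDerivAt (Icc_mem_nhds hr.1 hr.2)).deriv]
    exact hR x r (Ioo_subset_Icc_self hr)

/-- Before time `1 / K₀` the conformal factor is bounded above and below. -/
theorem exists_abs_logFactor_le (h : RicciFlowTwo g T)
    (hc : ∀ t ∈ Icc 0 T, riemComplete fun x => g x t) (hK : 0 < K₀)
    (hbd : ∀ x, |2 * curv g (x, 0)| ≤ K₀) {T₁ : ℝ} (hT₁ : T₁ ∈ Ioo 0 T) (hKT : K₀ * T₁ < 1) :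
    ∃ M, ∀ x, ∀ t ∈ Icc 0 T₁, |logFactor g (x, t)| ≤ M := by
  have hT : 0 < T := hT₁.1.trans hT₁.2
  have hT₁0 : 0 < T₁ := hT₁.1
  have hR := h.neg_le_curv hc hK hbd hT₁
  have hsub : Icc 0 T₁ ⊆ Icc 0 T := Icc_subset_Icc_right hT₁.2.le
  have hF := h.contDiffOn_logFactor hT
  have hFge : ∀ x, ∀ t ∈ Icc 0 T₁, -1 ≤ logFactor g (x, t) := fun x t ht => by
    have := h.logFactor_sub_ge hT₁ hR x le_rfl ht.1 ht.2
    rw [logFactor_zero] at this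
    have := mul_le_mul_of_nonneg_left ht.2 hK.le
    linarith
  have hUge : ∀ x, ∀ t ∈ Icc 0 T₁, -T₁ ≤ timePrim T (logFactor g) (x, t) := fun x t ht => by
    have := le_timePrim hT hF.continuousOn (hsub ht)
      fun s hs => hFge x s ⟨hs.1, hs.2.trans ht.2⟩
    linarith [ht.2]
  have hUle : ∀ x, ∀ t ∈ Icc 0 T₁,
      timePrim T (logFactor g) (x, t) ≤ T₁ * (logFactor g (x, t) + 1) := fun x t ht => by
    refine (timePrim_le hT hF.continuousOn (hsub ht) (C := logFactor g (x, t) + 1)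
      fun s hs => ?_).trans (mul_le_mul_of_nonneg_right ht.2 (by linarith [hFge x t ht]))
    have h1 := h.logFactor_sub_ge hT₁ hR x hs.1 hs.2 ht.2
    have h2 : K₀ * (t - s) ≤ K₀ * T₁ := mul_le_mul_of_nonneg_left (by linarith [hs.1, ht.2]) hK.le
    linarith
  obtain ⟨lam, hlam⟩ : ∃ lam, lam = 2 * K₀ / (1 - K₀ * T₁) := ⟨_, rfl⟩
  obtain ⟨F₀, hF₀⟩ : ∃ F₀, F₀ = max 1 (6 * (1 + 2 * lam) / K₀) := ⟨_, rfl⟩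
  obtain ⟨a, ha⟩ : ∃ a, a = lam * T₁ + (1 + lam * T₁) * F₀ := ⟨_, rfl⟩
  have hl : 0 < lam := by
    have : 0 < 1 - K₀ * T₁ := by linarith
    rw [hlam]
    positivity
  have ha0 : 0 < a := by
    have : 1 ≤ F₀ := hF₀ ▸ le_max_left _ _
    rw [ha]
    positivity
  have hQ : ∀ x, ∀ t ∈ Icc 0 T₁,
      logFactor g (x, t) + (lam * timePrim T (logFactor g) (x, t) + -a) ≤ 0 := by
    refine h.nonpos_of_subsolution hT₁ (h.uniformlyProper hc 0 hT₁.2.le)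
      (u := fun p => logFactor g p + (lam * timePrim T (logFactor g) p + -a))
      (c := 1 / (1 + lam * T₁) ^ 2)
      ((hF.mono domain_subset).add
        ((contDiffOn_const.mul (contDiffOn_timePrim hT hF)).add contDiffOn_const))
      ((hF.continuousOn.mono (prod_mono_right hsub)).add
        ((continuousOn_const.mul (continuous_timePrim hT hF.continuousOn).continuousOn).add
          continuousOn_const)) (fun x => ?_) (by positivity) fun x t ht hpos => ?_
    · rw [logFactor_zero, timePrim_zero]
      linarith
    · have ht' : t ∈ Ioo 0 T := ⟨ht.1, ht.2.trans_lt hT₁.2⟩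
      have htI : t ∈ Icc 0 T := Ioo_subset_Icc_self ht'
      have htc : t ∈ Icc 0 T₁ := ⟨ht.1.le, ht.2⟩
      have hk := h.contDiff_logFactor_slice hT htI
      have hu := contDiff_timePrim_slice hF ht'
      have d := hasDerivAt_timePrim hT hF.continuousOn x t
      rw [clamp_of_mem htI] at d
      rw [((h.hasDerivAt_logFactor x ht').fun_add ((d.const_mul lam).add_const (-a))).deriv,
        lap_add hk ((contDiff_const.mul hu).add contDiff_const),
        lap_add (contDiff_const.mul hu) contDiff_const, lap_const_mul _ hu, lap_const,
        h.lap_eq hT htI, h.lap_eq hT htI, h.lap_logFactor hT htI, h.lap_timePrim_logFactor hT x htI]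
      have e : Real.exp (-logFactor g (x, t)) * Real.exp (logFactor g (x, t)) = 1 := by
        rw [← Real.exp_add, neg_add_cancel, Real.exp_zero]
      have hUl := mul_le_mul_of_nonneg_left (hUle x t htc) hl.le
      have key := reaction_le (F := logFactor g (x, t))
        (Q := logFactor g (x, t) + lam * timePrim T (logFactor g) (x, t)) hK hT₁0 hKT hlam hF₀ ha
        htc (hbd x) (by linarith) (by linarith)
      refine (le_of_eq ?_).trans (key.trans (le_of_eq ?_))
      · linear_combination (lam - 2 * curv g (x, t)) * e
      · ring
  refine ⟨max 1 (a + lam * T₁), fun x t ht => abs_le.2 ⟨?_, ?_⟩⟩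
  · linarith [hFge x t ht, le_max_left 1 (a + lam * T₁)]
  · have := mul_le_mul_of_nonneg_left (hUge x t ht) hl.le
    linarith [hQ x t ht, le_max_right 1 (a + lam * T₁)]

variable {g₁ g₂ : (Fin 2 → ℝ) → ℝ → Matrix (Fin 2) (Fin 2) ℝ}

/-- Comparison of the time integrals of the conformal factors of two flows. -/
theorem timePrim_logFactor_le (h₁ : RicciFlowTwo g₁ T) (h₂ : RicciFlowTwo g₂ T)
    (hc₂ : ∀ t ∈ Icc 0 T, riemComplete fun x => g₂ x t) (h0 : ∀ x, g₁ x 0 = g₂ x 0) {T₁ M : ℝ}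
    (hT₁ : T₁ ∈ Ioo 0 T) (hM₁ : ∀ x, ∀ t ∈ Icc 0 T₁, |logFactor g₁ (x, t)| ≤ M)
    (hM₂ : ∀ x, ∀ t ∈ Icc 0 T₁, |logFactor g₂ (x, t)| ≤ M) (x : Fin 2 → ℝ) {t : ℝ}
    (ht : t ∈ Icc 0 T₁) : timePrim T (logFactor g₂) (x, t) ≤ timePrim T (logFactor g₁) (x, t) := by
  have hT : 0 < T := hT₁.1.trans hT₁.2
  have hT₁0 : 0 < T₁ := hT₁.1
  have hsub : Icc 0 T₁ ⊆ Icc 0 T := Icc_subset_Icc_right hT₁.2.le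
  have hF₁ := h₁.contDiffOn_logFactor hT
  have hF₂ := h₂.contDiffOn_logFactor hT
  have hG : (fun y => g₁ y 0) = fun y => g₂ y 0 := funext h0
  have hM : 0 ≤ M := (abs_nonneg _).trans (hM₁ x t ht)
  set B := 2 * T₁ * M + 1 with hB
  have hBpos : 0 < B := by positivity
  have hV : ∀ x, ∀ t ∈ Icc 0 T₁,
      timePrim T (logFactor g₂) (x, t) - timePrim T (logFactor g₁) (x, t) ≤ B := fun x t ht => by
    have k₂ := timePrim_le hT hF₂.continuousOn (hsub ht) (x := x)
      fun s hs => (abs_le.1 (hM₂ x s ⟨hs.1, hs.2.trans ht.2⟩)).2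
    have k₁ := le_timePrim hT hF₁.continuousOn (hsub ht) (x := x)
      fun s hs => (abs_le.1 (hM₁ x s ⟨hs.1, hs.2.trans ht.2⟩)).1
    have := mul_le_mul_of_nonneg_right ht.2 hM
    linarith
  have key : ∀ δ > 0, timePrim T (logFactor g₂) (x, t) +
      (-1 * timePrim T (logFactor g₁) (x, t) + -δ * t) ≤ 0 := by
    intro δ hδ
    refine h₂.nonpos_of_subsolution hT₁ (h₂.uniformlyProper hc₂ 0 hT₁.2.le)
      (u := fun p => timePrim T (logFactor g₂) p + (-1 * timePrim T (logFactor g₁) p + -δ * p.2))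
      (c := δ / B ^ 2)
      ((contDiffOn_timePrim hT hF₂).add ((contDiffOn_const.mul (contDiffOn_timePrim hT hF₁)).add
        (contDiffOn_const.mul contDiffOn_snd)))
      (((continuous_timePrim hT hF₂.continuousOn).add
        ((continuous_const.mul (continuous_timePrim hT hF₁.continuousOn)).add
          (continuous_const.mul continuous_snd))).continuousOn) (fun x => ?_) (by positivity)
      (fun x t ht hpos => ?_) x t ht
    · simp only [timePrim_zero]
      simp
    · have ht' : t ∈ Ioo 0 T := ⟨ht.1, ht.2.trans_lt hT₁.2⟩
      have htI : t ∈ Icc 0 T := Ioo_subset_Icc_self ht'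
      have hu₁ := contDiff_timePrim_slice hF₁ ht'
      have hu₂ := contDiff_timePrim_slice hF₂ ht'
      have d₁ := hasDerivAt_timePrim hT hF₁.continuousOn x t
      have d₂ := hasDerivAt_timePrim hT hF₂.continuousOn x t
      rw [clamp_of_mem htI] at d₁ d₂
      have l₁ := h₁.lap_timePrim_logFactor hT x htI
      have c0 : curv g₁ (x, 0) = curv g₂ (x, 0) := by simp only [curv, hG]
      rw [hG, c0] at l₁
      dsimp only at hpos ⊢
      rw [(d₂.fun_add ((d₁.const_mul (-1)).fun_add ((hasDerivAt_id' t).const_mul (-δ)))).deriv,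
        lap_add hu₂ ((contDiff_const.mul hu₁).add contDiff_const),
        lap_add (contDiff_const.mul hu₁) contDiff_const, lap_const_mul _ hu₁, lap_const,
        h₂.lap_eq hT htI, h₂.lap_eq hT htI, h₂.lap_timePrim_logFactor hT x htI, l₁]
      have e₁ : Real.exp (logFactor g₂ (x, t)) * Real.exp (-logFactor g₁ (x, t)) =
          Real.exp (logFactor g₂ (x, t) - logFactor g₁ (x, t)) := by
        rw [← Real.exp_add, sub_eq_add_neg]
      have e₂ : Real.exp (logFactor g₂ (x, t)) * Real.exp (-logFactor g₂ (x, t)) = 1 := by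
        rw [← Real.exp_add, add_neg_cancel, Real.exp_zero]
      have hexp := Real.add_one_le_exp (logFactor g₂ (x, t) - logFactor g₁ (x, t))
      have hWB : timePrim T (logFactor g₂) (x, t) +
          (-1 * timePrim T (logFactor g₁) (x, t) + -δ * t) ≤ B := by
        have := hV x t ⟨ht.1.le, ht.2⟩
        have := mul_pos hδ ht.1
        linarith
      have hsq := pow_le_pow_left₀ hpos.le hWB 2
      have hq : δ / B ^ 2 * (timePrim T (logFactor g₂) (x, t) +
          (-1 * timePrim T (logFactor g₁) (x, t) + -δ * t)) ^ 2 ≤ δ := by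
        rw [div_mul_eq_mul_div, div_le_iff₀ (by positivity)]
        exact mul_le_mul_of_nonneg_left hsq hδ.le
      linarith
  have hlim : timePrim T (logFactor g₂) (x, t) - timePrim T (logFactor g₁) (x, t) ≤ 0 := by
    refine le_of_forall_pos_le_add fun ε hε => ?_
    have k := key (ε / T₁) (by positivity)
    have : ε / T₁ * t ≤ ε := by
      rw [div_mul_eq_mul_div, div_le_iff₀ hT₁0]
      exact mul_le_mul_of_nonneg_left ht.2 hε.le
    linarith
  linarith

/-- Complete two-dimensional flows with the same initial metric agree before time `1 / K₀`. -/
theorem eq_of_eq_zero (h₁ : RicciFlowTwo g₁ T) (h₂ : RicciFlowTwo g₂ T)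
    (hc₁ : ∀ t ∈ Icc 0 T, riemComplete fun x => g₁ x t)
    (hc₂ : ∀ t ∈ Icc 0 T, riemComplete fun x => g₂ x t) (h0 : ∀ x, g₁ x 0 = g₂ x 0) (hK : 0 < K₀)
    (hbd : ∀ x, |2 * curv g₁ (x, 0)| ≤ K₀) (x : Fin 2 → ℝ) {t : ℝ}
    (ht : t ∈ Ioo 0 (min T (1 / K₀))) : g₁ x t = g₂ x t := by
  obtain ⟨T₁, htT₁, hT₁⟩ := exists_between ht.2
  have hT₁I : T₁ ∈ Ioo 0 T := ⟨ht.1.trans htT₁, hT₁.trans_le (min_le_left _ _)⟩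
  have hT : 0 < T := hT₁I.1.trans hT₁I.2
  have hKT : K₀ * T₁ < 1 := by
    have := hT₁.trans_le (min_le_right _ _)
    rwa [lt_div_iff₀ hK, mul_comm] at this
  have hbd₂ : ∀ x, |2 * curv g₂ (x, 0)| ≤ K₀ := fun x => by
    have e : curv g₂ (x, 0) = curv g₁ (x, 0) := by simp only [curv, funext h0]
    rw [e]
    exact hbd x
  obtain ⟨M₁, hM₁⟩ := h₁.exists_abs_logFactor_le hc₁ hK hbd hT₁I hKT
  obtain ⟨M₂, hM₂⟩ := h₂.exists_abs_logFactor_le hc₂ hK hbd₂ hT₁I hKT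
  have b₁ : ∀ x, ∀ t ∈ Icc 0 T₁, |logFactor g₁ (x, t)| ≤ max M₁ M₂ := fun x t ht =>
    (hM₁ x t ht).trans (le_max_left _ _)
  have b₂ : ∀ x, ∀ t ∈ Icc 0 T₁, |logFactor g₂ (x, t)| ≤ max M₁ M₂ := fun x t ht =>
    (hM₂ x t ht).trans (le_max_right _ _)
  have hU : ∀ s ∈ Icc 0 T₁,
      timePrim T (logFactor g₁) (x, s) = timePrim T (logFactor g₂) (x, s) := fun s hs =>
    le_antisymm (timePrim_logFactor_le h₂ h₁ hc₁ (fun x => (h0 x).symm) hT₁I b₂ b₁ x hs)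
      (timePrim_logFactor_le h₁ h₂ hc₂ h0 hT₁I b₁ b₂ x hs)
  have htI : t ∈ Icc 0 T := ⟨ht.1.le, (htT₁.trans hT₁I.2).le⟩
  have hF : logFactor g₁ (x, t) = logFactor g₂ (x, t) := by
    have d₁ := hasDerivAt_timePrim hT (h₁.contDiffOn_logFactor hT).continuousOn x t
    have d₂ := hasDerivAt_timePrim hT (h₂.contDiffOn_logFactor hT).continuousOn x t
    rw [clamp_of_mem htI] at d₁ d₂
    refine d₁.unique (d₂.congr_of_eventuallyEq ?_)
    filter_upwards [Icc_mem_nhds ht.1 htT₁] with s hs using hU s hs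
  ext a b
  rw [h₁.eq_exp_logFactor htI, h₂.eq_exp_logFactor htI, hF, h0]

end RicciFlowTwo

end Uniqueness

/-- Strong uniqueness of two dimensional Ricci flow (Theorem 3.10). -/
theorem stmt_16 (K₀ v₀ : ℝ) (hK₀ : 0 < K₀) (hv₀ : 0 < v₀) (T : ℝ)
    (g0 : (Fin 2 → ℝ) → Matrix (Fin 2) (Fin 2) ℝ)
    (hg0 : SmoothMetric g0) (hg0c : riemComplete g0)
    (hbd : ∀ x, |scalarCurv g0 x| ≤ K₀)
    (hvol : ∀ x : Fin 2 → ℝ, v₀ ≤ riemVol g0 (rBall g0 x 1))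
    (g₁ g₂ : (Fin 2 → ℝ) → ℝ → Matrix (Fin 2) (Fin 2) ℝ)
    (hg₁ : SmoothMetricFamily g₁ (Icc 0 T)) (hg₂ : SmoothMetricFamily g₂ (Icc 0 T))
    (hf₁ : IsRicciFlow g₁ (Icc 0 T)) (hf₂ : IsRicciFlow g₂ (Icc 0 T))
    (hc₁ : ∀ t ∈ Icc (0:ℝ) T, riemComplete (fun x => g₁ x t))
    (hc₂ : ∀ t ∈ Icc (0:ℝ) T, riemComplete (fun x => g₂ x t))
    (hinit₁ : ∀ x, g₁ x 0 = g0 x) (hinit₂ : ∀ x, g₂ x 0 = g0 x) :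
    ∀ x, ∀ t : ℝ, 0 ≤ t → t ≤ min T (1/K₀) → g₁ x t = g₂ x t := by
  intro x t ht0 htm
  have h0 : ∀ x, g₁ x 0 = g₂ x 0 := fun x => (hinit₁ x).trans (hinit₂ x).symm
  rcases ht0.eq_or_lt with rfl | htpos
  · exact h0 x
  have hbd' : ∀ x, |2 * curv g₁ (x, 0)| ≤ K₀ := fun x => by
    have e : (fun y => g₁ y 0) = g0 := funext hinit₁
    have := hbd x
    rw [hg0.scalarCurv_eq] at this
    simpa only [curv, e] using this
  have hsub : Icc 0 (min T (1 / K₀)) ⊆ Icc 0 T := Icc_subset_Icc_right (min_le_left _ _)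
  have hcont : ∀ g : (Fin 2 → ℝ) → ℝ → Matrix (Fin 2) (Fin 2) ℝ,
      SmoothMetricFamily g (Icc 0 T) → ∀ a b,
        ContinuousOn (fun s => g x s a b) (Icc 0 (min T (1 / K₀))) := fun g hg a b =>
    (hg.1 a b).continuousOn.comp (by fun_prop : Continuous fun s : ℝ => (x, s)).continuousOn
      fun s hs => ⟨mem_univ _, hsub hs⟩
  ext a b
  refine EqOn.of_subset_closure (s := Ioo 0 (min T (1 / K₀))) (fun s hs => ?_) (hcont g₁ hg₁ a b)
    (hcont g₂ hg₂ a b) Ioo_subset_Icc_self (closure_Ioo (htpos.trans_le htm).ne).ge ⟨ht0, htm⟩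
  have := RicciFlowTwo.eq_of_eq_zero ⟨hg₁, hf₁⟩ ⟨hg₂, hf₂⟩ hc₁ hc₂ h0 hK₀ hbd' x hs
  exact congrFun (congrFun this a) b

end
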